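/- Let n satisfy 1 ≤ n < ω. For every Π_{n+1} TCI 𝔗 there are a Σ_n TCI 𝔗' and a formula θ of the language of set theory with two free variables such that θ is absolute for outer models of V, and in every outer model of V, θ defines a bijection from the set of models of 𝔗 onto the set of models of 𝔗'. -/

import Mathlib

/-!
Common formalization layer for "Small extensions of set-theoretic universes".

We work with `ZFSet`, Mathlib's type of ZFC sets.  A "universe" `V` is a
`ZFSet` which is a (countable) transitive model of ZFC, where satisfaction
of ZFC is spelled out via an explicit first-order syntax `Fm` for languages
whose symbols are named by ZFC sets, together with a Tarskian satisfaction
predicate `Sat`.  TCIs (theories with constraints in interpretation), their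
models, the forcings `ℙ(𝔗)`, derivative forcings, generic filters, the
evaluation map `Eval^V`, local method definitions and the reducibility
relation `≤^M` are all defined below, following the paper.
-/

noncomputable section

namespace SmallExt

open Classical

attribute [local instance] Classical.propDecidable

instance : Nonempty ZFSet := ⟨∅⟩

/-! ### basic coding machinery -/

/-- Kuratowski ordered pair. -/
def opair (a b : ZFSet) : ZFSet := ZFSet.pair a b

/-- First projection of a Kuratowski pair. -/
def zfst (x : ZFSet) : ZFSet := ZFSet.sUnion (ZFSet.sInter x)

/-- Second projection of a Kuratowski pair. -/
def zsnd (x : ZFSet) : ZFSet :=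
  ZFSet.sUnion
    (ZFSet.sep (fun y => ZFSet.sUnion x ≠ ZFSet.sInter x → y ∉ ZFSet.sInter x) (ZFSet.sUnion x))

/-- The `n`-th von Neumann natural, as a ZFC set. -/
def natZ : ℕ → ZFSet
  | 0 => ∅
  | n + 1 => insert (natZ n) (natZ n)

/-- Internal coding of a finite list as an iterated pair (`[a] ↦ a`), so that
`ztuple` of a list of length `n` is a member of the `n`-th cartesian power. -/
def ztuple : List ZFSet → ZFSet
  | [] => ∅
  | [a] => a
  | a :: b :: l => opair a (ztuple (b :: l))

/-- Internal coding of a finite list as an iterated pair, with end marker `∅`. -/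
def zlist : List ZFSet → ZFSet
  | [] => ∅
  | a :: l => opair a (zlist l)

/-- `n`-th cartesian power of a ZFC set (with `z^1 = z`, as in the paper). -/
def ZPow (z : ZFSet) : ℕ → ZFSet
  | 0 => {∅}
  | 1 => z
  | n + 2 => ZFSet.prod z (ZPow z (n + 1))

/-- Decode an internal `n`-tuple into a list. -/
def decodeTuple : ℕ → ZFSet → List ZFSet
  | 0, _ => []
  | 1, t => [t]
  | n + 2, t => zfst t :: decodeTuple (n + 1) (zsnd t)

/-- Image of a ZFC set under an arbitrary (classically definable) function. -/
def zimage (f : ZFSet → ZFSet) (x : ZFSet) : ZFSet :=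
  @ZFSet.image f (Classical.allZFSetDefinable _) x

/-- The set of finite subsets of a ZFC set. -/
def finSubsets (A : ZFSet) : ZFSet :=
  ZFSet.sep (fun p => p.toSet.Finite) (ZFSet.powerset A)

/-- Application of a set-coded function (a set of ordered pairs) to an argument. -/
def iapp (I s : ZFSet) : ZFSet := Classical.epsilon fun v => opair s v ∈ I

/-- `f` is a set-coded function with domain `d`. -/
def IsZFunc (f d : ZFSet) : Prop :=
  (∀ q ∈ f, ∃ s v, q = opair s v ∧ s ∈ d) ∧ ∀ s ∈ d, ∃! v, opair s v ∈ f

/-- `j` is (the code of) an injective function from `a` into `b`. -/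
def ZInjFun (j a b : ZFSet) : Prop :=
  IsZFunc j a ∧ (∀ s ∈ a, iapp j s ∈ b) ∧
    ∀ s ∈ a, ∀ s' ∈ a, iapp j s = iapp j s' → s = s'

/-- Von Neumann ordinals: transitive sets of transitive sets. -/
def IsOrd (x : ZFSet) : Prop := x.IsTransitive ∧ ∀ y ∈ x, ZFSet.IsTransitive y

/-- `t` is the transitive closure of `a`. -/
def IsTrclOf (a t : ZFSet) : Prop :=
  a ⊆ t ∧ t.IsTransitive ∧ ∀ u, a ⊆ u → u.IsTransitive → t ⊆ u

/-! ### first-order syntax over set-named signatures -/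

/-- Terms: de Bruijn variables, set parameters, and applications of
function symbols (named by ZFC sets; constants are `0`-ary functions). -/
inductive Tm : Type 1
  | var : ℕ → Tm
  | param : ZFSet.{0} → Tm
  | func : ZFSet.{0} → (n : ℕ) → (Fin n → Tm) → Tm

/-- First-order formulas over set-named signatures (with equality). -/
inductive Fm : Type 1
  | rel : ZFSet.{0} → (n : ℕ) → (Fin n → Tm) → Fm
  | eq : Tm → Tm → Fm
  | not : Fm → Fm
  | imp : Fm → Fm → Fm
  | all : Fm → Fm
  | ex : Fm → Fm

/-- Derived conjunction. -/
def Fm.and (f g : Fm) : Fm := Fm.not (Fm.imp f (Fm.not g))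

/-- Derived disjunction. -/
def Fm.or (f g : Fm) : Fm := Fm.imp (Fm.not f) g

/-- Derived biconditional. -/
def Fm.iff (f g : Fm) : Fm := Fm.and (Fm.imp f g) (Fm.imp g f)

/-- Evaluation of terms. -/
def Tm.eval (fI : ZFSet → List ZFSet → ZFSet) (v : ℕ → ZFSet) : Tm → ZFSet
  | Tm.var n => v n
  | Tm.param a => a
  | Tm.func s n a => fI s (List.ofFn fun i => Tm.eval fI v (a i))

/-- Prepend a value to a valuation (for quantifiers). -/
def vcons (z : ZFSet) (v : ℕ → ZFSet) : ℕ → ZFSet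
  | 0 => z
  | n + 1 => v n

/-- Tarskian satisfaction, parametrized by a class domain `domP`, an
interpretation `rI` of the relation symbols and `fI` of the function symbols. -/
def Sat (domP : ZFSet → Prop) (rI : ZFSet → List ZFSet → Prop)
    (fI : ZFSet → List ZFSet → ZFSet) : Fm → (ℕ → ZFSet) → Prop
  | Fm.rel s n a, v => rI s (List.ofFn fun i => Tm.eval fI v (a i))
  | Fm.eq t u, v => Tm.eval fI v t = Tm.eval fI v u
  | Fm.not f, v => ¬ Sat domP rI fI f v
  | Fm.imp f g, v => Sat domP rI fI f v → Sat domP rI fI g v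
  | Fm.all f, v => ∀ z, domP z → Sat domP rI fI f (vcons z v)
  | Fm.ex f, v => ∃ z, domP z ∧ Sat domP rI fI f (vcons z v)

/-- Free variables of a term. -/
def Tm.free : Tm → Set ℕ
  | Tm.var n => {n}
  | Tm.param _ => ∅
  | Tm.func _ _ a => {m | ∃ i, m ∈ Tm.free (a i)}

/-- Free variables of a formula (de Bruijn). -/
def Fm.free : Fm → Set ℕ
  | Fm.rel _ _ a => {m | ∃ i, m ∈ Tm.free (a i)}
  | Fm.eq t u => Tm.free t ∪ Tm.free u
  | Fm.not f => Fm.free f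
  | Fm.imp f g => Fm.free f ∪ Fm.free g
  | Fm.all f => {m | m + 1 ∈ Fm.free f}
  | Fm.ex f => {m | m + 1 ∈ Fm.free f}

/-- Set parameters occurring in a term. -/
def Tm.paramSet : Tm → Set ZFSet
  | Tm.var _ => ∅
  | Tm.param a => {a}
  | Tm.func _ _ a => {b | ∃ i, b ∈ Tm.paramSet (a i)}

/-- Set parameters occurring in a formula. -/
def Fm.paramSet : Fm → Set ZFSet
  | Fm.rel _ _ a => {b | ∃ i, b ∈ Tm.paramSet (a i)}
  | Fm.eq t u => Tm.paramSet t ∪ Tm.paramSet u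
  | Fm.not f => Fm.paramSet f
  | Fm.imp f g => Fm.paramSet f ∪ Fm.paramSet g
  | Fm.all f => Fm.paramSet f
  | Fm.ex f => Fm.paramSet f

/-- Quantifier-free formulas. -/
def IsQF : Fm → Prop
  | Fm.rel _ _ _ => True
  | Fm.eq _ _ => True
  | Fm.not f => IsQF f
  | Fm.imp f g => IsQF f ∧ IsQF g
  | Fm.all _ => False
  | Fm.ex _ => False

mutual
  /-- `Π_n` formulas (prenex, with possibly empty quantifier blocks). -/
  inductive IsPi : ℕ → Fm → Prop where
    | qf {f} : IsQF f → IsPi 0 f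
    | ofSigma {n f} : IsSigma n f → IsPi (n + 1) f
    | all {n f} : IsPi (n + 1) f → IsPi (n + 1) (Fm.all f)

  /-- `Σ_n` formulas (prenex, with possibly empty quantifier blocks). -/
  inductive IsSigma : ℕ → Fm → Prop where
    | qf {f} : IsQF f → IsSigma 0 f
    | ofPi {n f} : IsPi n f → IsSigma (n + 1) f
    | ex {n f} : IsSigma (n + 1) f → IsSigma (n + 1) (Fm.ex f)
end

/-! ### the language of set theory and ZFC -/

/-- The name of the membership relation symbol. -/
def memSym : ZFSet := natZ 0

/-- The standard interpretation of `∈`. -/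
def memRel : ZFSet → List ZFSet → Prop :=
  fun s args => s = memSym ∧ ∃ a b, args = [a, b] ∧ a ∈ b

/-- Satisfaction in the ∈-structure with domain `M` (a ZFC set). -/
def SatV (M : ZFSet) (f : Fm) (v : ℕ → ZFSet) : Prop :=
  Sat (· ∈ M) memRel (fun _ _ => ∅) f v

/-- Satisfaction in the ambient (class-sized) ∈-structure. -/
def SatU (f : Fm) (v : ℕ → ZFSet) : Prop :=
  Sat (fun _ => True) memRel (fun _ _ => ∅) f v

/-- Atomic membership formula between de Bruijn variables. -/
def mem2 (i j : ℕ) : Fm := Fm.rel memSym 2 ![Tm.var i, Tm.var j]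

/-- Equality between de Bruijn variables. -/
def eq2 (i j : ℕ) : Fm := Fm.eq (Tm.var i) (Tm.var j)

/-- Terms that are plain variables or parameters. -/
def Tm.noFunc : Tm → Prop
  | Tm.var _ => True
  | Tm.param _ => True
  | Tm.func _ _ _ => False

/-- Formulas of the language of set theory (only `∈`, binary, no function
symbols; parameters allowed). -/
def Fm.memOnly : Fm → Prop
  | Fm.rel s n a => s = memSym ∧ n = 2 ∧ ∀ i, Tm.noFunc (a i)
  | Fm.eq t u => Tm.noFunc t ∧ Tm.noFunc u
  | Fm.not f => Fm.memOnly f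
  | Fm.imp f g => Fm.memOnly f ∧ Fm.memOnly g
  | Fm.all f => Fm.memOnly f
  | Fm.ex f => Fm.memOnly f

/-- Iterated universal closure. -/
def allClose : ℕ → Fm → Fm
  | 0, f => f
  | k + 1, f => allClose k (Fm.all f)

/-- Extensionality. -/
def extAx : Fm :=
  Fm.all (Fm.all (Fm.imp (Fm.all (Fm.iff (mem2 0 2) (mem2 0 1))) (eq2 1 0)))

/-- Pairing. -/
def pairAx : Fm := Fm.all (Fm.all (Fm.ex (Fm.and (mem2 2 0) (mem2 1 0))))

/-- Union. -/
def unionAx : Fm :=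
  Fm.all (Fm.ex (Fm.all (Fm.all (Fm.imp (Fm.and (mem2 1 0) (mem2 0 3)) (mem2 1 2)))))

/-- Power set. -/
def powAx : Fm :=
  Fm.all (Fm.ex (Fm.all (Fm.imp (Fm.all (Fm.imp (mem2 0 1) (mem2 0 3))) (mem2 0 1))))

/-- Infinity. -/
def infAx : Fm :=
  Fm.ex (Fm.and
    (Fm.ex (Fm.and (mem2 0 1) (Fm.all (Fm.not (mem2 0 1)))))
    (Fm.all (Fm.imp (mem2 0 1)
      (Fm.ex (Fm.and (mem2 0 2) (Fm.and (mem2 1 0)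
        (Fm.all (Fm.iff (mem2 0 1) (Fm.or (mem2 0 2) (eq2 0 2))))))))))

/-- Foundation. -/
def fundAx : Fm :=
  Fm.all (Fm.imp (Fm.ex (mem2 0 1))
    (Fm.ex (Fm.and (mem2 0 1) (Fm.all (Fm.imp (mem2 0 1) (Fm.not (mem2 0 2)))))))

/-- Choice (for families of nonempty pairwise disjoint sets). -/
def choiceAx : Fm :=
  Fm.all (Fm.imp
    (Fm.and
      (Fm.all (Fm.imp (mem2 0 1) (Fm.ex (mem2 0 1))))
      (Fm.all (Fm.all (Fm.imp
        (Fm.and (mem2 1 2) (Fm.and (mem2 0 2) (Fm.ex (Fm.and (mem2 0 2) (mem2 0 1)))))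
        (eq2 1 0)))))
    (Fm.ex (Fm.all (Fm.imp (mem2 0 2)
      (Fm.ex (Fm.and (mem2 0 1) (Fm.and (mem2 0 2)
        (Fm.all (Fm.imp (Fm.and (mem2 0 2) (mem2 0 3)) (eq2 0 1))))))))))

/-- Body of a separation instance: `∀x ∃s ∀z (z ∈ s ↔ z ∈ x ∧ φ)`,
where in `φ` the variable `0` is `z`, `2` is `x`, and `≥ 3` are parameters. -/
def sepBody (φ : Fm) : Fm :=
  Fm.all (Fm.ex (Fm.all (Fm.iff (mem2 0 1) (Fm.and (mem2 0 2) φ))))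

/-- Body of a collection instance: `∀a ∃b ∀x∈a (∃y φ → ∃y∈b φ)`,
where in `φ` the variable `0` is `y`, `1` is `x`, `3` is `a`, and `≥ 4` are parameters. -/
def repBody (φ : Fm) : Fm :=
  Fm.all (Fm.ex (Fm.all (Fm.imp (mem2 0 2)
    (Fm.imp (Fm.ex φ) (Fm.ex (Fm.and (mem2 0 2) φ))))))

/-- The ZFC axioms, as a set of sentences of the language of set theory. -/
def ZFCax : Set Fm :=
  {extAx, pairAx, unionAx, powAx, infAx, fundAx, choiceAx} ∪
    {f | ∃ k φ, Fm.memOnly φ ∧ Fm.paramSet φ = ∅ ∧ 1 ∉ Fm.free φ ∧ f = allClose k (sepBody φ)} ∪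
    {f | ∃ k φ, Fm.memOnly φ ∧ Fm.paramSet φ = ∅ ∧ 2 ∉ Fm.free φ ∧ f = allClose k (repBody φ)}

/-- `M` is an ∈-model of ZFC. -/
def SatZFC (M : ZFSet) : Prop := ∀ f ∈ ZFCax, SatV M f (fun _ => ∅)

/-- A transitive model of ZFC. -/
def IsTransModel (M : ZFSet) : Prop := M.IsTransitive ∧ SatZFC M

/-- A countable transitive model of ZFC. -/
def IsCTM (M : ZFSet) : Prop := IsTransModel M ∧ M.toSet.Countable

/-- `W` is an outer model of `U`: both are CTMs, `U ⊆ W`, and they have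
the same ordinals. -/
def OuterModel (U W : ZFSet) : Prop :=
  IsCTM U ∧ IsCTM W ∧ U ⊆ W ∧ ∀ y ∈ W, IsOrd y → y ∈ U

/-- `W = U[m]`: `W` is an outer model of `U` and the smallest CTM
containing `U` as a subset and `m` as an element. -/
def Generates (U m W : ZFSet) : Prop :=
  OuterModel U W ∧ m ∈ W ∧ ∀ W', IsCTM W' → U ⊆ W' → m ∈ W' → W ⊆ W'

/-- `W` is a small extension of `U`. -/
def IsSmallExt (U W : ZFSet) : Prop :=
  OuterModel U W ∧ ∃ m ∈ W, ∀ W', IsCTM W' → U ⊆ W' → m ∈ W' → W ⊆ W'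

/-- `k` is a cardinal from the point of view of the model `U`: an ordinal
with no `U`-internal injection into a smaller ordinal. -/
def IsCardinalIn (U k : ZFSet) : Prop :=
  k ∈ U ∧ IsOrd k ∧ ∀ b ∈ k, ¬ ∃ j ∈ U, ZInjFun j k b

end SmallExt
namespace SmallExt

attribute [local instance] Classical.propDecidable

/-! ### Theories with constraints in interpretation (TCIs) -/

/-- Coding of terms as ZFC sets. -/
def TmCode : Tm → ZFSet
  | Tm.var n => opair (natZ 0) (natZ n)
  | Tm.param a => opair (natZ 1) a
  | Tm.func s n a => opair (natZ 2) (opair s (zlist (List.ofFn fun i => TmCode (a i))))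

/-- Coding of formulas as ZFC sets (the code of `¬ f` is `⟨2, code f⟩`). -/
def FmCode : Fm → ZFSet
  | Fm.rel s n a => opair (natZ 0) (opair s (zlist (List.ofFn fun i => TmCode (a i))))
  | Fm.eq t u => opair (natZ 1) (opair (TmCode t) (TmCode u))
  | Fm.not f => opair (natZ 2) (FmCode f)
  | Fm.imp f g => opair (natZ 3) (opair (FmCode f) (FmCode g))
  | Fm.all f => opair (natZ 4) (FmCode f)
  | Fm.ex f => opair (natZ 5) (FmCode f)

/-- The first component of a TCI `⟨T, σ, U̇, ϑ⟩`: its theory. -/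
def tciT (x : ZFSet) : ZFSet := zfst x

/-- The signature `σ` of a TCI. -/
def tciSig (x : ZFSet) : ZFSet := zfst (zsnd x)

/-- The distinguished unary relation symbol `U̇` of a TCI. -/
def tciUdot (x : ZFSet) : ZFSet := zfst (zsnd (zsnd x))

/-- The interpretation constraint map `ϑ` of a TCI. -/
def tciTheta (x : ZFSet) : ZFSet := zsnd (zsnd (zsnd x))

/-- Symbols are coded as `⟨kind, ⟨arity, name⟩⟩` with kind `0` (relation),
`1` (function) or `2` (constant). -/
def symKind (s : ZFSet) : ZFSet := zfst s

/-- The (internal) arity of a symbol. -/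
def symArity (s : ZFSet) : ZFSet := zfst (zsnd s)

/-- A well-formed symbol. -/
def IsSymbol (s : ZFSet) : Prop :=
  ∃ k a nm, s = opair k (opair a nm) ∧ (k = natZ 0 ∨ k = natZ 1 ∨ k = natZ 2) ∧ ∃ n : ℕ, a = natZ n

/-- Decode an internal von Neumann natural. -/
def zToNat (a : ZFSet) : ℕ := if h : ∃ n, natZ n = a then h.choose else 0

/-- The arity of a symbol, as a natural number. -/
def arityOf (s : ZFSet) : ℕ := zToNat (symArity s)

/-- A term uses only symbols of the signature `σ` (with correct kinds and
arities) and no parameters. -/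
def Tm.usesSig (σ : ZFSet) : Tm → Prop
  | Tm.var _ => True
  | Tm.param _ => False
  | Tm.func s n a => s ∈ σ ∧
      ((symKind s = natZ 1 ∧ symArity s = natZ n) ∨ (symKind s = natZ 2 ∧ n = 0)) ∧
      ∀ i, Tm.usesSig σ (a i)

/-- A formula over the signature `σ` (no parameters). -/
def Fm.usesSig (σ : ZFSet) : Fm → Prop
  | Fm.rel s n a => s ∈ σ ∧ symKind s = natZ 0 ∧ symArity s = natZ n ∧ ∀ i, Tm.usesSig σ (a i)
  | Fm.eq t u => Tm.usesSig σ t ∧ Tm.usesSig σ u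
  | Fm.not f => Fm.usesSig σ f
  | Fm.imp f g => Fm.usesSig σ f ∧ Fm.usesSig σ g
  | Fm.all f => Fm.usesSig σ f
  | Fm.ex f => Fm.usesSig σ f

/-- Same as `Fm.usesSig` but allowing set parameters (used for literals
with parameters). -/
def Tm.usesSigP (σ : ZFSet) : Tm → Prop
  | Tm.var _ => True
  | Tm.param _ => True
  | Tm.func s n a => s ∈ σ ∧
      ((symKind s = natZ 1 ∧ symArity s = natZ n) ∨ (symKind s = natZ 2 ∧ n = 0)) ∧
      ∀ i, Tm.usesSigP σ (a i)

/-- A formula over the signature `σ`, allowing set parameters. -/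
def Fm.usesSigP (σ : ZFSet) : Fm → Prop
  | Fm.rel s n a => s ∈ σ ∧ symKind s = natZ 0 ∧ symArity s = natZ n ∧ ∀ i, Tm.usesSigP σ (a i)
  | Fm.eq t u => Tm.usesSigP σ t ∧ Tm.usesSigP σ u
  | Fm.not f => Fm.usesSigP σ f
  | Fm.imp f g => Fm.usesSigP σ f ∧ Fm.usesSigP σ g
  | Fm.all f => Fm.usesSigP σ f
  | Fm.ex f => Fm.usesSigP σ f

/-- Atomic formulas. -/
def Fm.isAtom : Fm → Prop
  | Fm.rel _ _ _ => True
  | Fm.eq _ _ => True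
  | _ => False

/-- `x` is (the code of) a theory with constraints in interpretation:
a tuple `⟨T, σ, U̇, ϑ⟩` where `T` is a set of (codes of) first-order
sentences over `σ`, `U̇` is a unary relation symbol not in `σ`, and `ϑ`
maps each symbol of `σ ∪ {U̇}` to a pair `(y, i)` with `i ∈ {0, 1}` and `y`
included in a finite cartesian power of the first component `z` of `ϑ(U̇)`,
with the disjointness conditions on the powers of `z` from the paper. -/
def IsTCI (x : ZFSet) : Prop :=
  x = opair (tciT x) (opair (tciSig x) (opair (tciUdot x) (tciTheta x))) ∧
  (∀ s ∈ tciSig x, IsSymbol s) ∧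
  IsSymbol (tciUdot x) ∧ symKind (tciUdot x) = natZ 0 ∧ symArity (tciUdot x) = natZ 1 ∧
  tciUdot x ∉ tciSig x ∧
  IsZFunc (tciTheta x) (insert (tciUdot x) (tciSig x)) ∧
  (∀ s ∈ insert (tciUdot x) (tciSig x),
    ∃ y i, iapp (tciTheta x) s = opair y i ∧ (i = natZ 0 ∨ i = natZ 1) ∧
      ∃ n : ℕ, y ⊆ ZPow (zfst (iapp (tciTheta x) (tciUdot x))) n) ∧
  (∀ n : ℕ, 1 < n →
    zfst (iapp (tciTheta x) (tciUdot x)) ∩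
      ZPow (zfst (iapp (tciTheta x) (tciUdot x))) n = ∅) ∧
  (∀ m n : ℕ, 1 < m → m < n →
    ZPow (zfst (iapp (tciTheta x) (tciUdot x))) m ∩
      ZPow (zfst (iapp (tciTheta x) (tciUdot x))) n = ∅) ∧
  (∀ c ∈ tciT x, ∃ f : Fm, FmCode f = c ∧ Fm.free f = ∅ ∧ Fm.usesSig (tciSig x) f)

/-- Satisfaction in a coded structure `M = ⟨U, I⟩`: relation symbols are
interpreted by `I` via internal tuples, function and constant symbols by the
(graph) values recorded in `I`. -/
def SatStr (M : ZFSet) (f : Fm) : Prop :=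
  Sat (· ∈ zfst M) (fun s args => ztuple args ∈ iapp (zsnd M) s)
    (fun s args => if args = [] then iapp (zsnd M) s
      else Classical.epsilon fun b => ztuple (args ++ [b]) ∈ iapp (zsnd M) s)
    f (fun _ => ∅)

/-- The modelling relation `M ⊨* 𝔗` between coded structures and TCIs. -/
def ModelsTCI (M x : ZFSet) : Prop :=
  IsTCI x ∧
  M = opair (zfst M) (zsnd M) ∧
  IsZFunc (zsnd M) (tciSig x) ∧
  -- the constraint on the universe
  (∀ y i, iapp (tciTheta x) (tciUdot x) = opair y i →
    (i = natZ 0 → zfst M ⊆ y) ∧ (i = natZ 1 → zfst M = y)) ∧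
  -- the constraints on the symbols of the signature
  (∀ s ∈ tciSig x, ∀ y i, iapp (tciTheta x) s = opair y i →
    (symKind s = natZ 0 →
      (i = natZ 0 → iapp (zsnd M) s ⊆ y ∩ ZPow (zfst M) (arityOf s)) ∧
      (i = natZ 1 → iapp (zsnd M) s = y ∩ ZPow (zfst M) (arityOf s))) ∧
    (symKind s = natZ 1 →
      (∀ args : List ZFSet, args.length = arityOf s → (∀ a ∈ args, a ∈ zfst M) →
        ∃! b, b ∈ zfst M ∧ ztuple (args ++ [b]) ∈ iapp (zsnd M) s) ∧
      (i = natZ 0 → iapp (zsnd M) s ⊆ y ∩ ZPow (zfst M) (arityOf s + 1)) ∧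
      (i = natZ 1 → iapp (zsnd M) s = y ∩ ZPow (zfst M) (arityOf s + 1))) ∧
    (symKind s = natZ 2 → iapp (zsnd M) s ∈ y ∧ iapp (zsnd M) s ∈ zfst M)) ∧
  -- `M` satisfies the theory
  (∀ c ∈ tciT x, ∀ f : Fm, FmCode f = c → SatStr M f)

/-- A `Π_n` TCI: one whose theory contains only `Π_n` sentences. -/
def IsPiTCI (n : ℕ) (x : ZFSet) : Prop :=
  IsTCI x ∧ ∀ c ∈ tciT x, ∃ f : Fm, FmCode f = c ∧ IsPi n f

/-- A `Σ_n` TCI: one whose theory contains only `Σ_n` sentences. -/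
def IsSigmaTCI (n : ℕ) (x : ZFSet) : Prop :=
  IsTCI x ∧ ∀ c ∈ tciT x, ∃ f : Fm, FmCode f = c ∧ IsSigma n f

/-- A TCI in `V` is consistent iff it has a model in some outer model of `V`. -/
def ConsistentTCI (V x : ZFSet) : Prop :=
  ∃ W M, OuterModel V W ∧ M ∈ W ∧ ModelsTCI M x

/-! ### the language fragment `𝓛_𝔗` and the diagram `Σ(𝔗, M)` -/

/-- The set of codes of atomic sentences (with parameters) associated to a
symbol `s` of a TCI `x`, as in the proof of Proposition 3.22 of the paper. -/
def codesFor (x s : ZFSet) : ZFSet :=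
  if symKind s = natZ 0 then
    zimage (fun t => FmCode (Fm.rel s (arityOf s)
      fun i => Tm.param ((decodeTuple (arityOf s) t).getD i ∅)))
      (zfst (iapp (tciTheta x) s))
  else if symKind s = natZ 1 then
    zimage (fun t => FmCode (Fm.eq
      (Tm.func s (arityOf s) fun i => Tm.param ((decodeTuple (arityOf s + 1) t).getD i ∅))
      (Tm.param ((decodeTuple (arityOf s + 1) t).getD (arityOf s) ∅))))
      (zfst (iapp (tciTheta x) s))
  else
    zimage (fun a => FmCode (Fm.eq (Tm.func s 0 Fin.elim0) (Tm.param a)))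
      (zfst (iapp (tciTheta x) s))

/-- The atomic sentences of `𝓛_𝔗`. -/
def LLbase (x : ZFSet) : ZFSet :=
  ZFSet.sUnion (zimage (fun s => codesFor x s) (insert (tciUdot x) (tciSig x)))

/-- The language fragment `𝓛_𝔗`: atomic sentences with parameters, closed
under negation. -/
def LL (x : ZFSet) : ZFSet :=
  LLbase x ∪ zimage (fun t => opair (natZ 2) t) (LLbase x)

/-- A literal of `𝓛_𝔗` true in the structure `M` (with `U̇` interpreted as
the domain of `M`). -/
def LitTrue (x M : ZFSet) (f : Fm) : Prop :=
  (∃ a, f = Fm.rel (tciUdot x) 1 (fun _ => Tm.param a) ∧ a ∈ zfst M) ∨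
  (∃ a, f = Fm.not (Fm.rel (tciUdot x) 1 (fun _ => Tm.param a)) ∧ a ∉ zfst M) ∨
  (∃ g, (f = g ∨ f = Fm.not g) ∧ Fm.isAtom g ∧ Fm.usesSigP (tciSig x) g ∧
    (∀ a ∈ Fm.paramSet g, a ∈ zfst M) ∧
    (f = g → SatStr M g) ∧ (f = Fm.not g → ¬ SatStr M g))

/-- The `𝔗`-specific atomic diagram `Σ(𝔗, M)` of a model `M` of `𝔗`. -/
def SigmaSet (x M : ZFSet) : ZFSet :=
  ZFSet.sep (fun c => ∃ f : Fm, FmCode f = c ∧ LitTrue x M f) (LL x)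

/-! ### forcing notions and generic filters -/

/-- A forcing notion coded as a pair `⟨P, ≤⟩` of a set of conditions and a
partial order (a set of Kuratowski pairs). -/
def IsForcing (P : ZFSet) : Prop :=
  P = opair (zfst P) (zsnd P) ∧
  (∀ q ∈ zsnd P, ∃ a ∈ zfst P, ∃ b ∈ zfst P, q = opair a b) ∧
  (∀ a ∈ zfst P, opair a a ∈ zsnd P) ∧
  (∀ a b c : ZFSet, opair a b ∈ zsnd P → opair b c ∈ zsnd P → opair a c ∈ zsnd P) ∧
  (∀ a b : ZFSet, opair a b ∈ zsnd P → opair b a ∈ zsnd P → a = b)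

/-- `a ≤ b` in the coded forcing `P` (`a` extends, i.e. is stronger than, `b`). -/
def ple (P a b : ZFSet) : Prop := opair a b ∈ zsnd P

/-- `g` is a filter on the coded forcing `P`. -/
def IsFilterOn (P g : ZFSet) : Prop :=
  g ⊆ zfst P ∧
  (∀ p ∈ g, ∀ q ∈ zfst P, ple P p q → q ∈ g) ∧
  (∀ p ∈ g, ∀ q ∈ g, ∃ r ∈ g, ple P r p ∧ ple P r q)

/-- `D` is a dense subset of the coded forcing `P`. -/
def IsDenseIn (P D : ZFSet) : Prop :=
  D ⊆ zfst P ∧ ∀ p ∈ zfst P, ∃ q ∈ D, ple P q p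

/-- `g` is a `P`-generic filter over `V`: a filter on `P` meeting all dense
subsets of `P` lying in `V`. -/
def GenericFilterOver (V P g : ZFSet) : Prop :=
  IsFilterOn P g ∧ ∀ D ∈ V, IsDenseIn P D → ∃ q ∈ g, q ∈ D

/-- `p` is an atom of the coded forcing `P`: any two extensions of `p`
are compatible. -/
def PAtom (P p : ZFSet) : Prop :=
  p ∈ zfst P ∧ ∀ q₁ ∈ zfst P, ∀ q₂ ∈ zfst P, ple P q₁ p → ple P q₂ p →
    ∃ r ∈ zfst P, ple P r q₁ ∧ ple P r q₂

/-- An atomless forcing notion. -/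
def Atomless (P : ZFSet) : Prop := ∀ p ∈ zfst P, ¬ PAtom P p

/-- `g_p(ℙ) = {q ∈ P : q` is compatible with `p}`. -/
def gpSet (P p : ZFSet) : ZFSet :=
  ZFSet.sep (fun q => ∃ r ∈ zfst P, ple P r q ∧ ple P r p) (zfst P)

/-- The reverse-inclusion order on a set `p` of conditions, as a set of pairs. -/
def supsetOrder (p : ZFSet) : ZFSet :=
  ZFSet.sep (fun q => ∃ a ∈ p, ∃ b ∈ p, q = opair a b ∧ b ⊆ a) (ZFSet.prod p p)

/-! ### the forcings `ℙ(𝔗)` and their derivatives -/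

/-- `P(𝔗)`: finite subsets of `𝓛_𝔗` included in `Σ(𝔗, M)` for some model
`M` of `𝔗` in some outer model of `V`. -/
def PT (V x : ZFSet) : ZFSet :=
  ZFSet.sep
    (fun p => ∃ W M, OuterModel V W ∧ M ∈ W ∧ ModelsTCI M x ∧ p ⊆ SigmaSet x M)
    (finSubsets (LL x))

/-- The forcing notion `ℙ(𝔗) = (P(𝔗), ⊇)`. -/
def Pforcing (V x : ZFSet) : ZFSet := opair (PT V x) (supsetOrder (PT V x))

/-- `q` is an atom of a `⊇`-ordered set `P` of conditions. -/
def SupAtomIn (P q : ZFSet) : Prop :=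
  q ∈ P ∧ ∀ q₁ ∈ P, ∀ q₂ ∈ P, q ⊆ q₁ → q ⊆ q₂ → ∃ r ∈ P, q₁ ⊆ r ∧ q₂ ⊆ r

/-- The derivative forcings `P(𝔗)^{(α)}`: conditions certified by the diagram
of a model of `𝔗` avoiding all atoms of all earlier stages (stage `0` is
`P(𝔗)` itself). -/
def PTa (V x : ZFSet) : Ordinal.{1} → ZFSet :=
  WellFounded.fix wellFounded_lt fun α rec =>
    ZFSet.sep
      (fun p => ∃ W M, OuterModel V W ∧ M ∈ W ∧ ModelsTCI M x ∧ p ⊆ SigmaSet x M ∧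
        ∀ β, ∀ h : β < α, ∀ q, SupAtomIn (rec β h) q → ¬ q ⊆ SigmaSet x M)
      (finSubsets (LL x))

/-- The ordinal `|[𝓛_𝔗]^{<ω}|⁺`, bounding the derivative process. -/
def cardBound (x : ZFSet) : Ordinal.{1} :=
  (Order.succ (Cardinal.mk (finSubsets (LL x)).toSet)).ord

/-- The fixed point `P(𝔗)^⊤` of the derivative process. -/
def PTtopSet (V x : ZFSet) : ZFSet :=
  PTa V x (sInf {α : Ordinal.{1} | PTa V x α = PTa V x (Order.succ α)})

/-- The forcing notion `ℙ(𝔗)^⊤`. -/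
def PtopForcing (V x : ZFSet) : ZFSet :=
  opair (PTtopSet V x) (supsetOrder (PTtopSet V x))

/-- `M` is an almost finitely determined model of `𝔗`: `p ⊆ Σ(𝔗, M)` for
some atom `p` of some derivative forcing `ℙ(𝔗)^{(α)}`, `α < |[𝓛_𝔗]^{<ω}|⁺`. -/
def AlmostFinDet (V x M : ZFSet) : Prop :=
  ModelsTCI M x ∧ ∃ α : Ordinal.{1}, α < cardBound x ∧
    ∃ p, SupAtomIn (PTa V x α) p ∧ p ⊆ SigmaSet x M

/-- All models of `𝔗` in outer models of `V` are almost finitely determined. -/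
def AllAFD (V x : ZFSet) : Prop :=
  ∀ W M, OuterModel V W → M ∈ W → ModelsTCI M x → AlmostFinDet V x M

/-! ### the TCI `𝔗(ℙ)` of a forcing notion -/

/-- The symbol `≤̇` (binary relation). -/
def leSym : ZFSet := opair (natZ 0) (opair (natZ 2) (natZ 0))

/-- The symbol `Ġ` (unary relation) for the generic filter. -/
def gSym : ZFSet := opair (natZ 0) (opair (natZ 1) (natZ 1))

/-- The symbol `Ḋ` (unary relation) associated to the dense set `D`. -/
def dSym (D : ZFSet) : ZFSet := opair (natZ 0) (opair (natZ 1) (opair (natZ 2) D))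

/-- The distinguished symbol `U̇` used for `𝔗(ℙ)` and `𝔗_s`. -/
def udSym : ZFSet := opair (natZ 0) (opair (natZ 1) (natZ 3))

/-- The set of dense subsets of a coded forcing notion `P`. -/
def denseSets (P : ZFSet) : ZFSet :=
  ZFSet.sep (fun D => ∀ p ∈ zfst P, ∃ q ∈ D, ple P q p) (ZFSet.powerset (zfst P))

/-- `Ġ(i)` as a formula. -/
def relG (i : ℕ) : Fm := Fm.rel gSym 1 (fun _ => Tm.var i)

/-- `i ≤̇ j` as a formula. -/
def relLe (i j : ℕ) : Fm := Fm.rel leSym 2 ![Tm.var i, Tm.var j]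

/-- The sentences of `𝔗(ℙ)`: `Ġ` is a filter meeting each dense set. -/
def TofPTheory (P : ZFSet) : ZFSet :=
  insert (FmCode (Fm.all (Fm.all (Fm.ex (Fm.imp (Fm.and (relG 2) (relG 1))
      (Fm.and (relG 0) (Fm.and (relLe 0 2) (relLe 0 1))))))))
    (insert (FmCode (Fm.all (Fm.all (Fm.imp (Fm.and (relLe 1 0) (relG 1)) (relG 0)))))
      (zimage (fun D => FmCode (Fm.ex (Fm.and (relG 0) (Fm.rel (dSym D) 1 (fun _ => Tm.var 0)))))
        (denseSets P)))

/-- The constraint map of `𝔗(ℙ)`. -/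
def TofPTheta (P : ZFSet) : ZFSet :=
  insert (opair udSym (opair (zfst P) (natZ 1)))
    (insert (opair leSym (opair (zsnd P) (natZ 1)))
      (insert (opair gSym (opair (zfst P) (natZ 0)))
        (zimage (fun D => opair (dSym D) (opair D (natZ 1))) (denseSets P))))

/-- The `Π₂` TCI `𝔗(ℙ)` whose models (in outer models of `V`) are exactly
the `ℙ`-generic filters over `V`. -/
def TofP (P : ZFSet) : ZFSet :=
  opair (TofPTheory P)
    (opair (insert leSym (insert gSym (zimage dSym (denseSets P))))
      (opair udSym (TofPTheta P)))

/-! ### evaluations, local method definitions and `≤^M` -/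

/-- `Eval^V(𝔗) = {V[M] : M ⊨* 𝔗` in some outer model of `V}`. -/
def EvalT (V x : ZFSet) : Set ZFSet :=
  {W' | ∃ W M, OuterModel V W ∧ M ∈ W ∧ ModelsTCI M x ∧ Generates V M W'}

/-- A valuation loading one set at variable `0`. -/
def vone (a : ZFSet) : ℕ → ZFSet := fun n => if n = 0 then a else ∅

/-- A valuation loading two sets at variables `0`, `1`. -/
def vtwo (a b : ZFSet) : ℕ → ZFSet := fun n => if n = 0 then a else if n = 1 then b else ∅

/-- A valuation loading three sets at variables `0`, `1`, `2`. -/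
def vthree (a b c : ZFSet) : ℕ → ZFSet :=
  fun n => if n = 0 then a else if n = 1 then b else if n = 2 then c else ∅

/-- The class function `F` (restricted to the class `X`) is definable in `V`
with parameters in `V`. -/
def DefFunIn (V : ZFSet) (X : ZFSet → Prop) (F : ZFSet → ZFSet) : Prop :=
  ∃ φ : Fm, Fm.memOnly φ ∧ (∀ a ∈ Fm.paramSet φ, a ∈ V) ∧
    ∀ x, x ∈ V → X x → ∀ y, y ∈ V → (SatV V φ (vtwo x y) ↔ y = F x)

/-- A local method definition over `V`: a nonempty class of TCIs in `V`,
definable in `V` with parameters in `V`. -/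
def LocalMethodDef (V : ZFSet) (X : ZFSet → Prop) : Prop :=
  (∃ t, X t) ∧ (∀ t, X t → t ∈ V ∧ IsTCI t) ∧
  ∃ φ : Fm, Fm.memOnly φ ∧ (∀ a ∈ Fm.paramSet φ, a ∈ V) ∧
    ∀ t, t ∈ V → (X t ↔ SatV V φ (vone t))

/-- The reducibility relation `X ≤^M Y` between local method definitions:
some `V`-definable `F : X → Y` satisfies
`∅ ≠ Eval^V(F(𝔗)) ⊆ Eval^V(𝔗)` for all consistent `𝔗 ∈ X`. -/
def LeqM (V : ZFSet) (X Y : ZFSet → Prop) : Prop :=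
  ∃ F : ZFSet → ZFSet, DefFunIn V X F ∧
    (∀ x, x ∈ V → X x → F x ∈ V ∧ Y (F x)) ∧
    ∀ x, x ∈ V → X x → ConsistentTCI V x →
      (EvalT V (F x)).Nonempty ∧ EvalT V (F x) ⊆ EvalT V x

/-- `X ≡^M Y`. -/
def EquivM (V : ZFSet) (X Y : ZFSet → Prop) : Prop := LeqM V X Y ∧ LeqM V Y X

/-- The local method definition `Π^M_n` of all `Π_n` TCIs. -/
def PiM (n : ℕ) : ZFSet → Prop := IsPiTCI n

/-- The local method definition `Σ^M_n` of all `Σ_n` TCIs. -/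
def SigmaM (n : ℕ) : ZFSet → Prop := IsSigmaTCI n

/-- The local method definition `Fg = {𝔗(ℙ) : ℙ` a forcing notion in `V}`. -/
def FgClass (V : ZFSet) : ZFSet → Prop :=
  fun t => ∃ P, P ∈ V ∧ IsForcing P ∧ t = TofP P

/-! ### H(κ), collapse forcing, and structure-genericity -/

/-- `H` is (the code of) `H(|trcl(t)|⁺)` as computed inside `V`:
the set of all `y ∈ V` whose transitive closure admits, in `V`,
an injection into the transitive closure of `t`. -/
def IsHIn (V t H : ZFSet) : Prop :=
  H ∈ V ∧ ∀ y, (y ∈ H ↔ (y ∈ V ∧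
    ∀ ty tt, IsTrclOf {y} ty → IsTrclOf t tt → ∃ j ∈ V, ZInjFun j ty tt))

/-- The conditions of the collapse `Col(ω, λ)`: finite partial functions
from `ω` to `λ`. -/
def ColSet (lam : ZFSet) : ZFSet :=
  ZFSet.sep
    (fun f => (∀ q ∈ f, ∃ a b, q = opair a b) ∧
      (∀ a b b' : ZFSet, opair a b ∈ f → opair a b' ∈ f → b = b') ∧ f.toSet.Finite)
    (ZFSet.powerset (ZFSet.prod ZFSet.omega lam))

/-- The collapse forcing `Col(ω, λ)`, ordered by reverse inclusion. -/
def ColForcing (lam : ZFSet) : ZFSet := opair (ColSet lam) (supsetOrder (ColSet lam))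

/-- `g` is a `P`-generic filter over the ∈-structure with domain `H`:
a filter on `P` meeting every dense subset of `P` definable over `(H; ∈)`
with parameters in `H`. -/
def GenericOverStruct (H P g : ZFSet) : Prop :=
  IsFilterOn P g ∧
  ∀ φ : Fm, Fm.memOnly φ → (∀ a ∈ Fm.paramSet φ, a ∈ H) →
    ((∀ p ∈ zfst P, ∃ q ∈ zfst P, SatV H φ (vone q) ∧ ple P q p) →
      ∃ q ∈ g, SatV H φ (vone q))

/-- The `Π₀` TCI `𝔗_s` whose models in any outer model are the subsets of `s`. -/
def Tsub (s : ZFSet) : ZFSet :=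
  opair ∅ (opair ∅ (opair udSym ({opair udSym (opair s (natZ 0))} : ZFSet)))

end SmallExt

namespace SmallExt

/-- `g_p` for a `⊇`-ordered set of conditions `P`:
the conditions compatible with `p`. -/
def gpSup (P p : ZFSet) : ZFSet :=
  ZFSet.sep (fun q => ∃ r ∈ P, q ⊆ r ∧ p ⊆ r) P

/-- Outer models among arbitrary (not necessarily countable) transitive
models of ZFC. -/
def OuterModelT (U W : ZFSet) : Prop :=
  IsTransModel U ∧ IsTransModel W ∧ U ⊆ W ∧ ∀ y ∈ W, IsOrd y → y ∈ U

/-- Consistency of a TCI relative to a transitive model `U` of ZFC. -/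
def ConsistentT (U x : ZFSet) : Prop :=
  ∃ W M, OuterModelT U W ∧ M ∈ W ∧ ModelsTCI M x

end SmallExt

namespace SmallExt

/-! ### Part 1: bounded formulas -/

/-- trivial function interpretation -/
abbrev noF : ZFSet.{0} → List ZFSet.{0} → ZFSet.{0} := fun _ _ => ∅

@[simp] theorem vcons_zero (z v) : vcons z v 0 = z := rfl
@[simp] theorem vcons_succ (z v n) : vcons z v (n+1) = v n := rfl

/-- renaming of terms -/
def Tm.ren (ρ : ℕ → ℕ) (π : ZFSet.{0} → ℕ) : Tm → Tm
  | Tm.var n => Tm.var (ρ n)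
  | Tm.param a => Tm.var (π a)
  | Tm.func s n a => Tm.func s n (fun i => Tm.ren ρ π (a i))

def upr (ρ : ℕ → ℕ) : ℕ → ℕ
  | 0 => 0
  | n+1 => ρ n + 1

/-- renaming of formulas -/
def Fm.ren : (ℕ → ℕ) → (ZFSet.{0} → ℕ) → Fm → Fm
  | ρ, π, Fm.rel s n a => Fm.rel s n (fun i => Tm.ren ρ π (a i))
  | ρ, π, Fm.eq t u => Fm.eq (Tm.ren ρ π t) (Tm.ren ρ π u)
  | ρ, π, Fm.not f => Fm.not (Fm.ren ρ π f)
  | ρ, π, Fm.imp f g => Fm.imp (Fm.ren ρ π f) (Fm.ren ρ π g)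
  | ρ, π, Fm.all f => Fm.all (Fm.ren (upr ρ) (fun a => π a + 1) f)
  | ρ, π, Fm.ex f => Fm.ex (Fm.ren (upr ρ) (fun a => π a + 1) f)

theorem Tm.ren_noFunc (ρ π) (t : Tm) (h : t.noFunc) : (t.ren ρ π).noFunc := by
  cases t <;> simp_all [Tm.ren, Tm.noFunc]

theorem Fm.ren_memOnly (f : Fm) : ∀ (ρ π), f.memOnly → (f.ren ρ π).memOnly := by
  induction f with
  | rel s n a =>
    intro ρ π h
    exact ⟨h.1, h.2.1, fun i => Tm.ren_noFunc _ _ _ (h.2.2 i)⟩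
  | eq t u => intro ρ π h; exact ⟨Tm.ren_noFunc _ _ _ h.1, Tm.ren_noFunc _ _ _ h.2⟩
  | not f ih => intro ρ π h; exact ih _ _ h
  | imp f g ih ih2 => intro ρ π h; exact ⟨ih _ _ h.1, ih2 _ _ h.2⟩
  | all f ih => intro ρ π h; exact ih _ _ h
  | ex f ih => intro ρ π h; exact ih _ _ h

theorem Tm.ren_paramSet (ρ π) (t : Tm) : (t.ren ρ π).paramSet = ∅ := by
  induction t with
  | var n => rfl
  | param a => rfl
  | func s n a ih => simp [Tm.ren, Tm.paramSet, ih]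

theorem Fm.ren_paramSet (f : Fm) : ∀ (ρ π), (f.ren ρ π).paramSet = ∅ := by
  induction f with
  | rel s n a => intro ρ π; simp [Fm.ren, Fm.paramSet, Tm.ren_paramSet]
  | eq t u => intro ρ π; simp [Fm.ren, Fm.paramSet, Tm.ren_paramSet]
  | not f ih => intro ρ π; exact ih _ _
  | imp f g ih ih2 => intro ρ π; simp [Fm.ren, Fm.paramSet, ih, ih2]
  | all f ih => intro ρ π; exact ih _ _
  | ex f ih => intro ρ π; exact ih _ _

theorem Tm.ren_free (ρ π) (t : Tm) (m : ℕ) (h : m ∈ (t.ren ρ π).free) :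
    (∃ n, m = ρ n) ∨ ∃ a, m = π a := by
  induction t with
  | var n => left; exact ⟨n, h⟩
  | param a => right; exact ⟨a, h⟩
  | func s n a ih => obtain ⟨i, hi⟩ := h; exact ih i hi

theorem Fm.ren_free (f : Fm) : ∀ (ρ π) (m : ℕ), m ∈ (f.ren ρ π).free →
    (∃ n, m = ρ n) ∨ ∃ a, m = π a := by
  have key : ∀ (ρ : ℕ → ℕ) (π : ZFSet → ℕ) (m : ℕ), ((∃ n, m+1 = upr ρ n) ∨ ∃ a, m+1 = π a+1) →
      (∃ n, m = ρ n) ∨ ∃ a, m = π a := by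
    rintro ρ π m (⟨n, h⟩ | ⟨a, h⟩)
    · cases n with
      | zero => simp [upr] at h
      | succ n => exact Or.inl ⟨n, by simpa [upr] using h⟩
    · exact Or.inr ⟨a, by omega⟩
  induction f with
  | rel s n a => rintro ρ π m ⟨i, h⟩; exact Tm.ren_free _ _ _ _ h
  | eq t u => rintro ρ π m (h | h) <;> exact Tm.ren_free _ _ _ _ h
  | not f ih => intro ρ π m h; exact ih _ _ _ h
  | imp f g ih ih2 =>
    rintro ρ π m (h | h)
    · exact ih _ _ _ h
    · exact ih2 _ _ _ h
  | all f ih => intro ρ π m h; exact key _ _ _ (ih _ _ _ h)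
  | ex f ih => intro ρ π m h; exact key _ _ _ (ih _ _ _ h)

theorem Tm.ren_eval (fI) (ρ π) (v w : ℕ → ZFSet.{0}) (t : Tm) (h1 : ∀ n, w (ρ n) = v n)
    (h2 : ∀ a ∈ t.paramSet, w (π a) = a) : (t.ren ρ π).eval fI w = t.eval fI v := by
  induction t with
  | var n => exact h1 n
  | param a => exact h2 a rfl
  | func s n a ih =>
    simp only [Tm.ren, Tm.eval]
    congr 2
    funext i
    exact ih i (fun b hb => h2 b ⟨i, hb⟩)

theorem Fm.ren_sat (dom rI fI) (f : Fm) : ∀ (ρ π) (v w : ℕ → ZFSet.{0}), (∀ n, w (ρ n) = v n) →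
    (∀ a ∈ f.paramSet, w (π a) = a) → (Sat dom rI fI (f.ren ρ π) w ↔ Sat dom rI fI f v) := by
  have up : ∀ (ρ : ℕ → ℕ) (v w : ℕ → ZFSet.{0}) (z : ZFSet.{0}), (∀ n, w (ρ n) = v n) →
      ∀ n, vcons z w (upr ρ n) = vcons z v n := by
    intro ρ v w z h n
    cases n with
    | zero => rfl
    | succ n => exact h n
  induction f with
  | rel s n a =>
    intro ρ π v w h1 h2
    simp only [Fm.ren, Sat]
    have : ∀ i, (Tm.ren ρ π (a i)).eval fI w = (a i).eval fI v := fun i =>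
      Tm.ren_eval _ _ _ _ _ _ h1 (fun b hb => h2 b ⟨i, hb⟩)
    simp only [this]
  | eq t u =>
    intro ρ π v w h1 h2
    simp only [Fm.ren, Sat]
    rw [Tm.ren_eval fI ρ π v w t h1 (fun b hb => h2 b (Or.inl hb)),
      Tm.ren_eval fI ρ π v w u h1 (fun b hb => h2 b (Or.inr hb))]
  | not f ih => intro ρ π v w h1 h2; simp only [Fm.ren, Sat]; rw [ih ρ π v w h1 h2]
  | imp f g ih ih2 =>
    intro ρ π v w h1 h2; simp only [Fm.ren, Sat]
    rw [ih ρ π v w h1 (fun b hb => h2 b (Or.inl hb)), ih2 ρ π v w h1 (fun b hb => h2 b (Or.inr hb))]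
  | all f ih =>
    intro ρ π v w h1 h2; simp only [Fm.ren, Sat]
    refine forall_congr' fun z => imp_congr_right fun _ => ih _ _ _ _ (up _ _ _ _ h1) h2
  | ex f ih =>
    intro ρ π v w h1 h2; simp only [Fm.ren, Sat]
    refine exists_congr fun z => and_congr_right fun _ => ih _ _ _ _ (up _ _ _ _ h1) h2

theorem Tm.paramSet_finite (t : Tm) : t.paramSet.Finite := by
  induction t with
  | var n => exact Set.finite_empty
  | param a => exact Set.finite_singleton a
  | func s n a ih =>
    have : Tm.paramSet (Tm.func s n a) = ⋃ i, (a i).paramSet := by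
      ext b; simp [Tm.paramSet]
    rw [this]; exact Set.finite_iUnion ih

theorem Fm.paramSet_finite (f : Fm) : f.paramSet.Finite := by
  induction f with
  | rel s n a =>
    have : Fm.paramSet (Fm.rel s n a) = ⋃ i, (a i).paramSet := by
      ext b; simp [Fm.paramSet]
    rw [this]; exact Set.finite_iUnion fun i => Tm.paramSet_finite _
  | eq t u => exact (Tm.paramSet_finite t).union (Tm.paramSet_finite u)
  | not f ih => exact ih
  | imp f g ih ih2 => exact ih.union ih2
  | all f ih => exact ih
  | ex f ih => exact ih

/-! #### semantic bounded formulas -/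

/-- Variables or constants from `W`. -/
inductive Tr (W : ZFSet.{0}) : ((ℕ → ZFSet.{0}) → ZFSet.{0}) → Prop
  | var (i : ℕ) : Tr W (fun v => v i)
  | const (c : ZFSet.{0}) : c ∈ W → Tr W (fun _ => c)

/-- Bounded predicates with parameters from `W`. -/
inductive Dl (W : ZFSet.{0}) : ((ℕ → ZFSet.{0}) → Prop) → Prop
  | mem {f g} : Tr W f → Tr W g → Dl W (fun v => f v ∈ g v)
  | eq {f g} : Tr W f → Tr W g → Dl W (fun v => f v = g v)
  | not {P} : Dl W P → Dl W (fun v => ¬ P v)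
  | imp {P Q} : Dl W P → Dl W Q → Dl W (fun v => P v → Q v)
  | bex {f Q} : Tr W f → Dl W Q → Dl W (fun v => ∃ y ∈ f v, Q (vcons y v))

theorem Dl.congr {W P Q} (h : Dl W P) (e : ∀ v, P v ↔ Q v) : Dl W Q := by
  have : P = Q := by funext v; exact propext (e v)
  exact this ▸ h

theorem Dl.and {W P Q} (h : Dl W P) (h' : Dl W Q) : Dl W (fun v => P v ∧ Q v) :=
  (Dl.not (Dl.imp h (Dl.not h'))).congr (fun v => by tauto)
theorem Dl.or {W P Q} (h : Dl W P) (h' : Dl W Q) : Dl W (fun v => P v ∨ Q v) :=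
  (Dl.imp (Dl.not h) h').congr (fun v => by tauto)

def Tr.toTm {W f} (h : Tr W f) : ∃ t : Tm, t.noFunc ∧ (∀ a ∈ t.paramSet, a ∈ W) ∧
    ∀ v, t.eval noF v = f v := by
  cases h with
  | var i => exact ⟨Tm.var i, trivial, by simp [Tm.paramSet], fun v => rfl⟩
  | const c hc => exact ⟨Tm.param c, trivial, by simp [Tm.paramSet, hc], fun v => rfl⟩

theorem Tr.lift {W f} (h : Tr W f) : Tr W (fun v => f (fun n => v (n+1))) := by
  cases h with
  | var i => exact Tr.var (i+1)
  | const c hc => exact Tr.const c hc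

/-- Realization of bounded predicates by formulas. -/
theorem Dl.realize {W : ZFSet.{0}} {P} (h : Dl W P) : ∃ φ : Fm, φ.memOnly ∧ (∀ a ∈ φ.paramSet, a ∈ W) ∧
    ∀ dom : ZFSet.{0} → Prop, (∀ a, a ∈ W → dom a) → (∀ a b, dom a → b ∈ a → dom b) →
      ∀ v, (∀ n, dom (v n)) → (Sat dom memRel noF φ v ↔ P v) := by
  have memAt : ∀ t u : Tm, ∀ dom v, Sat dom memRel noF (Fm.rel memSym 2 ![t, u]) v ↔
      t.eval noF v ∈ u.eval noF v := by
    intro t u dom v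
    simp only [Sat, memRel, List.ofFn_succ, List.ofFn_zero]
    simp
  induction h with
  | mem hf hg =>
    obtain ⟨t, t1, t2, t3⟩ := hf.toTm
    obtain ⟨u, u1, u2, u3⟩ := hg.toTm
    refine ⟨Fm.rel memSym 2 ![t, u], ⟨rfl, rfl, ?_⟩, ?_, ?_⟩
    · intro i; fin_cases i <;> assumption
    · rintro a ⟨i, hi⟩; fin_cases i
      · exact t2 a hi
      · exact u2 a hi
    · intro dom _ _ v _; rw [memAt, t3, u3]
  | eq hf hg =>
    obtain ⟨t, t1, t2, t3⟩ := hf.toTm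
    obtain ⟨u, u1, u2, u3⟩ := hg.toTm
    refine ⟨Fm.eq t u, ⟨t1, u1⟩, ?_, ?_⟩
    · rintro a (hi | hi)
      · exact t2 a hi
      · exact u2 a hi
    · intro dom _ _ v _; simp only [Sat]; rw [t3, u3]
  | not _ ih =>
    obtain ⟨φ, h1, h2, h3⟩ := ih
    refine ⟨Fm.not φ, h1, h2, ?_⟩
    intro dom d1 d2 v hv; simp only [Sat]; rw [h3 dom d1 d2 v hv]
  | imp _ _ ih ih' =>
    obtain ⟨φ, h1, h2, h3⟩ := ih
    obtain ⟨ψ, g1, g2, g3⟩ := ih'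
    refine ⟨Fm.imp φ ψ, ⟨h1, g1⟩, ?_, ?_⟩
    · rintro a (h | h)
      · exact h2 a h
      · exact g2 a h
    intro dom d1 d2 v hv; simp only [Sat]; rw [h3 dom d1 d2 v hv, g3 dom d1 d2 v hv]
  | @bex f Q hf _ ih =>
    obtain ⟨φ, h1, h2, h3⟩ := ih
    obtain ⟨t, t1, t2, t3⟩ := hf.lift.toTm
    refine ⟨Fm.ex (Fm.and (Fm.rel memSym 2 ![Tm.var 0, t]) φ), ?_, ?_, ?_⟩
    · refine ⟨⟨rfl, rfl, ?_⟩, h1⟩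
      intro i; fin_cases i
      · trivial
      · exact t1
    · rintro a (⟨i, hi⟩ | hi)
      · fin_cases i
        · exact absurd hi (by simp [Tm.paramSet])
        · exact t2 a hi
      · exact h2 a hi
    · intro dom d1 d2 v hv
      simp only [Sat, Fm.and]
      have e : ∀ z, (Sat dom memRel noF (Fm.rel memSym 2 ![Tm.var 0, t]) (vcons z v) ↔ z ∈ f v) := by
        intro z; rw [memAt, t3]; exact Iff.rfl
      simp only [Sat] at e
      simp only [e]
      have hfv : dom (f v) := by
        cases hf with
        | var i => exact hv i
        | const c hc => exact d1 c hc
      have hvz : ∀ z, dom z → ∀ n, dom (vcons z v n) := by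
        intro z hz n; cases n with
        | zero => exact hz
        | succ n => exact hv n
      constructor
      · rintro ⟨z, hz, h⟩
        rw [h3 dom d1 d2 _ (hvz z hz)] at h
        exact ⟨z, by tauto, by tauto⟩
      · rintro ⟨z, hz, h⟩
        have := d2 _ _ hfv hz
        refine ⟨z, this, ?_⟩
        rw [h3 dom d1 d2 _ (hvz z this)]
        tauto

/-- Simple functions. -/
class Sm (W : ZFSet.{0}) (f : (ℕ → ZFSet.{0}) → ZFSet.{0}) : Prop where
  out : ∀ (ρ : ℕ → ℕ) (Q), Dl W Q → Dl W (fun v => ∃ y ∈ f (fun n => v (ρ n)), Q (vcons y v))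

class DD (W : ZFSet.{0}) (P : (ℕ → ZFSet.{0}) → Prop) : Prop where
  out : Dl W P

variable {W : ZFSet.{0}}

theorem Tr.sm {f} (h : Tr W f) : Sm W f := by
  constructor
  intro ρ Q hQ
  cases h with
  | var i => exact Dl.bex (Tr.var (ρ i)) hQ
  | const c hc => exact Dl.bex (Tr.const c hc) hQ

instance Sm.var (i : ℕ) : Sm W (fun v => v i) := (Tr.var i).sm
instance Sm.const (c : ZFSet.{0}) [h : Fact (c ∈ W)] : Sm W (fun _ => c) := (Tr.const c h.out).sm

theorem Sm.ren {f} (h : Sm W f) (ρ : ℕ → ℕ) : Sm W (fun v => f (fun n => v (ρ n))) :=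
  ⟨fun ρ' Q hQ => h.out (fun n => ρ' (ρ n)) Q hQ⟩

theorem Sm.memVar {f} (h : Sm W f) (i : ℕ) (ρ : ℕ → ℕ) : Dl W (fun v => v i ∈ f (fun n => v (ρ n))) := by
  refine (h.out ρ (fun v => v 0 = v (i+1)) (Dl.eq (Tr.var 0) (Tr.var (i+1)))).congr ?_
  intro v; simp

theorem Sm.eqD {f g} (hf : Sm W f) (hg : Sm W g) : Dl W (fun v => f v = g v) := by
  have key : ∀ {f g}, Sm W f → Sm W g → Dl W (fun v => f v ⊆ g v) := by
    intro f g hf hg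
    have := hf.out (fun n => n) _ (Dl.not (hg.memVar 0 (fun n => n+1)))
    refine (Dl.not this).congr ?_
    intro v
    simp only [vcons_zero, vcons_succ]
    constructor
    · intro h z hz
      by_contra h'
      exact h ⟨z, hz, h'⟩
    · rintro h ⟨z, hz, h'⟩
      exact h' (h hz)
  refine (Dl.and (key hf hg) (key hg hf)).congr ?_
  intro v
  constructor
  · rintro ⟨h1, h2⟩; exact ZFSet.ext fun z => ⟨fun h => h1 h, fun h => h2 h⟩
  · intro h; rw [h]; exact ⟨fun _ h => h, fun _ h => h⟩

theorem Sm.memD {f g} (hf : Sm W f) (hg : Sm W g) : Dl W (fun v => f v ∈ g v) := by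
  have := hg.out (fun n => n) _ (Sm.eqD (Sm.var 0) (hf.ren (fun n => n+1)))
  refine this.congr ?_
  intro v; simp only [vcons_zero, vcons_succ]
  constructor
  · rintro ⟨y, h1, h2⟩; rw [← h2]; exact h1
  · intro h; exact ⟨_, h, rfl⟩

/-- substitution -/
theorem Dl.subst {Q} (h : Dl W Q) : ∀ E : (ℕ → ZFSet.{0}) → (ℕ → ZFSet.{0}), (∀ i, Sm W (fun v => E v i)) →
    Dl W (fun v => Q (E v)) := by
  have tr : ∀ {f}, Tr W f → ∀ E : (ℕ → ZFSet.{0}) → (ℕ → ZFSet.{0}), (∀ i, Sm W (fun v => E v i)) →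
      Sm W (fun v => f (E v)) := by
    intro f hf E hE
    cases hf with
    | var i => exact hE i
    | const c hc => exact (Tr.const c hc).sm
  induction h with
  | mem hf hg => intro E hE; exact Sm.memD (tr hf E hE) (tr hg E hE)
  | eq hf hg => intro E hE; exact Sm.eqD (tr hf E hE) (tr hg E hE)
  | not _ ih => intro E hE; exact Dl.not (ih E hE)
  | imp _ _ ih ih' => intro E hE; exact Dl.imp (ih E hE) (ih' E hE)
  | @bex f Q hf _ ih =>
    intro E hE
    have h1 := ih (fun v => vcons (v 0) (E (fun n => v (n+1)))) (by
      intro i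
      cases i with
      | zero => exact Sm.var 0
      | succ i => exact (hE i).ren (fun n => n+1))
    exact (tr hf E hE).out (fun n => n) _ h1

theorem Dl.subst1 {Q f} (h : Dl W Q) (hf : Sm W f) : Dl W (fun v => Q (vcons (f v) v)) := by
  refine h.subst (fun v => vcons (f v) v) ?_
  intro i
  cases i with
  | zero => exact hf
  | succ i => exact Sm.var i

instance Sm.empty : Sm W (fun _ => (∅ : ZFSet.{0})) := by
  constructor
  intro ρ Q hQ
  refine (Dl.not (Dl.eq (Tr.var 0) (Tr.var 0))).congr ?_
  intro v; simp

instance Sm.insert {f g} [hf : Sm W f] [hg : Sm W g] : Sm W (fun v => Insert.insert (f v) (g v)) := by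
  constructor
  intro ρ Q hQ
  refine (Dl.or (hQ.subst1 (hf.ren ρ)) (hg.out ρ Q hQ)).congr ?_
  intro v; simp

instance Sm.singleton {f} [hf : Sm W f] : Sm W (fun v => ({f v} : ZFSet.{0})) := by
  constructor
  intro ρ Q hQ
  refine (hQ.subst1 (hf.ren ρ)).congr ?_
  intro v; simp

instance Sm.union {f g} [hf : Sm W f] [hg : Sm W g] : Sm W (fun v => f v ∪ g v) := by
  constructor
  intro ρ Q hQ
  refine (Dl.or (hf.out ρ Q hQ) (hg.out ρ Q hQ)).congr ?_
  intro v; simp only [ZFSet.mem_union]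
  constructor
  · rintro (⟨y, h1, h2⟩ | ⟨y, h1, h2⟩)
    · exact ⟨y, Or.inl h1, h2⟩
    · exact ⟨y, Or.inr h1, h2⟩
  · rintro ⟨y, h1 | h1, h2⟩
    · exact Or.inl ⟨y, h1, h2⟩
    · exact Or.inr ⟨y, h1, h2⟩

instance Sm.opair {f g} [hf : Sm W f] [hg : Sm W g] : Sm W (fun v => opair (f v) (g v)) := by
  unfold SmallExt.opair ZFSet.pair
  infer_instance

instance Sm.natZ (m : ℕ) : Sm W (fun _ => natZ m) := by
  induction m with
  | zero => exact Sm.empty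
  | succ m ih => exact Sm.insert

instance DD.mem {f g} [hf : Sm W f] [hg : Sm W g] : DD W (fun v => f v ∈ g v) := ⟨hf.memD hg⟩
instance DD.eq {f g} [hf : Sm W f] [hg : Sm W g] : DD W (fun v => f v = g v) := ⟨hf.eqD hg⟩
instance DD.not {P} [h : DD W P] : DD W (fun v => ¬ P v) := ⟨h.out.not⟩
instance DD.and {P Q} [h : DD W P] [h' : DD W Q] : DD W (fun v => P v ∧ Q v) := ⟨h.out.and h'.out⟩
instance DD.or {P Q} [h : DD W P] [h' : DD W Q] : DD W (fun v => P v ∨ Q v) := ⟨h.out.or h'.out⟩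
instance DD.imp {P Q : (ℕ → ZFSet.{0}) → Prop} [h : DD W P] [h' : DD W Q] : DD W (fun v => P v → Q v) :=
  ⟨h.out.imp h'.out⟩
instance DD.iff {P Q : (ℕ → ZFSet.{0}) → Prop} [h : DD W P] [h' : DD W Q] : DD W (fun v => P v ↔ Q v) :=
  ⟨((h.out.imp h'.out).and (h'.out.imp h.out)).congr (fun v => by tauto)⟩
instance DD.bex {f} {Q : ZFSet.{0} → (ℕ → ZFSet.{0}) → Prop} [hf : Sm W f]
    [h : DD W (fun v => Q (v 0) (fun n => v (n+1)))] : DD W (fun v => ∃ y, y ∈ f v ∧ Q y v) :=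
  ⟨hf.out (fun n => n) _ h.out⟩
instance DD.ball {f} {Q : ZFSet.{0} → (ℕ → ZFSet.{0}) → Prop} [hf : Sm W f]
    [h : DD W (fun v => Q (v 0) (fun n => v (n+1)))] : DD W (fun v => ∀ y, y ∈ f v → Q y v) :=
  ⟨(Dl.not (hf.out (fun n => n) _ h.out.not)).congr (fun v => by
    simp only [vcons_zero, vcons_succ]; push Not; rfl)⟩
instance DD.subset {f g} [hf : Sm W f] [hg : Sm W g] : DD W (fun v => f v ⊆ g v) := by
  have : DD W (fun v => ∀ y, y ∈ f v → y ∈ g v) := by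
    have := hg.ren (fun n => n+1)
    exact DD.ball (Q := fun y v => y ∈ g v)
  exact this


end SmallExt

namespace SmallExt

/-! ### Part 2: closure properties of transitive models -/

section
attribute [local instance] Classical.propDecidable
variable {W : ZFSet.{0}}

theorem sat_allClose (dom rI fI) (L : List ZFSet.{0}) : ∀ (f : Fm) (v : ℕ → ZFSet.{0}),
    Sat dom rI fI (allClose L.length f) v → (∀ a ∈ L, dom a) → Sat dom rI fI f (L.foldr vcons v) := by
  induction L with
  | nil => intro f v h _; exact h
  | cons a L ih =>
    intro f v h hL
    have := ih (Fm.all f) v h (fun b hb => hL b (List.mem_cons_of_mem _ hb))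
    exact this a (hL a List.mem_cons_self)

theorem foldr_vcons_get (L : List ZFSet.{0}) (v) (a : ZFSet.{0}) (h : a ∈ L) :
    L.foldr vcons v (L.idxOf a) = a := by
  induction L with
  | nil => simp at h
  | cons b L ih =>
    by_cases hb : b = a
    · subst hb; simp
    · rw [List.idxOf_cons_ne L hb]
      simp only [List.foldr_cons, Nat.succ_eq_add_one, vcons_succ]
      exact ih (by simpa [Ne.symm hb] using h)

/-- the power set computed in `W` -/
def pw (W a : ZFSet.{0}) : ZFSet.{0} := ZFSet.sep (fun X => X ⊆ a) W

@[simp] theorem mem_pw {a X : ZFSet.{0}} : X ∈ pw W a ↔ X ∈ W ∧ X ⊆ a := by simp [pw]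

theorem mem_zimage {f : ZFSet.{0} → ZFSet.{0}} {a y : ZFSet.{0}} : y ∈ zimage f a ↔ ∃ x ∈ a, f x = y := by
  unfold zimage
  exact @ZFSet.mem_image f (Classical.allZFSetDefinable _) a y

variable [hW : Fact (IsTransModel W)]

theorem W_trans {a b : ZFSet.{0}} (ha : a ∈ W) (hb : b ∈ a) : b ∈ W := hW.out.1 a ha hb

theorem and_sat {dom rI fI f g v} : Sat dom rI fI (Fm.and f g) v ↔ Sat dom rI fI f v ∧ Sat dom rI fI g v := by
  simp only [Fm.and, Sat]; tauto
theorem or_sat {dom rI fI f g v} : Sat dom rI fI (Fm.or f g) v ↔ Sat dom rI fI f v ∨ Sat dom rI fI g v := by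
  simp only [Fm.or, Sat]; tauto
theorem iff_sat {dom rI fI f g v} : Sat dom rI fI (Fm.iff f g) v ↔ (Sat dom rI fI f v ↔ Sat dom rI fI g v) := by
  simp only [Fm.iff, and_sat, Sat]; tauto
theorem mem2_sat {dom v i j} : Sat dom memRel noF (mem2 i j) v ↔ v i ∈ v j := by
  simp only [mem2, Sat, memRel, List.ofFn_succ, List.ofFn_zero]
  simp [Tm.eval]
theorem eq2_sat {dom v i j} : Sat dom memRel noF (eq2 i j) v ↔ v i = v j := by
  simp only [eq2, Sat, Tm.eval]

theorem W_empty : (∅ : ZFSet.{0}) ∈ W := by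
  have h := hW.out.2 infAx (by simp [ZFCax])
  simp only [SatV, infAx, Sat, and_sat, mem2_sat] at h
  obtain ⟨z, hz, ⟨e, he, he2, he3⟩, _⟩ := h
  have : e = ∅ := by
    rw [ZFSet.eq_empty]
    intro y hy
    exact he3 y (W_trans he hy) hy
  exact this ▸ he

theorem W_sep {P : ZFSet.{0} → Prop} (hP : DD W (fun v => P (v 0))) {a : ZFSet.{0}} (ha : a ∈ W) :
    ZFSet.sep P a ∈ W := by
  obtain ⟨φ, h1, h2, h3⟩ := hP.out.realize
  let L := (Fm.paramSet_finite φ).toFinset.toList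
  have hL : ∀ b, b ∈ L ↔ b ∈ φ.paramSet := by intro b; simp [L]
  let ρ : ℕ → ℕ := fun n => if n = 0 then 0 else 2
  let π : ZFSet.{0} → ℕ := fun a => 3 + L.idxOf a
  have hax := hW.out.2 (allClose L.length (sepBody (φ.ren ρ π))) (by
    refine Or.inl (Or.inr ⟨L.length, φ.ren ρ π, Fm.ren_memOnly _ _ _ h1, Fm.ren_paramSet _ _ _, ?_, rfl⟩)
    intro h
    rcases Fm.ren_free _ _ _ _ h with ⟨n, hn⟩ | ⟨a, ha⟩
    · simp only [ρ] at hn; split_ifs at hn <;> omega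
    · simp only [π] at ha; omega)
  have h4 := sat_allClose _ _ _ L _ _ hax (fun b hb => h2 b ((hL b).1 hb))
  simp only [sepBody, Sat, iff_sat, and_sat, mem2_sat] at h4
  obtain ⟨s, hs, h5⟩ := h4 a ha
  have : ZFSet.sep P a = s := by
    ext z
    rw [ZFSet.mem_sep]
    have key : z ∈ W → (z ∈ s ↔ z ∈ a ∧ P z) := by
      intro hz
      have h6 := h5 z hz
      rw [Fm.ren_sat _ _ _ φ ρ π (vcons z (fun _ => a))] at h6
      · rw [h3 (· ∈ W) (fun _ h => h) (fun _ _ => W_trans)] at h6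
        · exact h6
        · intro n; cases n
          · exact hz
          · exact ha
      · intro n; cases n <;> simp [ρ]
      · intro b hb
        simp only [π]
        rw [show 3 + L.idxOf b = ((L.idxOf b + 1) + 1) + 1 by omega]
        simp only [vcons_succ]
        exact foldr_vcons_get _ _ _ ((hL b).2 hb)
    constructor
    · intro h; exact (key (W_trans ha h.1)).2 h
    · intro h; exact (key (W_trans hs h)).1 h
  exact this ▸ hs

theorem W_coll {R : ZFSet.{0} → ZFSet.{0} → Prop} (hP : DD W (fun v => R (v 1) (v 0))) {a : ZFSet.{0}} (ha : a ∈ W)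
    (hR : ∀ x ∈ a, ∃ y ∈ W, R x y) : ∃ b ∈ W, ∀ x ∈ a, ∃ y ∈ b, R x y := by
  obtain ⟨φ, h1, h2, h3⟩ := hP.out.realize
  let L := (Fm.paramSet_finite φ).toFinset.toList
  have hL : ∀ b, b ∈ L ↔ b ∈ φ.paramSet := by intro b; simp [L]
  let ρ : ℕ → ℕ := fun n => if n = 0 then 0 else 1
  let π : ZFSet.{0} → ℕ := fun a => 4 + L.idxOf a
  have hax := hW.out.2 (allClose L.length (repBody (φ.ren ρ π))) (by
    refine Or.inr ⟨L.length, φ.ren ρ π, Fm.ren_memOnly _ _ _ h1, Fm.ren_paramSet _ _ _, ?_, rfl⟩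
    intro h
    rcases Fm.ren_free _ _ _ _ h with ⟨n, hn⟩ | ⟨a, ha⟩
    · simp only [ρ] at hn; split_ifs at hn <;> omega
    · simp only [π] at ha; omega)
  have h4 := sat_allClose _ _ _ L _ _ hax (fun b hb => h2 b ((hL b).1 hb))
  simp only [repBody, Sat, and_sat, mem2_sat] at h4
  obtain ⟨b, hb, h5⟩ := h4 a ha
  refine ⟨b, hb, fun x hx => ?_⟩
  have hxW := W_trans ha hx
  have key : ∀ y ∈ W, (Sat (· ∈ W) memRel noF (φ.ren ρ π)
      (vcons y (vcons x (vcons b (vcons a (L.foldr vcons (fun _ => ∅)))))) ↔ R x y) := by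
    intro y hy
    rw [Fm.ren_sat _ _ _ φ ρ π (vcons y (fun _ => x))]
    · rw [h3 (· ∈ W) (fun _ h => h) (fun _ _ => W_trans)]
      · exact Iff.rfl
      · intro n; cases n
        · exact hy
        · exact hxW
    · intro n; cases n <;> simp [ρ]
    · intro b hb
      simp only [π]
      rw [show 4 + L.idxOf b = (((L.idxOf b + 1) + 1) + 1) + 1 by omega]
      simp only [vcons_succ]
      exact foldr_vcons_get _ _ _ ((hL b).2 hb)
  have h6 := h5 x hxW hx (by
    obtain ⟨y, hy, hr⟩ := hR x hx
    exact ⟨y, hy, (key y hy).2 hr⟩)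
  obtain ⟨y, hy, hyb, hs⟩ := h6
  exact ⟨y, hyb, (key y hy).1 hs⟩

theorem W_pair {a b : ZFSet.{0}} (ha : a ∈ W) (hb : b ∈ W) : ({a, b} : ZFSet.{0}) ∈ W := by
  have h := hW.out.2 pairAx (by simp [ZFCax])
  simp only [SatV, pairAx, Sat, and_sat, mem2_sat] at h
  obtain ⟨c, hc, h1, h2⟩ := h a ha b hb
  have : Fact (a ∈ W) := ⟨ha⟩
  have : Fact (b ∈ W) := ⟨hb⟩
  have h3 := W_sep (W := W) (P := fun z => z = a ∨ z = b) inferInstance hc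
  convert h3 using 1
  ext z
  simp only [ZFSet.mem_sep, ZFSet.mem_pair]
  constructor
  · rintro (rfl | rfl)
    · exact ⟨h1, Or.inl rfl⟩
    · exact ⟨h2, Or.inr rfl⟩
  · exact fun h => h.2

theorem W_singleton {a : ZFSet.{0}} (ha : a ∈ W) : ({a} : ZFSet.{0}) ∈ W := by
  have := W_pair ha ha
  simpa using this

theorem W_opair {a b : ZFSet.{0}} (ha : a ∈ W) (hb : b ∈ W) : opair a b ∈ W :=
  W_pair (W_singleton ha) (W_pair ha hb)

theorem W_sUnion {a : ZFSet.{0}} (ha : a ∈ W) : ZFSet.sUnion a ∈ W := by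
  have h := hW.out.2 unionAx (by simp [ZFCax])
  simp only [SatV, unionAx, Sat, and_sat, mem2_sat] at h
  obtain ⟨c, hc, h1⟩ := h a ha
  have : Fact (a ∈ W) := ⟨ha⟩
  have h3 := W_sep (W := W) (P := fun z => ∃ y ∈ a, z ∈ y) inferInstance hc
  convert h3 using 1
  ext z
  simp only [ZFSet.mem_sep, ZFSet.mem_sUnion]
  constructor
  · rintro ⟨y, hy, hz⟩
    exact ⟨h1 z (W_trans (W_trans ha hy) hz) y (W_trans ha hy) ⟨hz, hy⟩, y, hy, hz⟩
  · exact fun h => h.2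

theorem W_union {a b : ZFSet.{0}} (ha : a ∈ W) (hb : b ∈ W) : a ∪ b ∈ W := by
  have := W_sUnion (W_pair ha hb)
  convert this using 1
  ext z; simp

theorem W_insert {a b : ZFSet.{0}} (ha : a ∈ W) (hb : b ∈ W) : insert a b ∈ W := by
  have := W_union (W_singleton ha) hb
  convert this using 1
  ext z; simp

theorem W_pw {a : ZFSet.{0}} (ha : a ∈ W) : pw W a ∈ W := by
  have h := hW.out.2 powAx (by simp [ZFCax])
  simp only [SatV, powAx, Sat, mem2_sat] at h
  obtain ⟨c, hc, h1⟩ := h a ha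
  have : Fact (a ∈ W) := ⟨ha⟩
  have h3 := W_sep (W := W) (P := fun z => z ⊆ a) inferInstance hc
  convert h3 using 1
  ext z
  simp only [ZFSet.mem_sep, mem_pw]
  constructor
  · rintro ⟨h4, h5⟩
    exact ⟨h1 z h4 (fun y _ hy => h5 hy), h5⟩
  · exact fun h => ⟨W_trans hc h.1, h.2⟩

instance : Fact ((∅ : ZFSet.{0}) ∈ W) := ⟨W_empty⟩
instance {a b : ZFSet.{0}} [ha : Fact (a ∈ W)] [hb : Fact (b ∈ W)] : Fact (opair a b ∈ W) := ⟨W_opair ha.out hb.out⟩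
instance {a b : ZFSet.{0}} [ha : Fact (a ∈ W)] [hb : Fact (b ∈ W)] : Fact (insert a b ∈ W) := ⟨W_insert ha.out hb.out⟩
instance {a b : ZFSet.{0}} [ha : Fact (a ∈ W)] [hb : Fact (b ∈ W)] : Fact (a ∪ b ∈ W) := ⟨W_union ha.out hb.out⟩
instance {a : ZFSet.{0}} [ha : Fact (a ∈ W)] : Fact (({a} : ZFSet.{0}) ∈ W) := ⟨W_singleton ha.out⟩
theorem W_natZ (m : ℕ) : natZ m ∈ W := by
  induction m with
  | zero => exact W_empty
  | succ m ih => exact W_insert ih ih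
instance (m : ℕ) : Fact (natZ m ∈ W) := ⟨W_natZ m⟩

theorem W_prod {a b : ZFSet.{0}} (ha : a ∈ W) (hb : b ∈ W) : ZFSet.prod a b ∈ W := by
  have : Fact (a ∈ W) := ⟨ha⟩
  have : Fact (b ∈ W) := ⟨hb⟩
  have h3 := W_sep (W := W) (P := fun z => ∃ x ∈ a, ∃ y ∈ b, z = opair x y) inferInstance
    (W_pw (W_pw (W_union ha hb)))
  convert h3 using 1
  ext z
  simp only [ZFSet.mem_sep, ZFSet.mem_prod, mem_pw]
  constructor
  · rintro ⟨x, hx, y, hy, rfl⟩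
    have hx' := W_trans ha hx
    have hy' := W_trans hb hy
    refine ⟨⟨W_opair hx' hy', ?_⟩, x, hx, y, hy, rfl⟩
    intro q hq
    rw [ZFSet.pair, ZFSet.mem_pair] at hq
    rw [mem_pw]
    rcases hq with rfl | rfl
    · refine ⟨W_singleton hx', ?_⟩
      intro q hq; simp at hq; subst hq; simp [hx]
    · refine ⟨W_pair hx' hy', ?_⟩
      intro q hq; simp at hq; rcases hq with rfl | rfl <;> simp [hx, hy]
  · exact fun h => h.2

theorem W_image {f : ZFSet.{0} → ZFSet.{0}} (hf : Sm W (fun v => f (v 0))) {a : ZFSet.{0}} (ha : a ∈ W)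
    (h : ∀ x ∈ a, f x ∈ W) : zimage f a ∈ W := by
  have hf1 : Sm W (fun v => f (v 1)) := hf.ren (fun n => n + 1)
  obtain ⟨b, hb, h2⟩ := W_coll (W := W) (R := fun x y => y = f x) inferInstance ha (fun x hx => ⟨f x, h x hx, rfl⟩)
  have : Fact (a ∈ W) := ⟨ha⟩
  have h3 := W_sep (W := W) (P := fun z => ∃ x ∈ a, f x = z)
    (@DD.bex W (fun _ => a) (fun x v => f x = v 0) _ inferInstance) hb
  convert h3 using 1
  ext z
  simp only [ZFSet.mem_sep, mem_zimage]
  constructor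
  · rintro ⟨x, hx, rfl⟩
    obtain ⟨y, hy, rfl⟩ := h2 x hx
    exact ⟨hy, x, hx, rfl⟩
  · exact fun h => h.2

theorem W_inf : ∃ w ∈ W, ∀ j, natZ j ∈ w := by
  have h := hW.out.2 infAx (by simp [ZFCax])
  simp only [SatV, infAx, Sat, and_sat, mem2_sat, iff_sat, or_sat, eq2_sat] at h
  obtain ⟨w, hw, ⟨e, he, he2, he3⟩, h⟩ := h
  have e0 : e = ∅ := by
    rw [ZFSet.eq_empty]
    intro y hy
    exact he3 y (W_trans he hy) hy
  refine ⟨w, hw, fun j => ?_⟩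
  induction j with
  | zero => simp only [vcons_zero, vcons_succ] at he2; rw [e0] at he2; exact he2
  | succ j ih =>
    obtain ⟨s, hs, h1, h2, h3⟩ := h (natZ j) (W_natZ j) ih
    have : natZ (j+1) = s := by
      ext z
      simp only [natZ, ZFSet.mem_insert_iff]
      constructor
      · intro hz
        have hzW : z ∈ W := by
          rcases hz with rfl | hz
          · exact W_natZ j
          · exact W_trans (W_natZ j) hz
        exact (h3 z hzW).2 (by tauto)
      · intro hz
        have := (h3 z (W_trans hs hz)).1 hz
        exact Or.symm this
    rw [this]; exact h1

theorem W_tc (a : ZFSet.{0}) : a ∈ W → ∃ t ∈ W, t.IsTransitive ∧ a ⊆ t := by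
  induction a using ZFSet.inductionOn with
  | _ a ih =>
    intro ha
    obtain ⟨b, hb, h⟩ := W_coll (W := W) (R := fun x y => (∀ p ∈ y, ∀ q ∈ p, q ∈ y) ∧ x ⊆ y) inferInstance ha (by
      intro x hx
      obtain ⟨t, h1, h2, h3⟩ := ih x hx (W_trans ha hx)
      exact ⟨t, h1, fun p hp q hq => h2 p hp hq, h3⟩)
    have h4 := W_sep (W := W) (P := fun y => (∀ p ∈ y, ∀ q ∈ p, q ∈ y)) inferInstance hb
    refine ⟨_, W_union ha (W_sUnion h4), ?_, ?_⟩
    · intro p hp q hq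
      simp only [ZFSet.mem_union, ZFSet.mem_sUnion, ZFSet.mem_sep] at hp ⊢
      right
      rcases hp with hp | ⟨y, hy, hp⟩
      · obtain ⟨y, hy, h5, h6⟩ := h p hp
        exact ⟨y, ⟨hy, h5⟩, h6 hq⟩
      · exact ⟨y, hy, hy.2 p hp q hq⟩
    · intro p hp; simp [hp]

end
end SmallExt

namespace SmallExt

/-! ### Part 3: circuits -/

/-- Gate condition at `u`. -/
def Gate (D Ep En S u : ZFSet.{0}) : Prop :=
  (∃ m ∈ D, opair u m ∈ Ep ∧ m ∈ S) ∨ (∃ m ∈ D, opair u m ∈ En ∧ m ∉ S)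

def Cons (D Lf Ep En S : ZFSet.{0}) : Prop := ∀ u ∈ D, u ∉ Lf → (u ∈ S ↔ Gate D Ep En S u)

def Edge (Ep En m u : ZFSet.{0}) : Prop := opair u m ∈ Ep ∨ opair u m ∈ En

theorem gate_congr {D Ep En S S' u : ZFSet.{0}} (h : ∀ m ∈ D, Edge Ep En m u → (m ∈ S ↔ m ∈ S')) :
    Gate D Ep En S u ↔ Gate D Ep En S' u := by
  unfold Gate
  apply or_congr
  · refine exists_congr fun m => and_congr_right fun hm => and_congr_right fun he => h m hm (Or.inl he)
  · refine exists_congr fun m => and_congr_right fun hm => and_congr_right fun he => not_congr (h m hm (Or.inr he))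

/-- approximations to the evaluation of a circuit -/
def Approx (D Lf Ep En S0 F X : ZFSet.{0}) : Prop :=
  ∀ u ∈ F, (∀ m ∈ D, opair u m ∈ Ep ∨ opair u m ∈ En → m ∈ F) ∧
    (u ∈ X ↔ (u ∈ Lf ∧ u ∈ S0) ∨ (u ∉ Lf ∧
      ((∃ m ∈ D, opair u m ∈ Ep ∧ m ∈ X) ∨ (∃ m ∈ D, opair u m ∈ En ∧ m ∉ X))))

theorem approx_unique {D Lf Ep En S0 F X F' X' : ZFSet.{0}} (wf : WellFounded (Edge Ep En))
    (h : Approx D Lf Ep En S0 F X) (h' : Approx D Lf Ep En S0 F' X') (u : ZFSet.{0}) :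
    u ∈ F → u ∈ F' → (u ∈ X ↔ u ∈ X') := by
  induction u using wf.induction with
  | _ u ih =>
    intro h1 h2
    rw [(h u h1).2, (h' u h2).2]
    have := gate_congr (D := D) (Ep := Ep) (En := En) (S := X) (S' := X') (u := u)
      (fun m hm he => ih m he ((h u h1).1 m hm he) ((h' u h2).1 m hm he))
    unfold Gate at this
    rw [this]

theorem cons_unique {D Lf Ep En S S' : ZFSet.{0}} (wf : WellFounded (Edge Ep En))
    (h : Cons D Lf Ep En S) (h' : Cons D Lf Ep En S') (h0 : ∀ u ∈ D, u ∈ Lf → (u ∈ S ↔ u ∈ S')) (u : ZFSet.{0}) :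
    u ∈ D → (u ∈ S ↔ u ∈ S') := by
  induction u using wf.induction with
  | _ u ih =>
    intro h1
    by_cases hl : u ∈ Lf
    · exact h0 u h1 hl
    rw [h u h1 hl, h' u h1 hl]
    exact gate_congr fun m hm he => ih m he hm

theorem circuit_exists {W : ZFSet.{0}} [hW : Fact (IsTransModel W)] {D Lf Ep En S0 : ZFSet.{0}}
    (hD : D ∈ W) (hLf : Lf ∈ W) (hEp : Ep ∈ W) (hEn : En ∈ W) (hS0 : S0 ∈ W)
    (wf : WellFounded (Edge Ep En)) :
    ∃ S ∈ W, S ⊆ D ∧ Cons D Lf Ep En S ∧ ∀ u ∈ D, u ∈ Lf → (u ∈ S ↔ u ∈ S0) := by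
  have : Fact (D ∈ W) := ⟨hD⟩
  have : Fact (Lf ∈ W) := ⟨hLf⟩
  have : Fact (Ep ∈ W) := ⟨hEp⟩
  have : Fact (En ∈ W) := ⟨hEn⟩
  have : Fact (S0 ∈ W) := ⟨hS0⟩
  have : Fact (pw W D ∈ W) := ⟨W_pw hD⟩
  let A := Approx D Lf Ep En S0
  have hS := W_sep (W := W) (P := fun u => ∃ F ∈ pw W D, ∃ X ∈ pw W D, Approx D Lf Ep En S0 F X ∧ u ∈ F ∧ u ∈ X)
    (by unfold Approx; infer_instance) hD
  have hG := W_sep (W := W) (P := fun u => ∃ F ∈ pw W D, ∃ X ∈ pw W D, Approx D Lf Ep En S0 F X ∧ u ∈ F)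
    (by unfold Approx; infer_instance) hD
  generalize hSe : ZFSet.sep _ D = S at hS
  generalize hGe : ZFSet.sep _ D = G at hG
  have mS : ∀ u, u ∈ S ↔ u ∈ D ∧ ∃ F ∈ pw W D, ∃ X ∈ pw W D, Approx D Lf Ep En S0 F X ∧ u ∈ F ∧ u ∈ X := by
    intro u; rw [← hSe, ZFSet.mem_sep]
  have mG : ∀ u, u ∈ G ↔ u ∈ D ∧ ∃ F ∈ pw W D, ∃ X ∈ pw W D, Approx D Lf Ep En S0 F X ∧ u ∈ F := by
    intro u; rw [← hGe, ZFSet.mem_sep]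
  have SD : S ⊆ D := fun u hu => ((mS u).1 hu).1
  have GD : G ⊆ D := fun u hu => ((mG u).1 hu).1
  have SX : ∀ F ∈ pw W D, ∀ X ∈ pw W D, Approx D Lf Ep En S0 F X → ∀ u ∈ F, (u ∈ S ↔ u ∈ X) := by
    intro F hF X hX hA u hu
    constructor
    · intro h
      obtain ⟨_, F', hF', X', hX', hA', h1, h2⟩ := (mS u).1 h
      exact (approx_unique wf hA' hA u h1 hu).1 h2
    · intro h
      exact (mS u).2 ⟨(mem_pw.1 hF).2 hu, F, hF, X, hX, hA, hu, h⟩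
  have AG : Approx D Lf Ep En S0 G S := by
    intro u hu
    obtain ⟨huD, F, hF, X, hX, hA, h1⟩ := (mG u).1 hu
    have hcl := (hA u h1).1
    refine ⟨fun m hm he => (mG m).2 ⟨hm, F, hF, X, hX, hA, hcl m hm he⟩, ?_⟩
    rw [SX F hF X hX hA u h1, (hA u h1).2]
    have := gate_congr (D := D) (Ep := Ep) (En := En) (S := X) (S' := S) (u := u)
      (fun m hm he => (SX F hF X hX hA m (hcl m hm he)).symm)
    unfold Gate at this
    rw [this]
  have tot : ∀ u, u ∈ D → u ∈ G := by
    intro u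
    induction u using wf.induction with
    | _ u ih =>
      intro hu
      by_contra hG'
      have huS : u ∉ S := fun h => hG' ((mG u).2 (by
        obtain ⟨h1, F, hF, X, hX, h2, h3, _⟩ := (mS u).1 h
        exact ⟨h1, F, hF, X, hX, h2, h3⟩))
      have irr : ∀ m, Edge Ep En m u → m ≠ u := by
        rintro m he rfl
        exact wf.irrefl.irrefl m he
      have nog : ∀ g ∈ G, ∀ m ∈ D, Edge Ep En m g → m ≠ u := by
        rintro g hg m hm he rfl
        exact hG' ((AG g hg).1 m hm he)
      have ext : ∀ X ∈ W, X ⊆ D → (∀ m, m ≠ u → (m ∈ X ↔ m ∈ S)) →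
          (u ∈ X ↔ ((u ∈ Lf ∧ u ∈ S0) ∨ (u ∉ Lf ∧ Gate D Ep En S u))) → False := by
        intro X hX hXD h1 h2
        apply hG'
        refine (mG u).2 ⟨hu, insert u G, mem_pw.2 ⟨W_insert (W_trans hD hu) hG, ?_⟩, X, mem_pw.2 ⟨hX, hXD⟩, ?_, by simp⟩
        · intro y hy
          rcases ZFSet.mem_insert_iff.1 hy with rfl | hy
          · exact hu
          · exact GD hy
        · intro g hg
          have hgate : Gate D Ep En X g ↔ Gate D Ep En S g := by
            refine gate_congr fun m hm he => h1 m ?_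
            rcases ZFSet.mem_insert_iff.1 hg with rfl | hg
            · exact irr m he
            · exact nog g hg m hm he
          rcases ZFSet.mem_insert_iff.1 hg with rfl | hgG
          · refine ⟨fun m hm he => ZFSet.mem_insert_iff.2 (Or.inr (ih m he hm)), ?_⟩
            rw [h2, ← hgate]; rfl
          · refine ⟨fun m hm he => ZFSet.mem_insert_iff.2 (Or.inr ((AG g hgG).1 m hm he)), ?_⟩
            rw [h1 g (by intro h; exact hG' (h ▸ hgG)), (AG g hgG).2]
            unfold Gate at hgate
            rw [hgate]
      by_cases hc : ((u ∈ Lf ∧ u ∈ S0) ∨ (u ∉ Lf ∧ Gate D Ep En S u))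
      · refine ext (insert u S) (W_insert (W_trans hD hu) hS) ?_ ?_ ?_
        · intro y hy
          rcases ZFSet.mem_insert_iff.1 hy with rfl | hy
          · exact hu
          · exact SD hy
        · intro m hm; simp [hm]
        · simp [hc]
      · exact ext S hS SD (fun _ _ => Iff.rfl) ⟨fun h => absurd h huS, fun h => absurd h hc⟩
  refine ⟨S, hS, SD, ?_, ?_⟩
  · intro u hu hl
    have := (AG u (tot u hu)).2
    rw [this]
    constructor
    · rintro (⟨h, _⟩ | ⟨_, h⟩)
      · exact absurd h hl
      · exact h
    · intro h; exact Or.inr ⟨hl, h⟩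
  · intro u hu hl
    rw [(AG u (tot u hu)).2]
    constructor
    · rintro (⟨_, h⟩ | ⟨h, _⟩)
      · exact h
      · exact absurd hl h
    · intro h; exact Or.inl ⟨hl, h⟩

end SmallExt

namespace SmallExt

/-! ### Part 4: basic coding lemmas and the TCI of a clause set -/

theorem opair_inj {a b c d : ZFSet.{0}} : opair a b = opair c d ↔ a = c ∧ b = d := ZFSet.pair_inj

theorem mem_opair {a b q : ZFSet.{0}} : q ∈ opair a b ↔ q = {a} ∨ q = {a, b} := by
  simp [opair, ZFSet.pair]

theorem singleton_ne_empty' (a : ZFSet.{0}) : ({a} : ZFSet.{0}) ≠ ∅ := by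
  intro h; have : a ∈ ({a} : ZFSet.{0}) := by simp
  rw [h] at this; simp at this

theorem empty_notMem_opair (a b : ZFSet.{0}) : ∅ ∉ opair a b := by
  rw [mem_opair]
  rintro (h | h)
  · exact singleton_ne_empty' a h.symm
  · have : a ∈ ({a, b} : ZFSet.{0}) := by simp
    rw [← h] at this; simp at this

theorem opair_ne_empty (a b : ZFSet.{0}) : opair a b ≠ ∅ := by
  intro h
  have : ({a} : ZFSet.{0}) ∈ opair a b := mem_opair.2 (Or.inl rfl)
  rw [h] at this; simp at this

theorem sInter_opair (a b : ZFSet.{0}) : ZFSet.sInter (opair a b) = {a} := by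
  ext z
  have hne : (opair a b).Nonempty := ⟨{a}, mem_opair.2 (Or.inl rfl)⟩
  rw [ZFSet.mem_sInter hne]
  constructor
  · intro h; exact h _ (mem_opair.2 (Or.inl rfl))
  · intro h y hy
    simp at h; subst h
    rcases mem_opair.1 hy with rfl | rfl <;> simp

theorem sUnion_opair (a b : ZFSet.{0}) : ZFSet.sUnion (opair a b) = {a, b} := by
  ext z
  simp only [ZFSet.mem_sUnion, mem_opair]
  constructor
  · rintro ⟨y, rfl | rfl, h⟩
    · simp at h; simp [h]
    · exact h
  · intro h; exact ⟨_, Or.inr rfl, h⟩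

@[simp] theorem zfst_opair (a b : ZFSet.{0}) : zfst (opair a b) = a := by
  rw [zfst, sInter_opair]; ext z; simp

@[simp] theorem zsnd_opair (a b : ZFSet.{0}) : zsnd (opair a b) = b := by
  rw [zsnd, sInter_opair, sUnion_opair]
  ext z
  simp only [ZFSet.mem_sUnion, ZFSet.mem_sep, ZFSet.mem_pair, ZFSet.mem_singleton]
  constructor
  · rintro ⟨y, ⟨h1, h2⟩, h3⟩
    rcases h1 with rfl | rfl
    · by_cases hb : y = b
      · exact hb ▸ h3
      · exfalso
        refine h2 ?_ rfl
        intro h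
        have : b ∈ ({y, b} : ZFSet.{0}) := by simp
        rw [h] at this
        simp at this
        exact hb this.symm
    · exact h3
  · intro h
    refine ⟨b, ⟨Or.inr rfl, ?_⟩, h⟩
    rintro h1 rfl
    exact h1 (by ext; simp)

theorem natZ_mem {i j : ℕ} (h : i < j) : (natZ i : ZFSet.{0}) ∈ natZ j := by
  induction j with
  | zero => omega
  | succ j ih =>
    simp only [natZ, ZFSet.mem_insert_iff]
    rcases Nat.lt_succ_iff_lt_or_eq.1 h with h | rfl
    · exact Or.inr (ih h)
    · exact Or.inl rfl

theorem natZ_inj {i j : ℕ} (h : (natZ i : ZFSet.{0}) = natZ j) : i = j := by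
  rcases lt_trichotomy i j with h1 | h1 | h1
  · have := natZ_mem h1; rw [h] at this; exact absurd this (ZFSet.mem_irrefl _)
  · exact h1
  · have := natZ_mem h1; rw [h] at this; exact absurd this (ZFSet.mem_irrefl _)

theorem mem_natZ {j : ℕ} {q : ZFSet.{0}} : q ∈ natZ j ↔ ∃ i < j, q = natZ i := by
  constructor
  · induction j with
    | zero => intro h; simp [natZ] at h
    | succ j ih =>
      intro h
      simp only [natZ, ZFSet.mem_insert_iff] at h
      rcases h with rfl | h
      · exact ⟨j, by omega, rfl⟩
      · obtain ⟨i, h1, h2⟩ := ih h; exact ⟨i, by omega, h2⟩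
  · rintro ⟨i, h, rfl⟩; exact natZ_mem h

theorem zToNat_natZ (n : ℕ) : zToNat (natZ n : ZFSet.{0}) = n := by
  unfold zToNat
  have h : ∃ m, (natZ m : ZFSet.{0}) = natZ n := ⟨n, rfl⟩
  rw [dif_pos h]
  exact natZ_inj h.choose_spec

theorem iapp_eq {f d s v : ZFSet.{0}} (h : IsZFunc f d) (hs : s ∈ d) (hv : opair s v ∈ f) : iapp f s = v := by
  obtain ⟨w, hw, hu⟩ := h.2 s hs
  have : opair s (iapp f s) ∈ f := Classical.epsilon_spec (p := fun v => opair s v ∈ f) ⟨v, hv⟩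
  rw [hu _ hv, hu _ this]

theorem iapp_mem {f d s : ZFSet.{0}} (h : IsZFunc f d) (hs : s ∈ d) : opair s (iapp f s) ∈ f := by
  obtain ⟨w, hw, hu⟩ := h.2 s hs
  exact Classical.epsilon_spec (p := fun v => opair s v ∈ f) ⟨w, hw⟩

theorem zfunc_ext {f d q : ZFSet.{0}} (h : IsZFunc f d) : q ∈ f ↔ ∃ s ∈ d, q = opair s (iapp f s) := by
  constructor
  · intro hq
    obtain ⟨s, v, rfl, hs⟩ := h.1 q hq
    exact ⟨s, hs, by rw [iapp_eq h hs hq]⟩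
  · rintro ⟨s, hs, rfl⟩; exact iapp_mem h hs

theorem zlist_inj : ∀ l l' : List ZFSet.{0}, zlist l = zlist l' → l = l'
  | [], [], _ => rfl
  | [], _ :: _, h => absurd h.symm (opair_ne_empty _ _)
  | _ :: _, [], h => absurd h (opair_ne_empty _ _)
  | a :: l, b :: l', h => by
    obtain ⟨h1, h2⟩ := opair_inj.1 h
    rw [h1, zlist_inj l l' h2]

theorem ofFn_inj' {α : Type*} {n m : ℕ} {f : Fin n → α} {g : Fin m → α} (h : List.ofFn f = List.ofFn g) :
    ∃ e : n = m, ∀ i, f i = g (Fin.cast e i) := by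
  have e : n = m := by simpa using congrArg List.length h
  subst e
  refine ⟨rfl, fun i => ?_⟩
  have := List.ofFn_injective h
  rw [this]; rfl

theorem natZ_ne {i j : ℕ} (h : i ≠ j) : (natZ i : ZFSet.{0}) ≠ natZ j := fun h' => h (natZ_inj h')

theorem TmCode_inj (t : Tm) : ∀ u, TmCode t = TmCode u → t = u := by
  induction t with
  | var n =>
    intro u h
    cases u with
    | var m => rw [natZ_inj (opair_inj.1 h).2]
    | param a => exact absurd (opair_inj.1 h).1 (natZ_ne (by decide))
    | func s m a => exact absurd (opair_inj.1 h).1 (natZ_ne (by decide))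
  | param b =>
    intro u h
    cases u with
    | var m => exact absurd (opair_inj.1 h).1 (natZ_ne (by decide))
    | param a => rw [(opair_inj.1 h).2]
    | func s m a => exact absurd (opair_inj.1 h).1 (natZ_ne (by decide))
  | func s n a ih =>
    intro u h
    cases u with
    | var m => exact absurd (opair_inj.1 h).1 (natZ_ne (by decide))
    | param a => exact absurd (opair_inj.1 h).1 (natZ_ne (by decide))
    | func s' m a' =>
      obtain ⟨h1, h2⟩ := opair_inj.1 (opair_inj.1 h).2
      obtain ⟨rfl, h3⟩ := ofFn_inj' (zlist_inj _ _ h2)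
      subst h1
      congr 1
      funext i
      exact ih i _ (h3 i)

theorem FmCode_inj (f : Fm) : ∀ g, FmCode f = FmCode g → f = g := by
  induction f with
  | rel s n a =>
    intro u h
    cases u with
    | rel s' m a' =>
      obtain ⟨h1, h2⟩ := opair_inj.1 (opair_inj.1 h).2
      obtain ⟨rfl, h3⟩ := ofFn_inj' (zlist_inj _ _ h2)
      subst h1
      congr 1
      funext i
      exact TmCode_inj _ _ (h3 i)
    | _ => exact absurd (opair_inj.1 h).1 (natZ_ne (by decide))
  | eq t u =>
    intro g h
    cases g with
    | eq t' u' =>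
      obtain ⟨h1, h2⟩ := opair_inj.1 (opair_inj.1 h).2
      rw [TmCode_inj _ _ h1, TmCode_inj _ _ h2]
    | _ => exact absurd (opair_inj.1 h).1 (natZ_ne (by decide))
  | not f ih =>
    intro g h
    cases g with
    | not g => rw [ih _ (opair_inj.1 h).2]
    | _ => exact absurd (opair_inj.1 h).1 (natZ_ne (by decide))
  | imp f f' ih ih' =>
    intro g h
    cases g with
    | imp g g' =>
      obtain ⟨h1, h2⟩ := opair_inj.1 (opair_inj.1 h).2
      rw [ih _ h1, ih' _ h2]
    | _ => exact absurd (opair_inj.1 h).1 (natZ_ne (by decide))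
  | all f ih =>
    intro g h
    cases g with
    | all g => rw [ih _ (opair_inj.1 h).2]
    | _ => exact absurd (opair_inj.1 h).1 (natZ_ne (by decide))
  | ex f ih =>
    intro g h
    cases g with
    | ex g => rw [ih _ (opair_inj.1 h).2]
    | _ => exact absurd (opair_inj.1 h).1 (natZ_ne (by decide))

/-! #### the clause TCI -/

def symU : ZFSet.{0} := opair (natZ 0) (opair (natZ 1) (natZ 0))
def symR : ZFSet.{0} := opair (natZ 0) (opair (natZ 1) (natZ 1))
def symP (B : ZFSet.{0}) : ZFSet.{0} := opair (natZ 0) (opair (natZ 1) (opair B B))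

theorem symP_inj {A B : ZFSet.{0}} (h : symP A = symP B) : A = B :=
  (opair_inj.1 (opair_inj.1 (opair_inj.1 h).2).2).1
theorem symR_ne_P (B : ZFSet.{0}) : symR ≠ symP B := by
  intro h
  have := (opair_inj.1 (opair_inj.1 h).2).2
  have h2 : ∅ ∈ (natZ 1 : ZFSet.{0}) := by simp [natZ]
  rw [this] at h2
  exact empty_notMem_opair _ _ h2
theorem symU_ne_P (B : ZFSet.{0}) : symU ≠ symP B := by
  intro h
  have := (opair_inj.1 (opair_inj.1 h).2).2
  exact opair_ne_empty B B this.symm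
theorem symU_ne_R : symU ≠ symR := by
  intro h
  have := (opair_inj.1 (opair_inj.1 h).2).2
  exact absurd this (natZ_ne (by decide))

def relOf (s : ZFSet.{0}) : Fm := Fm.rel s 1 (fun _ => Tm.var 0)

def clFm (A B : ZFSet.{0}) : Fm :=
  Fm.ex (Fm.or (Fm.and (relOf symR) (relOf (symP A))) (Fm.and (Fm.not (relOf symR)) (relOf (symP B))))

def cl (D S A B : ZFSet.{0}) : Prop := ∃ y ∈ D, (y ∈ S ∧ y ∈ A) ∨ (y ∉ S ∧ y ∈ B)

def JJ (Q : ZFSet.{0}) : ZFSet.{0} := zimage (fun B => opair (symP B) B) Q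
def NN (D Q S : ZFSet.{0}) : ZFSet.{0} := opair D (insert (opair symR S) (JJ Q))

theorem NN_inj {D Q S S' : ZFSet.{0}} (h : NN D Q S = NN D Q S') : S = S' := by
  have h1 := (opair_inj.1 h).2
  have h2 : opair symR S ∈ insert (opair symR S') (JJ Q) := by rw [← h1]; simp
  rcases ZFSet.mem_insert_iff.1 h2 with h | h
  · exact (opair_inj.1 h).2
  · obtain ⟨B, _, hB⟩ := mem_zimage.1 h
    exact absurd (opair_inj.1 hB).1.symm (symR_ne_P B)

theorem ZPow_pair (D : ZFSet.{0}) (n : ℕ) (hn : 1 < n) (q : ZFSet.{0}) (hq : q ∈ ZPow D n) : ∃ a b, q = opair a b ∧ b ∈ ZPow D (n-1) := by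
  obtain ⟨n, rfl⟩ : ∃ m, n = m + 2 := ⟨n - 2, by omega⟩
  simp only [ZPow, ZFSet.mem_prod] at hq
  obtain ⟨a, _, b, hb, rfl⟩ := hq
  exact ⟨a, b, rfl, hb⟩

theorem ZPow_disj (D : ZFSet.{0}) (hD : ∀ d ∈ D, ∅ ∈ d) : ∀ m n : ℕ, 1 ≤ m → m < n → ∀ q, q ∈ ZPow D m → q ∉ ZPow D n := by
  intro m
  induction m with
  | zero => intro n h; omega
  | succ m ih =>
    intro n _ hn q h1 h2
    obtain ⟨a, b, rfl, hb⟩ := ZPow_pair D n (by omega) _ h2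
    rcases Nat.eq_zero_or_pos m with rfl | hm
    · exact empty_notMem_opair _ _ (hD _ h1)
    · obtain ⟨a', b', h3, hb'⟩ := ZPow_pair D (m+1) (by omega) _ h1
      obtain ⟨_, rfl⟩ := opair_inj.1 h3
      exact ih (n-1) hm (by omega) b hb' hb

theorem qf_all (f : Fm) (h : IsQF f) : ∀ m, IsPi m f ∧ IsSigma m f := by
  intro m
  induction m with
  | zero => exact ⟨IsPi.qf h, IsSigma.qf h⟩
  | succ m ih => exact ⟨IsPi.ofSigma ih.2, IsSigma.ofPi ih.1⟩

theorem clFm_sigma (A B : ZFSet.{0}) (n : ℕ) (hn : 1 ≤ n) : IsSigma n (clFm A B) := by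
  obtain ⟨n, rfl⟩ : ∃ m, n = m + 1 := ⟨n - 1, by omega⟩
  refine IsSigma.ex (qf_all _ ?_ _).2
  simp [IsQF, Fm.or, Fm.and, relOf]

theorem clFm_sat {D S A B I : ZFSet.{0}} (hS : iapp I symR = S) (hA : iapp I (symP A) = A) (hB : iapp I (symP B) = B) :
    SatStr (opair D I) (clFm A B) ↔ cl D S A B := by
  unfold SatStr clFm cl relOf
  simp only [Sat, or_sat, and_sat, zfst_opair, zsnd_opair, hS, hA, hB, List.ofFn_succ, List.ofFn_zero, Tm.eval,
    vcons_zero, ztuple]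

theorem clause_tci {V D : ZFSet.{0}} (Q : ZFSet.{0}) (hQ : Q = pw V D) (hD : ∀ d ∈ D, ∅ ∈ d) (K : ZFSet.{0} → Prop)
    (hK : ∀ S, S ⊆ D → (∀ A ∈ Q, ∀ B ∈ Q, (∀ S', S' ⊆ D → K S' → cl D S' A B) → cl D S A B) → K S) :
    ∃ x' : ZFSet.{0}, (∀ n, 1 ≤ n → IsSigmaTCI n x') ∧ ∀ N, ModelsTCI N x' ↔ ∃ S, S ⊆ D ∧ K S ∧ N = NN D Q S := by
  classical
  have hQD : ∀ B ∈ Q, B ⊆ D := by intro B hB; rw [hQ, mem_pw] at hB; exact hB.2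
  let T : ZFSet.{0} := zimage (fun p => FmCode (clFm (zfst p) (zsnd p)))
    (ZFSet.sep (fun p => ∀ S', S' ⊆ D → K S' → cl D S' (zfst p) (zsnd p)) (ZFSet.prod Q Q))
  have mT : ∀ c, c ∈ T ↔ ∃ A ∈ Q, ∃ B ∈ Q, (∀ S', S' ⊆ D → K S' → cl D S' A B) ∧ c = FmCode (clFm A B) := by
    intro c
    simp only [T, mem_zimage, ZFSet.mem_sep, ZFSet.mem_prod]
    constructor
    · rintro ⟨p, ⟨⟨A, hA, B, hB, rfl⟩, h⟩, rfl⟩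
      have e1 := zfst_opair A B
      have e2 := zsnd_opair A B
      unfold opair at e1 e2
      rw [e1, e2] at h
      rw [e1, e2]
      exact ⟨A, hA, B, hB, h, rfl⟩
    · rintro ⟨A, hA, B, hB, h, rfl⟩
      refine ⟨opair A B, ⟨⟨A, hA, B, hB, rfl⟩, ?_⟩, ?_⟩ <;> simp
      exact h
  let σ : ZFSet.{0} := insert symR (zimage symP Q)
  have mσ : ∀ s, s ∈ σ ↔ s = symR ∨ ∃ B ∈ Q, s = symP B := by
    intro s; simp only [σ, ZFSet.mem_insert_iff, mem_zimage, eq_comm]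
  let ϑ : ZFSet.{0} := insert (opair symU (opair D (natZ 1))) (insert (opair symR (opair D (natZ 0)))
    (zimage (fun B => opair (symP B) (opair B (natZ 1))) Q))
  have mϑ : ∀ q, q ∈ ϑ ↔ q = opair symU (opair D (natZ 1)) ∨ q = opair symR (opair D (natZ 0)) ∨
      ∃ B ∈ Q, q = opair (symP B) (opair B (natZ 1)) := by
    intro q; simp only [ϑ, ZFSet.mem_insert_iff, mem_zimage, eq_comm]
  let x' := opair T (opair σ (opair symU ϑ))
  have eT : tciT x' = T := by simp [x', tciT]
  have eσ : tciSig x' = σ := by simp [x', tciSig]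
  have eU : tciUdot x' = symU := by simp [x', tciUdot]
  have eϑ : tciTheta x' = ϑ := by simp [x', tciTheta]
  have fϑ : IsZFunc ϑ (insert symU σ) := by
    constructor
    · intro q hq
      rcases (mϑ q).1 hq with rfl | rfl | ⟨B, hB, rfl⟩
      · exact ⟨_, _, rfl, by simp⟩
      · exact ⟨_, _, rfl, ZFSet.mem_insert_iff.2 (Or.inr ((mσ _).2 (Or.inl rfl)))⟩
      · exact ⟨_, _, rfl, ZFSet.mem_insert_iff.2 (Or.inr ((mσ _).2 (Or.inr ⟨B, hB, rfl⟩)))⟩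
    · intro s hs
      rcases ZFSet.mem_insert_iff.1 hs with rfl | hs
      · refine ⟨_, (mϑ _).2 (Or.inl rfl), ?_⟩
        intro v hv
        rcases (mϑ _).1 hv with h | h | ⟨B, hB, h⟩
        · exact (opair_inj.1 h).2
        · exact absurd (opair_inj.1 h).1 symU_ne_R
        · exact absurd (opair_inj.1 h).1 (symU_ne_P B)
      rcases (mσ s).1 hs with rfl | ⟨B, hB, rfl⟩
      · refine ⟨_, (mϑ _).2 (Or.inr (Or.inl rfl)), ?_⟩
        intro v hv
        rcases (mϑ _).1 hv with h | h | ⟨B, hB, h⟩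
        · exact absurd (opair_inj.1 h).1.symm symU_ne_R
        · exact (opair_inj.1 h).2
        · exact absurd (opair_inj.1 h).1 (symR_ne_P B)
      · refine ⟨_, (mϑ _).2 (Or.inr (Or.inr ⟨B, hB, rfl⟩)), ?_⟩
        intro v hv
        rcases (mϑ _).1 hv with h | h | ⟨B', hB', h⟩
        · exact absurd (opair_inj.1 h).1.symm (symU_ne_P B)
        · exact absurd (opair_inj.1 h).1.symm (symR_ne_P B)
        · have := symP_inj (opair_inj.1 h).1
          subst this
          exact (opair_inj.1 h).2
  have iU : iapp ϑ symU = opair D (natZ 1) := iapp_eq fϑ (by simp) ((mϑ _).2 (Or.inl rfl))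
  have iR : iapp ϑ symR = opair D (natZ 0) := iapp_eq fϑ
    (ZFSet.mem_insert_iff.2 (Or.inr ((mσ _).2 (Or.inl rfl)))) ((mϑ _).2 (Or.inr (Or.inl rfl)))
  have iP : ∀ B ∈ Q, iapp ϑ (symP B) = opair B (natZ 1) := fun B hB => iapp_eq fϑ
    (ZFSet.mem_insert_iff.2 (Or.inr ((mσ _).2 (Or.inr ⟨B, hB, rfl⟩)))) ((mϑ _).2 (Or.inr (Or.inr ⟨B, hB, rfl⟩)))
  have hTCI : IsTCI x' := by
    unfold IsTCI
    rw [eT, eσ, eU, eϑ, iU, zfst_opair]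
    refine ⟨rfl, ?_, ?_, ?_, ?_, ?_, fϑ, ?_, ?_, ?_, ?_⟩
    · intro s hs
      rcases (mσ s).1 hs with rfl | ⟨B, hB, rfl⟩
      · exact ⟨_, _, _, rfl, Or.inl rfl, 1, rfl⟩
      · exact ⟨_, _, _, rfl, Or.inl rfl, 1, rfl⟩
    · exact ⟨_, _, _, rfl, Or.inl rfl, 1, rfl⟩
    · simp [symKind, symU]
    · simp [symArity, symU]
    · intro h
      rcases (mσ _).1 h with h | ⟨B, hB, h⟩
      · exact symU_ne_R h
      · exact symU_ne_P B h
    · intro s hs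
      rcases ZFSet.mem_insert_iff.1 hs with rfl | hs
      · exact ⟨_, _, iU, Or.inr rfl, 1, fun _ h => h⟩
      rcases (mσ s).1 hs with rfl | ⟨B, hB, rfl⟩
      · exact ⟨_, _, iR, Or.inl rfl, 1, fun _ h => h⟩
      · exact ⟨_, _, iP B hB, Or.inr rfl, 1, hQD B hB⟩
    · intro n hn
      rw [ZFSet.eq_empty]
      intro q hq
      rw [ZFSet.mem_inter] at hq
      exact ZPow_disj D hD 1 n le_rfl hn q hq.1 hq.2
    · intro m n hm hn
      rw [ZFSet.eq_empty]
      intro q hq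
      rw [ZFSet.mem_inter] at hq
      exact ZPow_disj D hD m n (by omega) hn q hq.1 hq.2
    · intro c hc
      obtain ⟨A, hA, B, hB, _, rfl⟩ := (mT c).1 hc
      refine ⟨clFm A B, rfl, ?_, ?_⟩
      · ext m; simp [clFm, Fm.free, Fm.or, Fm.and, relOf, Tm.free]
      · simp only [clFm, Fm.usesSig, Fm.or, Fm.and, relOf, Tm.usesSig]
        have h1 : symR ∈ σ := (mσ _).2 (Or.inl rfl)
        have h2 : symP A ∈ σ := (mσ _).2 (Or.inr ⟨A, hA, rfl⟩)
        have h3 : symP B ∈ σ := (mσ _).2 (Or.inr ⟨B, hB, rfl⟩)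
        simp [symKind, symArity, symR, symP] at h1 h2 h3 ⊢
        exact ⟨⟨h1, h2⟩, h1, h3⟩
  refine ⟨x', ?_, ?_⟩
  · intro n hn
    refine ⟨hTCI, ?_⟩
    rw [eT]
    intro c hc
    obtain ⟨A, hA, B, hB, _, rfl⟩ := (mT c).1 hc
    exact ⟨_, rfl, clFm_sigma A B n hn⟩
  · intro N
    have aR : arityOf symR = 1 := by simp only [arityOf, symArity, symR, zsnd_opair, zfst_opair]; exact zToNat_natZ 1
    have aP : ∀ B, arityOf (symP B) = 1 := by
      intro B; simp only [arityOf, symArity, symP, zsnd_opair, zfst_opair]; exact zToNat_natZ 1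
    have k01 : (natZ 0 : ZFSet.{0}) ≠ natZ 1 := natZ_ne (by decide)
    have k02 : (natZ 0 : ZFSet.{0}) ≠ natZ 2 := natZ_ne (by decide)
    have kR : symKind symR = natZ 0 := by simp [symKind, symR]
    have kP : ∀ B, symKind (symP B) = natZ 0 := by intro B; simp [symKind, symP]
    unfold ModelsTCI
    rw [eT, eσ, eU, eϑ, iU]
    constructor
    · rintro ⟨_, hN, hI, hU, hS, hT⟩
      have hDN : zfst N = D := (hU _ _ rfl).2 rfl
      generalize hIe : zsnd N = I at *
      rw [hDN] at hN hS
      have hRD : iapp I symR ⊆ D := by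
        have := ((hS symR ((mσ _).2 (Or.inl rfl)) _ _ iR).1 kR).1 rfl
        intro q hq
        exact (ZFSet.mem_inter.1 (this hq)).1
      have hPB : ∀ B ∈ Q, iapp I (symP B) = B := by
        intro B hB
        have := ((hS (symP B) ((mσ _).2 (Or.inr ⟨B, hB, rfl⟩)) _ _ (iP B hB)).1 (kP B)).2 rfl
        rw [this, aP]
        ext q
        rw [ZFSet.mem_inter]
        exact ⟨fun h => h.1, fun h => ⟨h, hQD B hB h⟩⟩
      refine ⟨iapp I symR, hRD, hK _ hRD ?_, ?_⟩
      · intro A hA B hB h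
        have := hT _ ((mT _).2 ⟨A, hA, B, hB, h, rfl⟩) _ rfl
        rw [hN] at this
        exact (clFm_sat rfl (hPB A hA) (hPB B hB)).1 this
      · rw [hN]
        unfold NN
        congr 1
        ext q
        rw [zfunc_ext hI, ZFSet.mem_insert_iff, JJ, mem_zimage]
        constructor
        · rintro ⟨s, hs, rfl⟩
          rcases (mσ s).1 hs with rfl | ⟨B, hB, rfl⟩
          · exact Or.inl rfl
          · exact Or.inr ⟨B, hB, by rw [hPB B hB]⟩
        · rintro (rfl | ⟨B, hB, rfl⟩)
          · exact ⟨_, (mσ _).2 (Or.inl rfl), rfl⟩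
          · exact ⟨_, (mσ _).2 (Or.inr ⟨B, hB, rfl⟩), by rw [hPB B hB]⟩
    · rintro ⟨S, hSD, hKS, rfl⟩
      generalize hIe : insert (opair symR S) (JJ Q) = I
      have mI : ∀ q, q ∈ I ↔ q = opair symR S ∨ ∃ B ∈ Q, q = opair (symP B) B := by
        intro q; rw [← hIe]; simp only [JJ, ZFSet.mem_insert_iff, mem_zimage, eq_comm]
      have hI : IsZFunc I σ := by
        constructor
        · intro q hq
          rcases (mI q).1 hq with rfl | ⟨B, hB, rfl⟩
          · exact ⟨_, _, rfl, (mσ _).2 (Or.inl rfl)⟩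
          · exact ⟨_, _, rfl, (mσ _).2 (Or.inr ⟨B, hB, rfl⟩)⟩
        · intro s hs
          rcases (mσ s).1 hs with rfl | ⟨B, hB, rfl⟩
          · refine ⟨S, (mI _).2 (Or.inl rfl), ?_⟩
            intro v hv
            rcases (mI _).1 hv with h | ⟨B, hB, h⟩
            · exact (opair_inj.1 h).2
            · exact absurd (opair_inj.1 h).1 (symR_ne_P B)
          · refine ⟨B, (mI _).2 (Or.inr ⟨B, hB, rfl⟩), ?_⟩
            intro v hv
            rcases (mI _).1 hv with h | ⟨B', hB', h⟩
            · exact absurd (opair_inj.1 h).1.symm (symR_ne_P B)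
            · have := symP_inj (opair_inj.1 h).1
              subst this
              exact (opair_inj.1 h).2
      have hRS : iapp I symR = S := iapp_eq hI ((mσ _).2 (Or.inl rfl)) ((mI _).2 (Or.inl rfl))
      have hPB : ∀ B ∈ Q, iapp I (symP B) = B := fun B hB =>
        iapp_eq hI ((mσ _).2 (Or.inr ⟨B, hB, rfl⟩)) ((mI _).2 (Or.inr ⟨B, hB, rfl⟩))
      have eN : NN D Q S = opair D I := by rw [NN, hIe]
      rw [eN, zfst_opair, zsnd_opair]
      refine ⟨hTCI, rfl, hI, ?_, ?_, ?_⟩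
      · intro y i h
        obtain ⟨rfl, rfl⟩ := opair_inj.1 h
        exact ⟨fun _ _ h => h, fun _ => rfl⟩
      · intro s hs y i h
        rcases (mσ s).1 hs with rfl | ⟨B, hB, rfl⟩
        · rw [iR] at h
          obtain ⟨rfl, rfl⟩ := opair_inj.1 h
          rw [kR]
          refine ⟨fun _ => ⟨fun _ => ?_, fun h => absurd h k01⟩, fun h => absurd h k01, fun h => absurd h k02⟩
          rw [hRS, aR]
          intro q hq
          exact ZFSet.mem_inter.2 ⟨hSD hq, hSD hq⟩
        · rw [iP B hB] at h
          obtain ⟨rfl, rfl⟩ := opair_inj.1 h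
          rw [kP]
          refine ⟨fun _ => ⟨fun h => absurd h.symm k01, fun _ => ?_⟩, fun h => absurd h k01, fun h => absurd h k02⟩
          rw [hPB _ hB, aP]
          ext q
          rw [ZFSet.mem_inter]
          exact ⟨fun h => ⟨h, hQD _ hB h⟩, fun h => h.1⟩
      · intro c hc f hf
        obtain ⟨A, hA, B, hB, h, rfl⟩ := (mT c).1 hc
        rw [FmCode_inj _ _ hf]
        exact (clFm_sat hRS (hPB A hA) (hPB B hB)).2 (h S hSD hKS)

end SmallExt

namespace SmallExt

/-! ### Part 5: finite tuples inside a transitive model -/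

section
attribute [local instance] Classical.propDecidable

theorem natZ_succ (n : ℕ) : (natZ (n+1) : ZFSet.{0}) = insert (natZ n) (natZ n) := rfl

theorem natZ_eq_iff {i j : ℕ} : (natZ i : ZFSet.{0}) = natZ j ↔ i = j := ⟨natZ_inj, fun h => by rw [h]⟩

theorem succ_inj' {a b : ZFSet.{0}} (h : (insert a a : ZFSet.{0}) = insert b b) : a = b := by
  have h1 : a ∈ (insert b b : ZFSet.{0}) := by rw [← h]; simp
  have h2 : b ∈ (insert a a : ZFSet.{0}) := by rw [h]; simp
  rw [ZFSet.mem_insert_iff] at h1 h2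
  rcases h1 with h1 | h1
  · exact h1
  rcases h2 with h2 | h2
  · exact h2.symm
  · exact absurd h1 (ZFSet.mem_asymm h2)

theorem succ_ne_empty (a : ZFSet.{0}) : (insert a a : ZFSet.{0}) ≠ ∅ := by
  intro h
  have : a ∈ (insert a a : ZFSet.{0}) := by simp
  rw [h] at this; simp at this

/-- iterated pair with end `y` -/
def nest (L : List ZFSet.{0}) (y : ZFSet.{0}) : ZFSet.{0} := L.foldr opair y

@[simp] theorem nest_nil (y : ZFSet.{0}) : nest [] y = y := rfl
@[simp] theorem nest_cons (a : ZFSet.{0}) (L) (y : ZFSet.{0}) : nest (a :: L) y = opair a (nest L y) := rfl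

theorem zlist_eq_nest (L : List ZFSet.{0}) : zlist L = nest L ∅ := by
  induction L with
  | nil => rfl
  | cons a L ih => simp [zlist, ih]

theorem ztuple_snoc (L : List ZFSet.{0}) (y : ZFSet.{0}) : ztuple (L ++ [y]) = nest L y := by
  induction L with
  | nil => rfl
  | cons a L ih =>
    cases L with
    | nil => rfl
    | cons b L =>
      show opair a (ztuple ((b :: L) ++ [y])) = _
      rw [ih]; rfl

theorem nest_inj : ∀ (L L' : List ZFSet.{0}) (y y' : ZFSet.{0}), L.length = L'.length → nest L y = nest L' y' →
    L = L' ∧ y = y'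
  | [], [], y, y', _, h => ⟨rfl, h⟩
  | a :: L, b :: L', y, y', hl, h => by
    simp only [nest_cons, opair_inj] at h
    have := nest_inj L L' y y' (by simpa using hl) h.2
    exact ⟨by rw [h.1, this.1], this.2⟩

theorem list_snoc {α : Type*} (L : List α) (n : ℕ) (h : L.length = n + 1) : ∃ L' y, L = L' ++ [y] ∧ L'.length = n := by
  have hne : L ≠ [] := by intro h'; simp [h'] at h
  refine ⟨L.dropLast, L.getLast hne, (List.dropLast_append_getLast hne).symm, by simp [h]⟩

theorem ztuple_inj (L L' : List ZFSet.{0}) (hl : L.length = L'.length) (h : ztuple L = ztuple L') : L = L' := by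
  cases hn : L.length with
  | zero =>
    have h1 : L = [] := List.length_eq_zero_iff.1 hn
    have h2 : L' = [] := List.length_eq_zero_iff.1 (hl ▸ hn)
    rw [h1, h2]
  | succ n =>
    obtain ⟨K, y, rfl, hK⟩ := list_snoc L n hn
    obtain ⟨K', y', rfl, hK'⟩ := list_snoc L' n (hl ▸ hn)
    rw [ztuple_snoc, ztuple_snoc] at h
    obtain ⟨rfl, rfl⟩ := nest_inj K K' y y' (by omega) h
    rfl

theorem mem_ZPow (z : ZFSet.{0}) : ∀ (n : ℕ) (w : ZFSet.{0}),
    w ∈ ZPow z n ↔ ∃ L : List ZFSet.{0}, L.length = n ∧ (∀ a ∈ L, a ∈ z) ∧ w = ztuple L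
  | 0, w => by
    simp only [ZPow, ZFSet.mem_singleton]
    constructor
    · intro h; exact ⟨[], rfl, by simp, h⟩
    · rintro ⟨L, h1, _, h2⟩; rw [List.length_eq_zero_iff.1 h1] at h2; exact h2
  | 1, w => by
    simp only [ZPow]
    constructor
    · intro h; exact ⟨[w], rfl, by simpa using h, rfl⟩
    · rintro ⟨L, h1, h2, h3⟩
      obtain ⟨a, rfl⟩ := List.length_eq_one_iff.1 h1
      rw [h3]; exact h2 a (by simp)
  | n + 2, w => by
    simp only [ZPow, ZFSet.mem_prod]
    constructor
    · rintro ⟨a, ha, b, hb, rfl⟩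
      obtain ⟨L, h1, h2, rfl⟩ := (mem_ZPow z (n+1) b).1 hb
      cases L with
      | nil => simp at h1
      | cons c L =>
        refine ⟨a :: c :: L, by simpa using h1, ?_, rfl⟩
        intro d hd
        rcases List.mem_cons.1 hd with rfl | hd
        · exact ha
        · exact h2 d hd
    · rintro ⟨L, h1, h2, rfl⟩
      match L, h1, h2 with
      | a :: c :: L, h1, h2 =>
        exact ⟨a, h2 a (by simp), ztuple (c :: L), (mem_ZPow z (n+1) _).2 ⟨c :: L, by simpa using h1,
          fun d hd => h2 d (List.mem_cons_of_mem _ hd), rfl⟩, rfl⟩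

theorem mem_ZPow_succ (z : ZFSet.{0}) (n : ℕ) (w : ZFSet.{0}) :
    w ∈ ZPow z (n+1) ↔ ∃ (L : List ZFSet.{0}) (b : ZFSet.{0}), L.length = n ∧ (∀ a ∈ L, a ∈ z) ∧ b ∈ z ∧ w = nest L b := by
  rw [mem_ZPow]
  constructor
  · rintro ⟨L, h1, h2, rfl⟩
    obtain ⟨K, y, rfl, hK⟩ := list_snoc L n h1
    exact ⟨K, y, hK, fun a ha => h2 a (by simp [ha]), h2 y (by simp), ztuple_snoc K y⟩
  · rintro ⟨L, b, h1, h2, h3, rfl⟩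
    refine ⟨L ++ [b], by simp [h1], ?_, (ztuple_snoc L b).symm⟩
    intro a ha
    rcases List.mem_append.1 ha with h | h
    · exact h2 a h
    · rw [List.mem_singleton.1 h]; exact h3

variable {W : ZFSet.{0}} [hW : Fact (IsTransModel W)]

theorem W_om : ∃ w ∈ W, ∀ k, k ∈ w ↔ ∃ j, k = natZ j := by
  obtain ⟨w, hw, hj⟩ := W_inf (W := W)
  have : Fact (w ∈ W) := ⟨hw⟩
  have : Fact (pw W w ∈ W) := ⟨W_pw hw⟩
  refine ⟨_, W_sep (W := W) (P := fun k => ∃ p ∈ pw W w, (∀ q ∈ p, q = ∅ ∨ ∃ m ∈ p, q = insert m m) ∧ k ∈ p)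
    inferInstance hw, ?_⟩
  intro k
  rw [ZFSet.mem_sep]
  constructor
  · rintro ⟨hkw, p, hpw, hp, hk⟩
    clear hkw
    induction k using ZFSet.inductionOn with
    | _ k ih =>
      rcases hp k hk with rfl | ⟨m, hm, rfl⟩
      · exact ⟨0, rfl⟩
      · obtain ⟨j, rfl⟩ := ih m (by simp) hm
        exact ⟨j+1, rfl⟩
  · rintro ⟨j, rfl⟩
    refine ⟨hj j, natZ (j+1), ?_, ?_, natZ_mem (by omega)⟩
    · rw [mem_pw]; refine ⟨W_natZ _, ?_⟩
      intro q hq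
      obtain ⟨i, _, rfl⟩ := mem_natZ.1 hq
      exact hj i
    · intro q hq
      obtain ⟨i, hi, rfl⟩ := mem_natZ.1 hq
      cases i with
      | zero => left; rfl
      | succ i => right; exact ⟨natZ i, natZ_mem (by omega), rfl⟩

/-- nests of depth `i` -/
def YY (Z : ZFSet.{0}) : ℕ → ZFSet.{0}
  | 0 => Z
  | i + 1 => ZFSet.prod Z (YY Z i)

theorem W_YY {Z : ZFSet.{0}} (hZ : Z ∈ W) (i : ℕ) : YY Z i ∈ W := by
  induction i with
  | zero => exact hZ
  | succ i ih => exact W_prod hZ ih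

def RN (Z k g : ZFSet.{0}) : Prop :=
  (∀ q ∈ Z, opair ∅ q ∈ g) ∧
    ∀ p ∈ g, ∀ p1 ∈ p, ∀ q ∈ p1, ∀ j ∈ k, p = opair j q → ∀ b ∈ Z, opair (insert j j) (opair b q) ∈ g

theorem RN_exists {Z : ZFSet.{0}} (hZ : Z ∈ W) (n : ℕ) :
    ∃ g ∈ W, ∀ p, p ∈ g ↔ ∃ i ≤ n, ∃ q ∈ YY Z i, p = opair (natZ i) q := by
  induction n with
  | zero =>
    refine ⟨ZFSet.prod {∅} Z, W_prod (W_singleton W_empty) hZ, ?_⟩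
    intro p
    simp [ZFSet.mem_prod, YY, opair, natZ]
  | succ n ih =>
    obtain ⟨g, hg, h⟩ := ih
    refine ⟨g ∪ ZFSet.prod {natZ (n+1)} (YY Z (n+1)), W_union hg (W_prod (W_singleton (W_natZ _)) (W_YY hZ _)), ?_⟩
    intro p
    rw [ZFSet.mem_union, h, ZFSet.mem_prod]
    constructor
    · rintro (⟨i, hi, q, hq, rfl⟩ | ⟨a, ha, q, hq, rfl⟩)
      · exact ⟨i, by omega, q, hq, rfl⟩
      · rw [ZFSet.mem_singleton] at ha; subst ha
        exact ⟨n+1, le_rfl, q, hq, rfl⟩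
    · rintro ⟨i, hi, q, hq, rfl⟩
      rcases Nat.lt_or_ge n i with h' | h'
      · obtain rfl : i = n+1 := by omega
        right; exact ⟨_, by simp, q, hq, rfl⟩
      · left; exact ⟨i, h', q, hq, rfl⟩

theorem opair_left {G a b : ZFSet.{0}} (hG : G.IsTransitive) (h : opair a b ∈ G) : a ∈ G := by
  have h1 : ({a} : ZFSet.{0}) ∈ G := hG _ h (mem_opair.2 (Or.inl rfl))
  exact hG _ h1 (by simp)

theorem opair_right {G a b : ZFSet.{0}} (hG : G.IsTransitive) (h : opair a b ∈ G) : b ∈ G := by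
  have h1 : ({a, b} : ZFSet.{0}) ∈ G := hG _ h (mem_opair.2 (Or.inr rfl))
  exact hG _ h1 (by simp)

theorem W_nests {Z X : ZFSet.{0}} (hZ : Z ∈ W) (hX : X ∈ W) : ∃ G ∈ W, G.IsTransitive ∧ X ∈ G ∧ Z ∈ G ∧
    (∀ j, natZ j ∈ G) ∧ ∀ L : List ZFSet.{0}, (∀ a ∈ L, a ∈ Z) → ∀ y ∈ Z, nest L y ∈ G := by
  obtain ⟨w, hw, mw⟩ := W_om (W := W)
  have : Fact (Z ∈ W) := ⟨hZ⟩
  obtain ⟨b, hb, hb2⟩ := W_coll (W := W) (R := fun k g => RN Z k g) (by unfold RN; infer_instance) hw (by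
    intro k hk
    obtain ⟨n, rfl⟩ := (mw k).1 hk
    obtain ⟨g, hg, h⟩ := RN_exists (W := W) hZ n
    refine ⟨g, hg, ?_, ?_⟩
    · intro q hq; exact (h _).2 ⟨0, by omega, q, hq, rfl⟩
    · rintro p hp _ _ q _ j hj rfl c hc
      obtain ⟨i, hi, q', hq', he⟩ := (h _).1 hp
      rw [opair_inj] at he
      obtain ⟨rfl, rfl⟩ := he
      obtain ⟨i', hi', he⟩ := mem_natZ.1 hj
      obtain rfl := natZ_inj he
      exact (h _).2 ⟨i+1, by omega, _, ZFSet.mem_prod.2 ⟨c, hc, q, hq', rfl⟩, rfl⟩)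
  obtain ⟨G, hG, tG, h⟩ := W_tc (W := W) ({X, Z, w, b} : ZFSet.{0})
    (W_insert hX (W_insert hZ (W_insert hw (W_singleton hb))))
  have hwG : w ∈ G := h (by simp)
  have hbG : b ∈ G := h (by simp)
  refine ⟨G, hG, tG, h (by simp), h (by simp), fun j => tG _ hwG ((mw _).2 ⟨j, rfl⟩), ?_⟩
  intro L hL y hy
  obtain ⟨g, hg, h1, h2⟩ := hb2 (natZ L.length) ((mw _).2 ⟨_, rfl⟩)
  have key : ∀ K : List ZFSet.{0}, (∀ a ∈ K, a ∈ Z) → K.length ≤ L.length → opair (natZ K.length) (nest K y) ∈ g := by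
    intro K
    induction K with
    | nil => intro _ _; exact h1 y hy
    | cons a K ih =>
      intro hK hl
      have := ih (fun c hc => hK c (List.mem_cons_of_mem _ hc)) (by simp at hl; omega)
      exact h2 _ this {natZ K.length, nest K y} (mem_opair.2 (Or.inr rfl)) _ (by simp) _
        (natZ_mem (by simpa using hl)) rfl a (hK a (by simp))
  exact opair_right tG (tG _ (tG _ hbG hg) (key L hL le_rfl))

/-- quadruples -/
def ent (i p q r : ZFSet.{0}) : ZFSet.{0} := opair i (opair p (opair q r))

theorem ent_inj {i p q r i' p' q' r' : ZFSet.{0}} :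
    ent i p q r = ent i' p' q' r' ↔ i = i' ∧ p = p' ∧ q = q' ∧ r = r' := by
  simp [ent, opair_inj]

instance Sm.ent {f1 f2 f3 f4} [Sm W f1] [Sm W f2] [Sm W f3] [Sm W f4] :
    Sm W (fun v => ent (f1 v) (f2 v) (f3 v) (f4 v)) := by
  unfold SmallExt.ent; infer_instance

def EE (G : ZFSet.{0}) : ZFSet.{0} := ZFSet.prod G (ZFSet.prod G (ZFSet.prod G G))

theorem W_EE {G : ZFSet.{0}} (hG : G ∈ W) : EE G ∈ W := W_prod hG (W_prod hG (W_prod hG hG))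

theorem ent_mem_EE {G i p q r : ZFSet.{0}} : ent i p q r ∈ EE G ↔ i ∈ G ∧ p ∈ G ∧ q ∈ G ∧ r ∈ G := by
  simp [ent, EE, opair]

def ClG (G z p : ZFSet.{0}) : Prop :=
  ∀ n ∈ G, ∀ l ∈ G, ∀ b ∈ G, ∀ q ∈ G, ent n l b q ∈ p →
    (n = ∅ ∧ l = ∅ ∧ q = b ∧ b ∈ z) ∨
    ∃ m ∈ G, ∃ a ∈ z, ∃ l' ∈ G, ∃ q' ∈ G, n = insert m m ∧ l = opair a l' ∧ q = opair a q' ∧ ent m l' b q' ∈ p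

/-- the graph of `nest` on tuples from `z` -/
def GE (W G z : ZFSet.{0}) : ZFSet.{0} := ZFSet.sep (fun u => ∃ p ∈ pw W (EE G), ClG G z p ∧ u ∈ p) (EE G)

theorem W_GE {G z : ZFSet.{0}} (hG : G ∈ W) (hz : z ∈ W) : GE W G z ∈ W := by
  have : Fact (G ∈ W) := ⟨hG⟩
  have : Fact (z ∈ W) := ⟨hz⟩
  have : Fact (pw W (EE G) ∈ W) := ⟨W_pw (W_EE hG)⟩
  exact W_sep (by unfold ClG; infer_instance) (W_EE hG)

theorem mem_GE {G z : ZFSet.{0}} (hG : G ∈ W) (tG : G.IsTransitive) (hn : ∀ j, natZ j ∈ G) (hzG : z ⊆ G)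
    (hL : ∀ L : List ZFSet.{0}, (∀ a ∈ L, a ∈ z) → ∀ y, y ∈ z ∨ y = ∅ → nest L y ∈ G) (n l b q : ZFSet.{0}) :
    ent n l b q ∈ GE W G z ↔ ∃ L : List ZFSet.{0}, (∀ a ∈ L, a ∈ z) ∧ n = natZ L.length ∧ l = zlist L ∧ b ∈ z ∧ q = nest L b := by
  unfold GE
  rw [ZFSet.mem_sep]
  constructor
  · rintro ⟨hue, p, hp, hc, hu⟩
    clear hue
    rw [mem_pw] at hp
    induction n using ZFSet.inductionOn generalizing l q with
    | _ n ih =>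
      obtain ⟨h1, h2, h3, h4⟩ := ent_mem_EE.1 (hp.2 hu)
      rcases hc n h1 l h2 b h3 q h4 hu with ⟨rfl, rfl, rfl, hb⟩ | ⟨m, hm, a, ha, l', hl', q', hq', rfl, rfl, rfl, hu'⟩
      · exact ⟨[], by simp, rfl, rfl, hb, rfl⟩
      · obtain ⟨L, h5, rfl, rfl, h6, rfl⟩ := ih m (by simp) l' q' hu'
        refine ⟨a :: L, ?_, rfl, rfl, h6, rfl⟩
        intro c hc'
        rcases List.mem_cons.1 hc' with rfl | h
        · exact ha
        · exact h5 c h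
  · rintro ⟨L, h1, rfl, rfl, hb, rfl⟩
    have hE : ∀ K : List ZFSet.{0}, (∀ a ∈ K, a ∈ z) → ent (natZ K.length) (zlist K) b (nest K b) ∈ EE G := by
      intro K hK
      refine ent_mem_EE.2 ⟨hn _, ?_, hzG hb, hL K hK b (Or.inl hb)⟩
      rw [zlist_eq_nest]; exact hL K hK ∅ (Or.inr rfl)
    refine ⟨hE L h1, ?_⟩
    induction L with
    | nil =>
      refine ⟨{ent ∅ ∅ b b}, ?_, ?_, ?_⟩
      · rw [mem_pw]
        have := hE [] (by simp)
        refine ⟨W_singleton (W_trans (W_EE hG) this), ?_⟩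
        intro u hu; rw [ZFSet.mem_singleton] at hu; subst hu; exact this
      · intro n _ l _ b' _ q _ h
        rw [ZFSet.mem_singleton, ent_inj] at h
        obtain ⟨rfl, rfl, rfl, rfl⟩ := h
        left; exact ⟨rfl, rfl, rfl, hb⟩
      · simp [natZ, zlist]
    | cons a L ih =>
      have h2 : ∀ c ∈ L, c ∈ z := fun c hc => h1 c (List.mem_cons_of_mem _ hc)
      obtain ⟨p, hp, hc, hu⟩ := ih h2
      rw [mem_pw] at hp
      have h3 := hE (a :: L) h1
      refine ⟨insert (ent (natZ (a :: L).length) (zlist (a :: L)) b (nest (a :: L) b)) p, ?_, ?_, by simp⟩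
      · rw [mem_pw]
        refine ⟨W_insert (W_trans (W_EE hG) h3) hp.1, ?_⟩
        intro u hu; rw [ZFSet.mem_insert_iff] at hu
        rcases hu with rfl | hu
        · exact h3
        · exact hp.2 hu
      · intro n h4 l h5 b' h6 q h7 h
        rw [ZFSet.mem_insert_iff] at h
        rcases h with h | h
        · rw [ent_inj] at h
          obtain ⟨rfl, rfl, rfl, rfl⟩ := h
          right
          obtain ⟨g1, g2, g3, g4⟩ := ent_mem_EE.1 (hE L h2)
          exact ⟨_, g1, a, h1 a (by simp), _, g2, _, g4, rfl, rfl, rfl, ZFSet.mem_insert_of_mem _ hu⟩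
        · rcases hc n h4 l h5 b' h6 q h7 h with h | ⟨m, hm, a', ha, l', hl', q', hq', e1, e2, e3, hu'⟩
          · left; exact h
          · right; exact ⟨m, hm, a', ha, l', hl', q', hq', e1, e2, e3, ZFSet.mem_insert_of_mem _ hu'⟩

end
end SmallExt

namespace SmallExt

/-! ### Part 6: the evaluation circuit -/

section
attribute [local instance] Classical.propDecidable

def nd (k : ℕ) (c a w y : ZFSet.{0}) : ZFSet.{0} := {∅, opair (natZ k) (opair c (opair a (opair w y)))}

theorem nd_inj {k c a w y k' c' a' w' y'} : nd k c a w y = nd k' c' a' w' y' ↔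
    k = k' ∧ c = c' ∧ a = a' ∧ w = w' ∧ y = y' := by
  constructor
  · intro h
    have h1 : opair (natZ k) (opair c (opair a (opair w y))) ∈ nd k' c' a' w' y' := by
      rw [← h]; simp [nd]
    simp only [nd, ZFSet.mem_insert_iff, ZFSet.mem_singleton] at h1
    rcases h1 with h1 | h1
    · exact absurd h1 (opair_ne_empty _ _)
    · simp only [opair_inj] at h1
      exact ⟨natZ_inj h1.1, h1.2⟩
  · rintro ⟨rfl, rfl, rfl, rfl, rfl⟩; rfl

theorem empty_mem_nd (k c a w y) : ∅ ∈ nd k c a w y := by simp [nd]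

instance Sm.nd {V : ZFSet.{0}} (k : ℕ) {f1 f2 f3 f4} [Sm V f1] [Sm V f2] [Sm V f3] [Sm V f4] :
    Sm V (fun v => nd k (f1 v) (f2 v) (f3 v) (f4 v)) := by
  unfold SmallExt.nd; infer_instance

def ndF : ZFSet.{0} := nd 2 ∅ ∅ ∅ ∅

instance Sm.ndF {V : ZFSet.{0}} : Sm V (fun _ => ndF) := by unfold SmallExt.ndF; infer_instance

/-- negative edges, first part -/
def RN1 (G z J u m : ZFSet.{0}) : Prop :=
  (∃ a ∈ G, ∃ l ∈ G, u = nd 3 (opair a l) ∅ ∅ ∅ ∧ m = nd 0 ∅ ∅ ∅ a) ∨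
  (∃ a ∈ G, ∃ y ∈ G, u = nd 4 ∅ (opair y a) ∅ y ∧ m = ndF) ∨
  (∃ n ∈ G, u = nd 4 n ∅ ∅ ∅ ∧ m = ndF) ∨
  (∃ s ∈ G, ∃ l ∈ G, ∃ a ∈ G, ∃ w ∈ G, ∃ y ∈ G, u = nd 5 (opair (natZ 2) (opair s l)) a w y ∧ m = nd 1 ∅ s w ∅) ∨
  (∃ c ∈ G, ∃ a ∈ G, ∃ w ∈ G, ∃ y ∈ z, u = nd 6 c a ∅ ∅ ∧ m = nd 5 c a w y) ∨
  (∃ p ∈ G, ∃ l ∈ G, ∃ a ∈ G, ∃ w ∈ G, ∃ y ∈ z, l ≠ ∅ ∧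
    u = nd 7 (opair (natZ 2) (opair (opair (natZ 1) p) l)) a ∅ y ∧
    m = nd 5 (opair (natZ 2) (opair (opair (natZ 1) p) l)) a w y) ∨
  (∃ p ∈ G, ∃ l ∈ G, ∃ a ∈ G, l ≠ ∅ ∧
    u = nd 7 (opair (natZ 2) (opair (opair (natZ 1) p) l)) a ∅ J ∧
    m = nd 6 (opair (natZ 2) (opair (opair (natZ 1) p) l)) a ∅ ∅)

def NP (G w : ZFSet.{0}) : Prop := ∀ y ∈ G, ∀ w' ∈ G, w ≠ opair y w'

/-- negative edges, second part -/
def RN2 (G u m : ZFSet.{0}) : Prop :=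
  (∃ a ∈ G, ∃ w ∈ G, ∃ y ∈ G, w ≠ y ∧ u = nd 8 ∅ a w y ∧ m = ndF) ∨
  (∃ t ∈ G, ∃ l ∈ G, ∃ a ∈ G, ∃ w ∈ G, ∃ y ∈ G, NP G w ∧ u = nd 8 (opair t l) a w y ∧ m = ndF) ∨
  (∃ t ∈ G, ∃ l ∈ G, ∃ a ∈ G, ∃ y1 ∈ G, ∃ w ∈ G, ∃ y ∈ G,
    u = nd 8 (opair t l) a (opair y1 w) y ∧ m = nd 7 t a ∅ y1) ∨
  (∃ a ∈ G, ∃ w ∈ G, w ≠ ∅ ∧ u = nd 9 ∅ a w ∅ ∧ m = ndF) ∨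
  (∃ t ∈ G, ∃ a ∈ G, ∃ w ∈ G, u = nd 9 (opair t ∅) a w ∅ ∧ m = nd 7 t a ∅ w) ∨
  (∃ t ∈ G, ∃ l ∈ G, ∃ a ∈ G, ∃ w ∈ G, l ≠ ∅ ∧ NP G w ∧ u = nd 9 (opair t l) a w ∅ ∧ m = ndF) ∨
  (∃ t ∈ G, ∃ l ∈ G, ∃ a ∈ G, ∃ y1 ∈ G, ∃ w ∈ G, l ≠ ∅ ∧
    u = nd 9 (opair t l) a (opair y1 w) ∅ ∧ m = nd 7 t a ∅ y1) ∨
  (∃ s ∈ G, ∃ l ∈ G, ∃ a ∈ G, ∃ w ∈ G, u = nd 10 (opair (natZ 0) (opair s l)) a w ∅ ∧ m = nd 1 ∅ s w ∅) ∨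
  (∃ t ∈ G, ∃ t' ∈ G, ∃ a ∈ G, ∃ y ∈ G, u = nd 11 (opair (natZ 1) (opair t t')) a ∅ y ∧
    (m = nd 7 t a ∅ y ∨ m = nd 7 t' a ∅ y))

/-- negative edges, third part -/
def RN3 (G z u m : ZFSet.{0}) : Prop :=
  (∃ p ∈ G, ∃ a ∈ G, ∃ w ∈ G, u = nd 12 (opair (natZ 0) p) a ∅ ∅ ∧ m = nd 10 (opair (natZ 0) p) a w ∅) ∨
  (∃ p ∈ G, ∃ a ∈ G, ∃ y ∈ G, u = nd 12 (opair (natZ 1) p) a ∅ ∅ ∧ m = nd 11 (opair (natZ 1) p) a ∅ y) ∨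
  (∃ c ∈ G, ∃ a ∈ G, u = nd 12 (opair (natZ 2) c) a ∅ ∅ ∧ m = nd 12 c a ∅ ∅) ∨
  (∃ c ∈ G, ∃ c' ∈ G, ∃ a ∈ G, u = nd 12 (opair (natZ 3) (opair c c')) a ∅ ∅ ∧ m = nd 12 c a ∅ ∅) ∨
  (∃ c ∈ G, ∃ a ∈ G, u = nd 12 (opair (natZ 4) c) a ∅ ∅ ∧ m = nd 15 c a ∅ ∅) ∨
  (∃ c ∈ G, ∃ a ∈ G, ∃ b ∈ z, u = nd 12 (opair (natZ 5) c) a ∅ ∅ ∧ m = nd 13 c (opair b a) ∅ b) ∨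
  (∃ c ∈ G, ∃ a ∈ G, ∃ b ∈ G, u = nd 13 c a ∅ b ∧ (m = nd 0 ∅ ∅ ∅ b ∨ m = nd 12 c a ∅ ∅)) ∨
  (∃ c ∈ G, ∃ a ∈ G, ∃ b ∈ G, u = nd 14 c a ∅ b ∧ m = nd 0 ∅ ∅ ∅ b) ∨
  (∃ c ∈ G, ∃ a ∈ G, ∃ b ∈ z, u = nd 15 c a ∅ ∅ ∧ m = nd 14 c (opair b a) ∅ b)

/-- positive edges -/
def RP1 (G u m : ZFSet.{0}) : Prop :=
  (∃ a ∈ G, ∃ l ∈ G, u = nd 3 (opair a l) ∅ ∅ ∅ ∧ m = nd 3 l ∅ ∅ ∅) ∨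
  (∃ n ∈ G, ∃ b ∈ G, ∃ a ∈ G, ∃ y ∈ G, u = nd 4 (insert n n) (opair b a) ∅ y ∧ m = nd 4 n a ∅ y) ∨
  (∃ s ∈ G, ∃ l ∈ G, ∃ a ∈ G, ∃ w ∈ G, ∃ y ∈ G, u = nd 5 (opair (natZ 2) (opair s l)) a w y ∧ m = nd 8 l a w y) ∨
  (∃ n ∈ G, ∃ a ∈ G, ∃ y ∈ G, u = nd 7 (opair (natZ 0) n) a ∅ y ∧ m = nd 4 n a ∅ y) ∨
  (∃ p ∈ G, ∃ l ∈ G, ∃ a ∈ G, ∃ y ∈ G, u = nd 7 (opair (natZ 2) (opair (opair (natZ 2) p) l)) a ∅ y ∧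
    m = nd 1 ∅ (opair (natZ 2) p) y ∅) ∨
  (∃ p ∈ G, ∃ a ∈ G, ∃ b ∈ G, u = nd 7 (opair (natZ 2) (opair (opair (natZ 1) p) ∅)) a ∅ {b} ∧
    m = nd 1 ∅ (opair (natZ 1) p) b ∅)

def RP2 (G u m : ZFSet.{0}) : Prop :=
  (∃ t ∈ G, ∃ l ∈ G, ∃ a ∈ G, ∃ y1 ∈ G, ∃ w ∈ G, ∃ y ∈ G,
    u = nd 8 (opair t l) a (opair y1 w) y ∧ m = nd 8 l a w y) ∨
  (∃ t ∈ G, ∃ l ∈ G, ∃ a ∈ G, ∃ y1 ∈ G, ∃ w ∈ G, l ≠ ∅ ∧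
    u = nd 9 (opair t l) a (opair y1 w) ∅ ∧ m = nd 9 l a w ∅) ∨
  (∃ s ∈ G, ∃ l ∈ G, ∃ a ∈ G, ∃ w ∈ G, u = nd 10 (opair (natZ 0) (opair s l)) a w ∅ ∧ m = nd 9 l a w ∅) ∨
  (∃ c ∈ G, ∃ c' ∈ G, ∃ a ∈ G, u = nd 12 (opair (natZ 3) (opair c c')) a ∅ ∅ ∧ m = nd 12 c' a ∅ ∅) ∨
  (∃ c ∈ G, ∃ a ∈ G, ∃ b ∈ G, u = nd 14 c a ∅ b ∧ m = nd 12 c a ∅ ∅)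

def RNe (G z J u m : ZFSet.{0}) : Prop := RN1 G z J u m ∨ RN2 G u m ∨ RN3 G z u m
def RPo (G u m : ZFSet.{0}) : Prop := RP1 G u m ∨ RP2 G u m

def DDn (G : ZFSet.{0}) : ZFSet.{0} :=
  zimage (fun p => {∅, p}) (ZFSet.prod (natZ 16) (ZFSet.prod G (ZFSet.prod G (ZFSet.prod G G))))

def EN (G z J : ZFSet.{0}) : ZFSet.{0} :=
  ZFSet.sep (fun p => ∃ u ∈ DDn G, ∃ m ∈ DDn G, p = opair u m ∧ RNe G z J u m) (ZFSet.prod (DDn G) (DDn G))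
def EP (G : ZFSet.{0}) : ZFSet.{0} :=
  ZFSet.sep (fun p => ∃ u ∈ DDn G, ∃ m ∈ DDn G, p = opair u m ∧ RPo G u m) (ZFSet.prod (DDn G) (DDn G))
def LF (G z σ : ZFSet.{0}) : ZFSet.{0} :=
  ZFSet.sep (fun u => (∃ y ∈ z, u = nd 0 ∅ ∅ ∅ y) ∨ ∃ s ∈ σ, ∃ w ∈ G, u = nd 1 ∅ s w ∅) (DDn G)

theorem mem_DDn {G k c a w y} (hk : k < 16) : nd k c a w y ∈ DDn G ↔ c ∈ G ∧ a ∈ G ∧ w ∈ G ∧ y ∈ G := by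
  unfold DDn
  rw [mem_zimage]
  constructor
  · rintro ⟨p, hp, he⟩
    simp only [ZFSet.mem_prod] at hp
    obtain ⟨k', hk', _, ⟨c', hc, _, ⟨a', ha, _, ⟨w', hw, y', hy, rfl⟩, rfl⟩, rfl⟩, rfl⟩ := hp
    obtain ⟨i, _, rfl⟩ := mem_natZ.1 hk'
    have : nd i c' a' w' y' = nd k c a w y := he
    obtain ⟨_, rfl, rfl, rfl, rfl⟩ := nd_inj.1 this
    exact ⟨hc, ha, hw, hy⟩
  · rintro ⟨hc, ha, hw, hy⟩
    refine ⟨opair (natZ k) (opair c (opair a (opair w y))), ?_, rfl⟩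
    simp [opair, hc, ha, hw, hy, natZ_mem hk]

theorem DDn_empty {G d} (h : d ∈ DDn G) : ∅ ∈ d := by
  unfold DDn at h
  rw [mem_zimage] at h
  obtain ⟨p, _, rfl⟩ := h
  simp

variable {V : ZFSet.{0}} [hV : Fact (IsTransModel V)]

theorem V_DDn {G} (hG : G ∈ V) : DDn G ∈ V := by
  have h : ZFSet.prod (natZ 16) (ZFSet.prod G (ZFSet.prod G (ZFSet.prod G G))) ∈ V :=
    W_prod (W_natZ _) (W_prod hG (W_prod hG (W_prod hG hG)))
  exact W_image inferInstance h (fun x hx => W_insert W_empty (W_singleton (W_trans h hx)))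

section
variable {G z J σ : ZFSet.{0}} [Fact (G ∈ V)] [Fact (z ∈ V)] [Fact (J ∈ V)] [Fact (σ ∈ V)]
set_option synthInstance.maxHeartbeats 400000
set_option synthInstance.maxSize 100000

instance DD.NP (i : ℕ) : DD V (fun v => NP G (v i)) := by unfold SmallExt.NP; infer_instance
instance DD.RN1 (i j : ℕ) : DD V (fun v => RN1 G z J (v i) (v j)) := by
  unfold SmallExt.RN1; infer_instance
instance DD.RN2 (i j : ℕ) : DD V (fun v => RN2 G (v i) (v j)) := by
  unfold SmallExt.RN2; infer_instance
instance DD.RN3 (i j : ℕ) : DD V (fun v => RN3 G z (v i) (v j)) := by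
  unfold SmallExt.RN3; infer_instance
instance DD.RP1 (i j : ℕ) : DD V (fun v => RP1 G (v i) (v j)) := by
  unfold SmallExt.RP1; infer_instance
instance DD.RP2 (i j : ℕ) : DD V (fun v => RP2 G (v i) (v j)) := by
  unfold SmallExt.RP2; infer_instance

end

theorem V_EN {G z J : ZFSet.{0}} (hG : G ∈ V) (hz : z ∈ V) (hJ : J ∈ V) : EN G z J ∈ V := by
  have : Fact (G ∈ V) := ⟨hG⟩
  have : Fact (z ∈ V) := ⟨hz⟩
  have : Fact (J ∈ V) := ⟨hJ⟩
  have : Fact (DDn G ∈ V) := ⟨V_DDn hG⟩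
  exact W_sep (by unfold RNe; infer_instance) (W_prod (V_DDn hG) (V_DDn hG))

theorem V_EP {G : ZFSet.{0}} (hG : G ∈ V) : EP G ∈ V := by
  have : Fact (G ∈ V) := ⟨hG⟩
  have : Fact (DDn G ∈ V) := ⟨V_DDn hG⟩
  exact W_sep (by unfold RPo; infer_instance) (W_prod (V_DDn hG) (V_DDn hG))

theorem V_LF {G z σ : ZFSet.{0}} (hG : G ∈ V) (hz : z ∈ V) (hs : σ ∈ V) : LF G z σ ∈ V := by
  have : Fact (G ∈ V) := ⟨hG⟩
  have : Fact (z ∈ V) := ⟨hz⟩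
  have : Fact (σ ∈ V) := ⟨hs⟩
  exact W_sep inferInstance (V_DDn hG)

theorem mem_EN {G z J u m} : opair u m ∈ EN G z J ↔ u ∈ DDn G ∧ m ∈ DDn G ∧ RNe G z J u m := by
  unfold EN
  rw [ZFSet.mem_sep]
  constructor
  · rintro ⟨_, u', hu, m', hm, he, h⟩
    obtain ⟨rfl, rfl⟩ := opair_inj.1 he
    exact ⟨hu, hm, h⟩
  · rintro ⟨hu, hm, h⟩
    exact ⟨by simp [opair, hu, hm], u, hu, m, hm, rfl, h⟩

theorem mem_EP {G u m} : opair u m ∈ EP G ↔ u ∈ DDn G ∧ m ∈ DDn G ∧ RPo G u m := by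
  unfold EP
  rw [ZFSet.mem_sep]
  constructor
  · rintro ⟨_, u', hu, m', hm, he, h⟩
    obtain ⟨rfl, rfl⟩ := opair_inj.1 he
    exact ⟨hu, hm, h⟩
  · rintro ⟨hu, hm, h⟩
    exact ⟨by simp [opair, hu, hm], u, hu, m, hm, rfl, h⟩

theorem rank_opair_l (a b : ZFSet.{0}) : a.rank < (opair a b).rank :=
  (ZFSet.rank_lt_of_mem (by simp : a ∈ ({a} : ZFSet.{0}))).trans (ZFSet.rank_lt_of_mem (mem_opair.2 (Or.inl rfl)))

theorem rank_opair_r (a b : ZFSet.{0}) : b.rank < (opair a b).rank :=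
  (ZFSet.rank_lt_of_mem (by simp : b ∈ ({a, b} : ZFSet.{0}))).trans (ZFSet.rank_lt_of_mem (mem_opair.2 (Or.inr rfl)))

def LT' (m u : ZFSet.{0}) : Prop := ∃ k c a w y k' c' a' w' y', u = nd k c a w y ∧ m = nd k' c' a' w' y' ∧
  (c'.rank < c.rank ∨ (c'.rank ≤ c.rank ∧ k' < k))

def meas (u : ZFSet.{0}) : Ordinal.{0} ×ₗ ℕ :=
  if h : ∃ p : Ordinal.{0} ×ₗ ℕ, ∃ k c a w y, u = nd k c a w y ∧ p = toLex (c.rank, k) then h.choose else toLex (0, 0)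

theorem meas_nd (k c a w y) : meas (nd k c a w y) = toLex (c.rank, k) := by
  unfold meas
  have h : ∃ p : Ordinal.{0} ×ₗ ℕ, ∃ k' c' a' w' y', nd k c a w y = nd k' c' a' w' y' ∧ p = toLex (c'.rank, k') :=
    ⟨_, k, c, a, w, y, rfl, rfl⟩
  rw [dif_pos h]
  obtain ⟨k', c', a', w', y', h1, h2⟩ := h.choose_spec
  rw [h2]
  obtain ⟨rfl, rfl, _⟩ := nd_inj.1 h1
  rfl

theorem LT'_wf : WellFounded LT' := by
  have h : WellFounded (InvImage (· < ·) meas) := InvImage.wf meas wellFounded_lt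
  refine Subrelation.wf ?_ h
  rintro m u ⟨k, c, a, w, y, k', c', a', w', y', rfl, rfl, h⟩
  show meas _ < meas _
  rw [meas_nd, meas_nd, Prod.Lex.toLex_lt_toLex]
  rcases h with h | ⟨h, h'⟩
  · exact Or.inl h
  · rcases h.lt_or_eq with h | h
    · exact Or.inl h
    · exact Or.inr ⟨h, h'⟩

theorem LT'.r {k c a w y k' c' a' w' y'} (h : c'.rank < c.rank) : LT' (nd k' c' a' w' y') (nd k c a w y) :=
  ⟨k, c, a, w, y, k', c', a', w', y', rfl, rfl, Or.inl h⟩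
theorem LT'.k {k c a w y k' c' a' w' y'} (h : k' < k) (hc : c' = c) : LT' (nd k' c' a' w' y') (nd k c a w y) :=
  ⟨k, c, a, w, y, k', c', a', w', y', rfl, rfl, Or.inr ⟨by rw [hc], h⟩⟩
theorem LT'.e {k c a w y k' a' w' y'} (h : k' < k) : LT' (nd k' ∅ a' w' y') (nd k c a w y) :=
  ⟨k, c, a, w, y, k', ∅, a', w', y', rfl, rfl, Or.inr ⟨by simp, h⟩⟩

theorem edge_wf (G z J : ZFSet.{0}) : WellFounded (Edge (EP G) (EN G z J)) := by
  refine Subrelation.wf ?_ LT'_wf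
  intro m u h
  have rr : ∀ a b c : ZFSet.{0}, c.rank < (opair a (opair b c)).rank := fun a b c =>
    (rank_opair_r b c).trans (rank_opair_r a _)
  have rl : ∀ a b c : ZFSet.{0}, b.rank < (opair a (opair b c)).rank := fun a b c =>
    (rank_opair_l b c).trans (rank_opair_r a _)
  rcases h with h | h
  · rcases (mem_EP.1 h).2.2 with h | h
    · rcases h with ⟨a, _, l, _, rfl, rfl⟩ | ⟨n, _, b, _, a, _, y, _, rfl, rfl⟩ | ⟨s, _, l, _, a, _, w, _, y, _, rfl, rfl⟩ |
        ⟨n, _, a, _, y, _, rfl, rfl⟩ | ⟨p, _, l, _, a, _, y, _, rfl, rfl⟩ | ⟨p, _, a, _, b, _, rfl, rfl⟩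
      · exact .r (rank_opair_r _ _)
      · exact .r (ZFSet.rank_lt_of_mem (by simp))
      · exact .r (rr _ _ _)
      · exact .r (rank_opair_r _ _)
      · exact .e (by omega)
      · exact .e (by omega)
    · rcases h with ⟨t, _, l, _, a, _, y1, _, w, _, y, _, rfl, rfl⟩ | ⟨t, _, l, _, a, _, y1, _, w, _, _, rfl, rfl⟩ |
        ⟨s, _, l, _, a, _, w, _, rfl, rfl⟩ | ⟨c, _, c', _, a, _, rfl, rfl⟩ | ⟨c, _, a, _, b, _, rfl, rfl⟩
      · exact .r (rank_opair_r _ _)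
      · exact .r (rank_opair_r _ _)
      · exact .r (rr _ _ _)
      · exact .r (rr _ _ _)
      · exact .k (by omega) rfl
  · rcases (mem_EN.1 h).2.2 with h | h | h
    · rcases h with ⟨a, _, l, _, rfl, rfl⟩ | ⟨a, _, y, _, rfl, rfl⟩ | ⟨n, _, rfl, rfl⟩ |
        ⟨s, _, l, _, a, _, w, _, y, _, rfl, rfl⟩ | ⟨c, _, a, _, w, _, y, _, rfl, rfl⟩ |
        ⟨p, _, l, _, a, _, w, _, y, _, _, rfl, rfl⟩ | ⟨p, _, l, _, a, _, _, rfl, rfl⟩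
      · exact .e (by omega)
      · exact .e (by omega)
      · exact .e (by omega)
      · exact .e (by omega)
      · exact .k (by omega) rfl
      · exact .k (by omega) rfl
      · exact .k (by omega) rfl
    · rcases h with ⟨a, _, w, _, y, _, _, rfl, rfl⟩ | ⟨t, _, l, _, a, _, w, _, y, _, _, rfl, rfl⟩ |
        ⟨t, _, l, _, a, _, y1, _, w, _, y, _, rfl, rfl⟩ | ⟨a, _, w, _, _, rfl, rfl⟩ | ⟨t, _, a, _, w, _, rfl, rfl⟩ |
        ⟨t, _, l, _, a, _, w, _, _, _, rfl, rfl⟩ | ⟨t, _, l, _, a, _, y1, _, w, _, _, rfl, rfl⟩ |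
        ⟨s, _, l, _, a, _, w, _, rfl, rfl⟩ | ⟨t, _, t', _, a, _, y, _, rfl, rfl | rfl⟩
      · exact .e (by omega)
      · exact .e (by omega)
      · exact .r (rank_opair_l _ _)
      · exact .e (by omega)
      · exact .r (rank_opair_l _ _)
      · exact .e (by omega)
      · exact .r (rank_opair_l _ _)
      · exact .e (by omega)
      · exact .r (rl _ _ _)
      · exact .r (rr _ _ _)
    · rcases h with ⟨p, _, a, _, w, _, rfl, rfl⟩ | ⟨p, _, a, _, w, _, rfl, rfl⟩ | ⟨c, _, a, _, rfl, rfl⟩ |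
        ⟨c, _, c', _, a, _, rfl, rfl⟩ | ⟨c, _, a, _, rfl, rfl⟩ | ⟨c, _, a, _, b, _, rfl, rfl⟩ |
        ⟨c, _, a, _, b, _, rfl, rfl | rfl⟩ | ⟨c, _, a, _, b, _, rfl, rfl⟩ | ⟨c, _, a, _, b, _, rfl, rfl⟩
      · exact .k (by omega) rfl
      · exact .k (by omega) rfl
      · exact .r (rank_opair_r _ _)
      · exact .r (rl _ _ _)
      · exact .r (rank_opair_r _ _)
      · exact .r (rank_opair_r _ _)
      · exact .e (by omega)
      · exact .k (by omega) rfl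
      · exact .e (by omega)
      · exact .k (by omega) rfl

end
end SmallExt

namespace SmallExt

/-! ### Part 7: gate lemmas -/

section
set_option linter.unusedSimpArgs false
set_option linter.flexible false
attribute [local instance] Classical.propDecidable

def XX (z : ZFSet.{0}) : ZFSet.{0} := insert ∅ (z ∪ zimage (fun b => {b}) z)
def ZZ (z J : ZFSet.{0}) : ZFSet.{0} := insert J (XX z)

structure Cx (G z J σ : ZFSet.{0}) : Prop where
  tG : G.IsTransitive
  zG : z ∈ G
  sG : σ ∈ G
  nat : ∀ j, natZ j ∈ G
  nests : ∀ L : List ZFSet.{0}, (∀ a ∈ L, a ∈ ZZ z J) → ∀ y ∈ ZZ z J, nest L y ∈ G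

variable {G z J σ S : ZFSet.{0}}

theorem Cx.em (h : Cx G z J σ) : ∅ ∈ G := h.nat 0
theorem Cx.zz (h : Cx G z J σ) {y} (hy : y ∈ ZZ z J) : y ∈ G := h.nests [] (by simp) y hy
theorem Cx.j (h : Cx G z J σ) : J ∈ G := h.zz (by simp [ZZ])
theorem Cx.zs (h : Cx G z J σ) {b} (hb : b ∈ z) : b ∈ G := h.tG _ h.zG hb
theorem Cx.ss (h : Cx G z J σ) {b} (hb : b ∈ σ) : b ∈ G := h.tG _ h.sG hb

abbrev CS (G z J σ S : ZFSet.{0}) : Prop := Cons (DDn G) (LF G z σ) (EP G) (EN G z J) S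

theorem gate (hS : CS G z J σ S) (k : ℕ) (hk : 2 ≤ k) (hk' : k < 16) (c a w y : ZFSet.{0})
    (hc : c ∈ G) (ha : a ∈ G) (hw : w ∈ G) (hy : y ∈ G) :
    nd k c a w y ∈ S ↔ (∃ m ∈ DDn G, RPo G (nd k c a w y) m ∧ m ∈ S) ∨
      (∃ m ∈ DDn G, RNe G z J (nd k c a w y) m ∧ m ∉ S) := by
  have hD : nd k c a w y ∈ DDn G := (mem_DDn hk').2 ⟨hc, ha, hw, hy⟩
  have hL : nd k c a w y ∉ LF G z σ := by
    unfold LF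
    rw [ZFSet.mem_sep]
    rintro ⟨_, ⟨y', _, h⟩ | ⟨s, _, w', _, h⟩⟩
    · have := (nd_inj.1 h).1; omega
    · have := (nd_inj.1 h).1; omega
  rw [hS _ hD hL]
  unfold Gate
  simp only [mem_EP, mem_EN, hD, true_and]
  refine or_congr ?_ ?_
  · exact exists_congr fun m => and_congr_right fun hm => by simp [hm]
  · exact exists_congr fun m => and_congr_right fun hm => by simp [hm]

theorem opair_ne_e (a b : ZFSet.{0}) : (opair a b = ∅) = False := eq_false (opair_ne_empty a b)
theorem e_ne_opair (a b : ZFSet.{0}) : (∅ = opair a b) = False := eq_false (fun h => opair_ne_empty a b h.symm)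

theorem succ_ne_e (a : ZFSet.{0}) : (insert a a = (∅ : ZFSet.{0})) = False := eq_false (succ_ne_empty a)
theorem e_ne_succ (a : ZFSet.{0}) : ((∅ : ZFSet.{0}) = insert a a) = False := eq_false (fun h => succ_ne_empty a h.symm)
theorem succ_inj_iff {a b : ZFSet.{0}} : (insert a a : ZFSet.{0}) = insert b b ↔ a = b :=
  ⟨succ_inj', fun h => by rw [h]⟩

theorem g2 (h : Cx G z J σ) (hS : CS G z J σ S) : nd 2 ∅ ∅ ∅ ∅ ∉ S := by
  rw [gate hS 2 (by omega) (by omega) _ _ _ _ h.em h.em h.em h.em]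
  simp [RPo, RP1, RP2, RNe, RN1, RN2, RN3, nd_inj, e_ne_opair, opair_ne_e, opair_inj, natZ_eq_iff, succ_ne_e, e_ne_succ, succ_inj_iff]

theorem g3e (h : Cx G z J σ) (hS : CS G z J σ S) : nd 3 ∅ ∅ ∅ ∅ ∉ S := by
  rw [gate hS 3 (by omega) (by omega) _ _ _ _ h.em h.em h.em h.em]
  simp [RPo, RP1, RP2, RNe, RN1, RN2, RN3, nd_inj, e_ne_opair, opair_ne_e, opair_inj, natZ_eq_iff, succ_ne_e, e_ne_succ, succ_inj_iff]

theorem fD (h : Cx G z J σ) : ndF ∈ DDn G := (mem_DDn (by omega)).2 ⟨h.em, h.em, h.em, h.em⟩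
theorem fS (h : Cx G z J σ) (hS : CS G z J σ S) : ndF ∉ S := g2 h hS

theorem g3 (h : Cx G z J σ) (hS : CS G z J σ S) {a l} (hc : opair a l ∈ G) :
    nd 3 (opair a l) ∅ ∅ ∅ ∈ S ↔ nd 3 l ∅ ∅ ∅ ∈ S ∨ nd 0 ∅ ∅ ∅ a ∉ S := by
  have e := h.em
  have fD := fD h
  have fS := fS h hS
  have hL := opair_left h.tG hc
  have hR := opair_right h.tG hc
  rw [gate hS 3 (by omega) (by omega) _ _ _ _ hc h.em h.em h.em]
  simp [RPo, RP1, RP2, RNe, RN1, RN2, RN3, nd_inj, e_ne_opair, opair_ne_e, opair_inj, natZ_eq_iff, succ_ne_e, e_ne_succ, succ_inj_iff, NP, hL, hR, hc]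
  try simp [mem_DDn, fD, fS, e, hL, hR, hc]

theorem g4e (h : Cx G z J σ) (hS : CS G z J σ S) {n y} (hn : n ∈ G) (hy : y ∈ G) :
    nd 4 n ∅ ∅ y ∈ S ↔ y = ∅ := by
  have e := h.em
  have fD := fD h
  have fS := fS h hS
  rw [gate hS 4 (by omega) (by omega) _ _ _ _ hn h.em h.em hy]
  simp [RPo, RP1, RP2, RNe, RN1, RN2, RN3, nd_inj, e_ne_opair, opair_ne_e, opair_inj, natZ_eq_iff, succ_ne_e, e_ne_succ, succ_inj_iff, NP, hn, hy]
  try simp [mem_DDn, fD, fS, e, hn, hy]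

theorem g4z (h : Cx G z J σ) (hS : CS G z J σ S) {b a y} (ha : opair b a ∈ G) (hy : y ∈ G) :
    nd 4 ∅ (opair b a) ∅ y ∈ S ↔ y = b := by
  have e := h.em
  have fD := fD h
  have fS := fS h hS
  have aL := opair_left h.tG ha
  have aR := opair_right h.tG ha
  rw [gate hS 4 (by omega) (by omega) _ _ _ _ h.em ha h.em hy]
  simp [RPo, RP1, RP2, RNe, RN1, RN2, RN3, nd_inj, e_ne_opair, opair_ne_e, opair_inj, natZ_eq_iff, succ_ne_e, e_ne_succ, succ_inj_iff, NP, ha, hy, aL, aR]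
  try simp [mem_DDn, fD, fS, e, ha, hy, aL, aR]

theorem g4s (h : Cx G z J σ) (hS : CS G z J σ S) {n b a y} (hn : insert n n ∈ G) (ha : opair b a ∈ G) (hy : y ∈ G) :
    nd 4 (insert n n) (opair b a) ∅ y ∈ S ↔ nd 4 n a ∅ y ∈ S := by
  have e := h.em
  have fD := fD h
  have fS := fS h hS
  have aL := opair_left h.tG ha
  have aR := opair_right h.tG ha
  have hn' : n ∈ G := h.tG _ hn (by simp)
  rw [gate hS 4 (by omega) (by omega) _ _ _ _ hn ha h.em hy]
  simp [RPo, RP1, RP2, RNe, RN1, RN2, RN3, nd_inj, e_ne_opair, opair_ne_e, opair_inj, natZ_eq_iff, succ_ne_e, e_ne_succ, succ_inj_iff, NP, hn, hn', ha, hy, aL, aR]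
  try simp [mem_DDn, fD, fS, e, hn, hn', ha, hy, aL, aR]

theorem g5 (h : Cx G z J σ) (hS : CS G z J σ S) {s l a w y} (hc : opair (natZ 2) (opair s l) ∈ G) (ha : a ∈ G) (hw : w ∈ G) (hy : y ∈ G) :
    nd 5 (opair (natZ 2) (opair s l)) a w y ∈ S ↔ nd 8 l a w y ∈ S ∨ nd 1 ∅ s w ∅ ∉ S := by
  have e := h.em
  have fD := fD h
  have fS := fS h hS
  have hL := opair_left h.tG hc
  have hR := opair_right h.tG hc
  have hRL := opair_left h.tG hR
  have hRR := opair_right h.tG hR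
  rw [gate hS 5 (by omega) (by omega) _ _ _ _ hc ha hw hy]
  simp [RPo, RP1, RP2, RNe, RN1, RN2, RN3, nd_inj, e_ne_opair, opair_ne_e, opair_inj, natZ_eq_iff, succ_ne_e, e_ne_succ, succ_inj_iff, NP, hL, hR, hRL, hRR, hc, ha, hw, hy]
  try simp [mem_DDn, fD, fS, e, hL, hR, hRL, hRR, hc, ha, hw, hy]

theorem g6 (h : Cx G z J σ) (hS : CS G z J σ S) {c a} (hc : c ∈ G) (ha : a ∈ G) :
    nd 6 c a ∅ ∅ ∈ S ↔ ∃ w ∈ G, ∃ y ∈ z, nd 5 c a w y ∉ S := by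
  have e := h.em
  have fD := fD h
  have fS := fS h hS
  have zs := fun b => h.zs (b := b)
  rw [gate hS 6 (by omega) (by omega) _ _ _ _ hc ha h.em h.em]
  simp [RPo, RP1, RP2, RNe, RN1, RN2, RN3, nd_inj, e_ne_opair, opair_ne_e, opair_inj, natZ_eq_iff, succ_ne_e, e_ne_succ, succ_inj_iff, NP, hc, ha]
  simp [mem_DDn, fD, fS, e, hc, ha]
  constructor
  · rintro ⟨w, y, -, ⟨hw, hy⟩, hmS⟩
    exact ⟨w, hw, y, hy, hmS⟩
  · rintro ⟨w, hw, y, hy, hmS⟩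
    exact ⟨w, y, ⟨hw, zs _ hy⟩, ⟨hw, hy⟩, hmS⟩

theorem g7v (h : Cx G z J σ) (hS : CS G z J σ S) {n a y} (hc : opair (natZ 0) n ∈ G) (ha : a ∈ G) (hy : y ∈ G) :
    nd 7 (opair (natZ 0) n) a ∅ y ∈ S ↔ nd 4 n a ∅ y ∈ S := by
  have e := h.em
  have fD := fD h
  have fS := fS h hS
  have hL := opair_left h.tG hc
  have hR := opair_right h.tG hc
  rw [gate hS 7 (by omega) (by omega) _ _ _ _ hc ha h.em hy]
  simp [RPo, RP1, RP2, RNe, RN1, RN2, RN3, nd_inj, e_ne_opair, opair_ne_e, opair_inj, natZ_eq_iff, succ_ne_e, e_ne_succ, succ_inj_iff, NP, hL, hR, hc, ha, hy]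
  try simp [mem_DDn, fD, fS, e, hL, hR, hc, ha, hy]

theorem g7c (h : Cx G z J σ) (hS : CS G z J σ S) {p l a y} (hc : opair (natZ 2) (opair (opair (natZ 2) p) l) ∈ G) (ha : a ∈ G) (hy : y ∈ G) :
    nd 7 (opair (natZ 2) (opair (opair (natZ 2) p) l)) a ∅ y ∈ S ↔ nd 1 ∅ (opair (natZ 2) p) y ∅ ∈ S := by
  have e := h.em
  have fD := fD h
  have fS := fS h hS
  have hL := opair_left h.tG hc
  have hR := opair_right h.tG hc
  have hRL := opair_left h.tG hR
  have hRR := opair_right h.tG hR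
  have hRLR := opair_right h.tG hRL
  rw [gate hS 7 (by omega) (by omega) _ _ _ _ hc ha h.em hy]
  simp [RPo, RP1, RP2, RNe, RN1, RN2, RN3, nd_inj, e_ne_opair, opair_ne_e, opair_inj, natZ_eq_iff, succ_ne_e, e_ne_succ, succ_inj_iff, NP, hL, hR, hRL, hRR, hRLR, hc, ha, hy]
  try simp [mem_DDn, fD, fS, e, hL, hR, hRL, hRR, hRLR, hc, ha, hy]

theorem g7z (h : Cx G z J σ) (hS : CS G z J σ S) {p a y} (hc : opair (natZ 2) (opair (opair (natZ 1) p) ∅) ∈ G) (ha : a ∈ G) (hy : y ∈ G) :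
    nd 7 (opair (natZ 2) (opair (opair (natZ 1) p) ∅)) a ∅ y ∈ S ↔ ∃ b ∈ G, y = {b} ∧ nd 1 ∅ (opair (natZ 1) p) b ∅ ∈ S := by
  have e := h.em
  have fD := fD h
  have fS := fS h hS
  have hL := opair_left h.tG hc
  have hR := opair_right h.tG hc
  have hRL := opair_left h.tG hR
  have hRR := opair_right h.tG hR
  have hRLR := opair_right h.tG hRL
  rw [gate hS 7 (by omega) (by omega) _ _ _ _ hc ha h.em hy]
  simp [RPo, RP1, RP2, RNe, RN1, RN2, RN3, nd_inj, e_ne_opair, opair_ne_e, opair_inj, natZ_eq_iff, succ_ne_e, e_ne_succ, succ_inj_iff, NP, hL, hR, hRL, hRR, hRLR, hc, ha, hy]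
  simp [mem_DDn, fD, fS, e, hL, hR, hRL, hRR, hRLR, hc, ha, hy]
  constructor
  · rintro ⟨b, hb, ⟨-, rfl⟩, hmS⟩
    exact ⟨b, hb, rfl, hmS⟩
  · rintro ⟨b, hb, rfl, hmS⟩
    exact ⟨b, hb, ⟨hb, rfl⟩, hmS⟩

theorem g7f (h : Cx G z J σ) (hS : CS G z J σ S) {p l a y} (hc : opair (natZ 2) (opair (opair (natZ 1) p) l) ∈ G) (hl : l ≠ ∅) (ha : a ∈ G) (hy : y ∈ G) :
    nd 7 (opair (natZ 2) (opair (opair (natZ 1) p) l)) a ∅ y ∈ S ↔ (y ∈ z ∧ ∃ w ∈ G, nd 5 (opair (natZ 2) (opair (opair (natZ 1) p) l)) a w y ∉ S) ∨ (y = J ∧ nd 6 (opair (natZ 2) (opair (opair (natZ 1) p) l)) a ∅ ∅ ∉ S) := by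
  have e := h.em
  have fD := fD h
  have fS := fS h hS
  have hL := opair_left h.tG hc
  have hR := opair_right h.tG hc
  have hRL := opair_left h.tG hR
  have hRR := opair_right h.tG hR
  have hRLR := opair_right h.tG hRL
  rw [gate hS 7 (by omega) (by omega) _ _ _ _ hc ha h.em hy]
  simp [RPo, RP1, RP2, RNe, RN1, RN2, RN3, nd_inj, e_ne_opair, opair_ne_e, opair_inj, natZ_eq_iff, succ_ne_e, e_ne_succ, succ_inj_iff, NP, hl, hL, hR, hRL, hRR, hRLR, hc, ha, hy]
  constructor
  · rintro ⟨m, hm, ⟨w, hw, hz, rfl⟩ | ⟨rfl, rfl⟩, hmS⟩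
    · exact Or.inl ⟨hz, w, hw, hmS⟩
    · exact Or.inr ⟨rfl, hmS⟩
  · rintro (⟨hz, w, hw, hmS⟩ | ⟨rfl, hmS⟩)
    · exact ⟨_, (mem_DDn (by omega)).2 ⟨hc, ha, hw, hy⟩, Or.inl ⟨w, hw, hz, rfl⟩, hmS⟩
    · exact ⟨_, (mem_DDn (by omega)).2 ⟨hc, ha, e, e⟩, Or.inr ⟨rfl, rfl⟩, hmS⟩

theorem g8e (h : Cx G z J σ) (hS : CS G z J σ S) {a w y} (ha : a ∈ G) (hw : w ∈ G) (hy : y ∈ G) :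
    nd 8 ∅ a w y ∈ S ↔ w ≠ y := by
  have e := h.em
  have fD := fD h
  have fS := fS h hS
  rw [gate hS 8 (by omega) (by omega) _ _ _ _ h.em ha hw hy]
  simp [RPo, RP1, RP2, RNe, RN1, RN2, RN3, nd_inj, e_ne_opair, opair_ne_e, opair_inj, natZ_eq_iff, succ_ne_e, e_ne_succ, succ_inj_iff, NP, ha, hw, hy]
  try simp [mem_DDn, fD, fS, e, ha, hw, hy]

theorem g8p (h : Cx G z J σ) (hS : CS G z J σ S) {t l a y1 w y} (hc : opair t l ∈ G) (ha : a ∈ G) (hw : opair y1 w ∈ G) (hy : y ∈ G) :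
    nd 8 (opair t l) a (opair y1 w) y ∈ S ↔ nd 8 l a w y ∈ S ∨ nd 7 t a ∅ y1 ∉ S := by
  have e := h.em
  have fD := fD h
  have fS := fS h hS
  have hL := opair_left h.tG hc
  have hR := opair_right h.tG hc
  have wL := opair_left h.tG hw
  have wR := opair_right h.tG hw
  rw [gate hS 8 (by omega) (by omega) _ _ _ _ hc ha hw hy]
  simp [RPo, RP1, RP2, RNe, RN1, RN2, RN3, nd_inj, e_ne_opair, opair_ne_e, opair_inj, natZ_eq_iff, succ_ne_e, e_ne_succ, succ_inj_iff, NP, hL, hR, wL, wR, hc, ha, hw, hy]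
  have hx : (∀ y ∈ G, ∀ w' ∈ G, y1 = y → ¬w = w') ↔ False :=
    ⟨fun hh => hh _ wL _ wR rfl rfl, False.elim⟩
  simp only [hx, false_and, false_or]
  simp [mem_DDn, fD, fS, e, hL, hR, wL, wR, hc, ha, hw, hy]

theorem g8n (h : Cx G z J σ) (hS : CS G z J σ S) {t l a w y} (hc : opair t l ∈ G) (ha : a ∈ G) (hw : w ∈ G) (hn : ∀ y w', w ≠ opair y w') (hy : y ∈ G) :
    nd 8 (opair t l) a w y ∈ S ↔ True := by
  have e := h.em
  have fD := fD h
  have fS := fS h hS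
  have hL := opair_left h.tG hc
  have hR := opair_right h.tG hc
  rw [gate hS 8 (by omega) (by omega) _ _ _ _ hc ha hw hy]
  simp [RPo, RP1, RP2, RNe, RN1, RN2, RN3, nd_inj, e_ne_opair, opair_ne_e, opair_inj, natZ_eq_iff, succ_ne_e, e_ne_succ, succ_inj_iff, NP, hL, hR, hc, ha, hw, hy, hn]
  try simp [mem_DDn, fD, fS, e, hL, hR, hc, ha, hw, hy, hn]

theorem g9e (h : Cx G z J σ) (hS : CS G z J σ S) {a w} (ha : a ∈ G) (hw : w ∈ G) :
    nd 9 ∅ a w ∅ ∈ S ↔ w ≠ ∅ := by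
  have e := h.em
  have fD := fD h
  have fS := fS h hS
  rw [gate hS 9 (by omega) (by omega) _ _ _ _ h.em ha hw h.em]
  simp [RPo, RP1, RP2, RNe, RN1, RN2, RN3, nd_inj, e_ne_opair, opair_ne_e, opair_inj, natZ_eq_iff, succ_ne_e, e_ne_succ, succ_inj_iff, NP, ha, hw]
  try simp [mem_DDn, fD, fS, e, ha, hw]

theorem g9o (h : Cx G z J σ) (hS : CS G z J σ S) {t a w} (hc : opair t ∅ ∈ G) (ha : a ∈ G) (hw : w ∈ G) :
    nd 9 (opair t ∅) a w ∅ ∈ S ↔ nd 7 t a ∅ w ∉ S := by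
  have e := h.em
  have fD := fD h
  have fS := fS h hS
  have hL := opair_left h.tG hc
  have hR := opair_right h.tG hc
  rw [gate hS 9 (by omega) (by omega) _ _ _ _ hc ha hw h.em]
  simp [RPo, RP1, RP2, RNe, RN1, RN2, RN3, nd_inj, e_ne_opair, opair_ne_e, opair_inj, natZ_eq_iff, succ_ne_e, e_ne_succ, succ_inj_iff, NP, hL, hR, hc, ha, hw]
  try simp [mem_DDn, fD, fS, e, hL, hR, hc, ha, hw]

theorem g9p (h : Cx G z J σ) (hS : CS G z J σ S) {t l a y1 w} (hc : opair t l ∈ G) (hl : l ≠ ∅) (ha : a ∈ G) (hw : opair y1 w ∈ G) :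
    nd 9 (opair t l) a (opair y1 w) ∅ ∈ S ↔ nd 9 l a w ∅ ∈ S ∨ nd 7 t a ∅ y1 ∉ S := by
  have e := h.em
  have fD := fD h
  have fS := fS h hS
  have hL := opair_left h.tG hc
  have hR := opair_right h.tG hc
  have wL := opair_left h.tG hw
  have wR := opair_right h.tG hw
  rw [gate hS 9 (by omega) (by omega) _ _ _ _ hc ha hw h.em]
  simp [RPo, RP1, RP2, RNe, RN1, RN2, RN3, nd_inj, e_ne_opair, opair_ne_e, opair_inj, natZ_eq_iff, succ_ne_e, e_ne_succ, succ_inj_iff, NP, hl, hL, hR, wL, wR, hc, ha, hw]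
  have hx : (∀ y ∈ G, ∀ w' ∈ G, y1 = y → ¬w = w') ↔ False :=
    ⟨fun hh => hh _ wL _ wR rfl rfl, False.elim⟩
  simp only [hx, false_and, false_or]
  simp [mem_DDn, fD, fS, e, hl, hL, hR, wL, wR, hc, ha, hw]

theorem g9n (h : Cx G z J σ) (hS : CS G z J σ S) {t l a w} (hc : opair t l ∈ G) (hl : l ≠ ∅) (ha : a ∈ G) (hw : w ∈ G) (hn : ∀ y w', w ≠ opair y w') :
    nd 9 (opair t l) a w ∅ ∈ S ↔ True := by
  have e := h.em
  have fD := fD h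
  have fS := fS h hS
  have hL := opair_left h.tG hc
  have hR := opair_right h.tG hc
  rw [gate hS 9 (by omega) (by omega) _ _ _ _ hc ha hw h.em]
  simp [RPo, RP1, RP2, RNe, RN1, RN2, RN3, nd_inj, e_ne_opair, opair_ne_e, opair_inj, natZ_eq_iff, succ_ne_e, e_ne_succ, succ_inj_iff, NP, hl, hL, hR, hc, ha, hw, hn]
  try simp [mem_DDn, fD, fS, e, hl, hL, hR, hc, ha, hw, hn]

theorem g10 (h : Cx G z J σ) (hS : CS G z J σ S) {s l a w} (hc : opair (natZ 0) (opair s l) ∈ G) (ha : a ∈ G) (hw : w ∈ G) :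
    nd 10 (opair (natZ 0) (opair s l)) a w ∅ ∈ S ↔ nd 9 l a w ∅ ∈ S ∨ nd 1 ∅ s w ∅ ∉ S := by
  have e := h.em
  have fD := fD h
  have fS := fS h hS
  have hL := opair_left h.tG hc
  have hR := opair_right h.tG hc
  have hRL := opair_left h.tG hR
  have hRR := opair_right h.tG hR
  rw [gate hS 10 (by omega) (by omega) _ _ _ _ hc ha hw h.em]
  simp [RPo, RP1, RP2, RNe, RN1, RN2, RN3, nd_inj, e_ne_opair, opair_ne_e, opair_inj, natZ_eq_iff, succ_ne_e, e_ne_succ, succ_inj_iff, NP, hL, hR, hRL, hRR, hc, ha, hw]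
  try simp [mem_DDn, fD, fS, e, hL, hR, hRL, hRR, hc, ha, hw]

theorem g11 (h : Cx G z J σ) (hS : CS G z J σ S) {t t' a y} (hc : opair (natZ 1) (opair t t') ∈ G) (ha : a ∈ G) (hy : y ∈ G) :
    nd 11 (opair (natZ 1) (opair t t')) a ∅ y ∈ S ↔ nd 7 t a ∅ y ∉ S ∨ nd 7 t' a ∅ y ∉ S := by
  have e := h.em
  have fD := fD h
  have fS := fS h hS
  have hL := opair_left h.tG hc
  have hR := opair_right h.tG hc
  have hRL := opair_left h.tG hR
  have hRR := opair_right h.tG hR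
  rw [gate hS 11 (by omega) (by omega) _ _ _ _ hc ha h.em hy]
  simp [RPo, RP1, RP2, RNe, RN1, RN2, RN3, nd_inj, e_ne_opair, opair_ne_e, opair_inj, natZ_eq_iff, succ_ne_e, e_ne_succ, succ_inj_iff, NP, hL, hR, hRL, hRR, hc, ha, hy]
  constructor
  · rintro ⟨m, hm, rfl | rfl, hmS⟩
    · exact Or.inl hmS
    · exact Or.inr hmS
  · rintro (hmS | hmS)
    · exact ⟨_, (mem_DDn (by omega)).2 (by simp [*]), Or.inl rfl, hmS⟩
    · exact ⟨_, (mem_DDn (by omega)).2 (by simp [*]), Or.inr rfl, hmS⟩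

theorem g12r (h : Cx G z J σ) (hS : CS G z J σ S) {p a} (hc : opair (natZ 0) p ∈ G) (ha : a ∈ G) :
    nd 12 (opair (natZ 0) p) a ∅ ∅ ∈ S ↔ ∃ w ∈ G, nd 10 (opair (natZ 0) p) a w ∅ ∉ S := by
  have e := h.em
  have fD := fD h
  have fS := fS h hS
  have hL := opair_left h.tG hc
  have hR := opair_right h.tG hc
  rw [gate hS 12 (by omega) (by omega) _ _ _ _ hc ha h.em h.em]
  simp [RPo, RP1, RP2, RNe, RN1, RN2, RN3, nd_inj, e_ne_opair, opair_ne_e, opair_inj, natZ_eq_iff, succ_ne_e, e_ne_succ, succ_inj_iff, NP, hL, hR, hc, ha]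
  try simp [mem_DDn, fD, fS, e, hL, hR, hc, ha]

theorem g12e (h : Cx G z J σ) (hS : CS G z J σ S) {p a} (hc : opair (natZ 1) p ∈ G) (ha : a ∈ G) :
    nd 12 (opair (natZ 1) p) a ∅ ∅ ∈ S ↔ ∃ y ∈ G, nd 11 (opair (natZ 1) p) a ∅ y ∉ S := by
  have e := h.em
  have fD := fD h
  have fS := fS h hS
  have hL := opair_left h.tG hc
  have hR := opair_right h.tG hc
  rw [gate hS 12 (by omega) (by omega) _ _ _ _ hc ha h.em h.em]
  simp [RPo, RP1, RP2, RNe, RN1, RN2, RN3, nd_inj, e_ne_opair, opair_ne_e, opair_inj, natZ_eq_iff, succ_ne_e, e_ne_succ, succ_inj_iff, NP, hL, hR, hc, ha]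
  try simp [mem_DDn, fD, fS, e, hL, hR, hc, ha]

theorem g12n (h : Cx G z J σ) (hS : CS G z J σ S) {c a} (hc : opair (natZ 2) c ∈ G) (ha : a ∈ G) :
    nd 12 (opair (natZ 2) c) a ∅ ∅ ∈ S ↔ nd 12 c a ∅ ∅ ∉ S := by
  have e := h.em
  have fD := fD h
  have fS := fS h hS
  have hL := opair_left h.tG hc
  have hR := opair_right h.tG hc
  rw [gate hS 12 (by omega) (by omega) _ _ _ _ hc ha h.em h.em]
  simp [RPo, RP1, RP2, RNe, RN1, RN2, RN3, nd_inj, e_ne_opair, opair_ne_e, opair_inj, natZ_eq_iff, succ_ne_e, e_ne_succ, succ_inj_iff, NP, hL, hR, hc, ha]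
  try simp [mem_DDn, fD, fS, e, hL, hR, hc, ha]

theorem g12i (h : Cx G z J σ) (hS : CS G z J σ S) {c c' a} (hc : opair (natZ 3) (opair c c') ∈ G) (ha : a ∈ G) :
    nd 12 (opair (natZ 3) (opair c c')) a ∅ ∅ ∈ S ↔ nd 12 c' a ∅ ∅ ∈ S ∨ nd 12 c a ∅ ∅ ∉ S := by
  have e := h.em
  have fD := fD h
  have fS := fS h hS
  have hL := opair_left h.tG hc
  have hR := opair_right h.tG hc
  have hRL := opair_left h.tG hR
  have hRR := opair_right h.tG hR
  rw [gate hS 12 (by omega) (by omega) _ _ _ _ hc ha h.em h.em]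
  simp [RPo, RP1, RP2, RNe, RN1, RN2, RN3, nd_inj, e_ne_opair, opair_ne_e, opair_inj, natZ_eq_iff, succ_ne_e, e_ne_succ, succ_inj_iff, NP, hL, hR, hRL, hRR, hc, ha]
  try simp [mem_DDn, fD, fS, e, hL, hR, hRL, hRR, hc, ha]

theorem g12a (h : Cx G z J σ) (hS : CS G z J σ S) {c a} (hc : opair (natZ 4) c ∈ G) (ha : a ∈ G) :
    nd 12 (opair (natZ 4) c) a ∅ ∅ ∈ S ↔ nd 15 c a ∅ ∅ ∉ S := by
  have e := h.em
  have fD := fD h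
  have fS := fS h hS
  have hL := opair_left h.tG hc
  have hR := opair_right h.tG hc
  rw [gate hS 12 (by omega) (by omega) _ _ _ _ hc ha h.em h.em]
  simp [RPo, RP1, RP2, RNe, RN1, RN2, RN3, nd_inj, e_ne_opair, opair_ne_e, opair_inj, natZ_eq_iff, succ_ne_e, e_ne_succ, succ_inj_iff, NP, hL, hR, hc, ha]
  try simp [mem_DDn, fD, fS, e, hL, hR, hc, ha]

theorem g12x (h : Cx G z J σ) (hS : CS G z J σ S) {c a} (hc : opair (natZ 5) c ∈ G) (ha : a ∈ G) :
    nd 12 (opair (natZ 5) c) a ∅ ∅ ∈ S ↔ ∃ b ∈ z, opair b a ∈ G ∧ nd 13 c (opair b a) ∅ b ∉ S := by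
  have e := h.em
  have fD := fD h
  have fS := fS h hS
  have hL := opair_left h.tG hc
  have hR := opair_right h.tG hc
  have zs := fun b => h.zs (b := b)
  rw [gate hS 12 (by omega) (by omega) _ _ _ _ hc ha h.em h.em]
  simp [RPo, RP1, RP2, RNe, RN1, RN2, RN3, nd_inj, e_ne_opair, opair_ne_e, opair_inj, natZ_eq_iff, succ_ne_e, e_ne_succ, succ_inj_iff, NP, hL, hR, hc, ha]
  simp [mem_DDn, fD, fS, e, hL, hR, hc, ha]
  constructor
  · rintro ⟨b, ⟨hp, -⟩, hb, hmS⟩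
    exact ⟨b, hb, hp, hmS⟩
  · rintro ⟨b, hb, hp, hmS⟩
    exact ⟨b, ⟨hp, zs _ hb⟩, hb, hmS⟩

theorem g13 (h : Cx G z J σ) (hS : CS G z J σ S) {c a b} (hc : c ∈ G) (ha : a ∈ G) (hb : b ∈ G) :
    nd 13 c a ∅ b ∈ S ↔ nd 0 ∅ ∅ ∅ b ∉ S ∨ nd 12 c a ∅ ∅ ∉ S := by
  have e := h.em
  have fD := fD h
  have fS := fS h hS
  rw [gate hS 13 (by omega) (by omega) _ _ _ _ hc ha h.em hb]
  simp [RPo, RP1, RP2, RNe, RN1, RN2, RN3, nd_inj, e_ne_opair, opair_ne_e, opair_inj, natZ_eq_iff, succ_ne_e, e_ne_succ, succ_inj_iff, NP, hc, ha, hb]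
  constructor
  · rintro ⟨m, hm, rfl | rfl, hmS⟩
    · exact Or.inl hmS
    · exact Or.inr hmS
  · rintro (hmS | hmS)
    · exact ⟨_, (mem_DDn (by omega)).2 (by simp [*]), Or.inl rfl, hmS⟩
    · exact ⟨_, (mem_DDn (by omega)).2 (by simp [*]), Or.inr rfl, hmS⟩

theorem g14 (h : Cx G z J σ) (hS : CS G z J σ S) {c a b} (hc : c ∈ G) (ha : a ∈ G) (hb : b ∈ G) :
    nd 14 c a ∅ b ∈ S ↔ nd 12 c a ∅ ∅ ∈ S ∨ nd 0 ∅ ∅ ∅ b ∉ S := by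
  have e := h.em
  have fD := fD h
  have fS := fS h hS
  rw [gate hS 14 (by omega) (by omega) _ _ _ _ hc ha h.em hb]
  simp [RPo, RP1, RP2, RNe, RN1, RN2, RN3, nd_inj, e_ne_opair, opair_ne_e, opair_inj, natZ_eq_iff, succ_ne_e, e_ne_succ, succ_inj_iff, NP, hc, ha, hb]
  try simp [mem_DDn, fD, fS, e, hc, ha, hb]

theorem g15 (h : Cx G z J σ) (hS : CS G z J σ S) {c a} (hc : c ∈ G) (ha : a ∈ G) :
    nd 15 c a ∅ ∅ ∈ S ↔ ∃ b ∈ z, opair b a ∈ G ∧ nd 14 c (opair b a) ∅ b ∉ S := by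
  have e := h.em
  have fD := fD h
  have fS := fS h hS
  have zs := fun b => h.zs (b := b)
  rw [gate hS 15 (by omega) (by omega) _ _ _ _ hc ha h.em h.em]
  simp [RPo, RP1, RP2, RNe, RN1, RN2, RN3, nd_inj, e_ne_opair, opair_ne_e, opair_inj, natZ_eq_iff, succ_ne_e, e_ne_succ, succ_inj_iff, NP, hc, ha]
  simp [mem_DDn, fD, fS, e, hc, ha]
  constructor
  · rintro ⟨b, ⟨hp, -⟩, hb, hmS⟩
    exact ⟨b, hb, hp, hmS⟩
  · rintro ⟨b, hb, hp, hmS⟩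
    exact ⟨b, ⟨hp, zs _ hb⟩, hb, hmS⟩

end
end SmallExt

namespace SmallExt

/-! ### Part 8: semantics of the circuit -/

section
attribute [local instance] Classical.propDecidable

def J0 : ZFSet.{0} := Classical.epsilon (fun _ : ZFSet.{0} => False)
def Jz (z : ZFSet.{0}) : ZFSet.{0} := if J0 ∈ XX z then J0 else XX z
def rp (z y : ZFSet.{0}) : ZFSet.{0} := if y = J0 then Jz z else y
def XJ (z y : ZFSet.{0}) : Prop := y ∈ XX z ∨ y = J0

theorem rp_id {z y} (h : y ∈ XX z) : rp z y = y := by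
  unfold rp Jz
  split_ifs with h1 h2
  · exact h1.symm
  · rw [h1] at h; exact absurd h h2
  · rfl

theorem rp_J0 (z) : rp z J0 = Jz z := by simp [rp]

theorem rp_mem {z y} (h : XJ z y) (hz : rp z y ∈ XX z) : rp z y = y := by
  rcases h with h | rfl
  · exact rp_id h
  · rw [rp_J0] at *
    unfold Jz at *
    split_ifs at * with h1
    · rfl
    · exact absurd hz (ZFSet.mem_irrefl _)

theorem rp_inj {z y y'} (h : XJ z y) (h' : XJ z y') (e : rp z y = rp z y') : y = y' := by
  by_cases hz : rp z y ∈ XX z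
  · rw [← rp_mem h hz, e, rp_mem h' (e ▸ hz)]
  · have h1 : y = J0 := by
      rcases h with h | h
      · rw [rp_id h] at hz; exact absurd h hz
      · exact h
    have h2 : y' = J0 := by
      rw [e] at hz
      rcases h' with h | h
      · rw [rp_id h] at hz; exact absurd h hz
      · exact h
    rw [h1, h2]

theorem rp_ZZ {z y} (h : XJ z y) : rp z y ∈ ZZ z (Jz z) := by
  rcases h with h | rfl
  · rw [rp_id h]; simp [ZZ, h]
  · rw [rp_J0]; simp [ZZ]

theorem z_XX {z y : ZFSet.{0}} (h : y ∈ z) : y ∈ XX z := by simp [XX, h]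

def fIs (i : ZFSet.{0} → ZFSet.{0}) (s : ZFSet.{0}) (args : List ZFSet.{0}) : ZFSet.{0} :=
  if args = [] then i s else Classical.epsilon fun b => ztuple (args ++ [b]) ∈ i s
def rIs (i : ZFSet.{0} → ZFSet.{0}) (s : ZFSet.{0}) (args : List ZFSet.{0}) : Prop :=
  ztuple args ∈ i s

structure Str (z U σ : ZFSet.{0}) (i : ZFSet.{0} → ZFSet.{0}) : Prop where
  sym : ∀ s ∈ σ, IsSymbol s
  UZ : U ⊆ z
  r : ∀ s ∈ σ, symKind s = natZ 0 → i s ⊆ ZPow U (arityOf s)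
  f : ∀ s ∈ σ, symKind s = natZ 1 → i s ⊆ ZPow U (arityOf s + 1)
  ft : ∀ s ∈ σ, symKind s = natZ 1 → ∀ args : List ZFSet.{0}, args.length = arityOf s → (∀ a ∈ args, a ∈ U) →
        ∃! b, b ∈ U ∧ ztuple (args ++ [b]) ∈ i s
  c : ∀ s ∈ σ, symKind s = natZ 2 → i s ∈ U

structure Sem (G z σ S U : ZFSet.{0}) (i : ZFSet.{0} → ZFSet.{0}) : Prop where
  cx : Cx G z (Jz z) σ
  cs : CS G z (Jz z) σ S
  hU : ∀ b ∈ z, (nd 0 ∅ ∅ ∅ b ∈ S ↔ b ∈ U)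
  h2 : ∀ s ∈ σ, symKind s = natZ 2 → ∀ w ∈ G, (nd 1 ∅ s w ∅ ∈ S ↔ w = i s)
  h1 : ∀ s ∈ σ, symKind s ≠ natZ 2 → ∀ w ∈ G, (nd 1 ∅ s w ∅ ∈ S ↔ w ∈ i s)

variable {G z σ S U : ZFSet.{0}} {i : ZFSet.{0} → ZFSet.{0}}

theorem sem_var (h : Sem G z σ S U i) : ∀ (L : List ZFSet.{0}) (_ : ∀ b ∈ L, b ∈ z) (j : ℕ), ∀ y ∈ G,
    (nd 4 (natZ j) (zlist L) ∅ y ∈ S ↔ y = L.getD j ∅)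
  | [], _, j, y, hy => by
    rw [show zlist [] = ∅ from rfl, g4e h.cx h.cs (h.cx.nat j) hy]; simp
  | b :: L, hL, 0, y, hy => by
    have := h.cx.nests (b :: L) (fun a ha => by simp [ZZ, z_XX (hL a ha)]) ∅ (by simp [ZZ, XX])
    rw [← zlist_eq_nest] at this
    rw [show zlist (b :: L) = opair b (zlist L) from rfl] at *
    rw [show natZ 0 = ∅ from rfl, g4z h.cx h.cs this hy]; simp
  | b :: L, hL, j+1, y, hy => by
    have := h.cx.nests (b :: L) (fun a ha => by simp [ZZ, z_XX (hL a ha)]) ∅ (by simp [ZZ, XX])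
    rw [← zlist_eq_nest] at this
    rw [show zlist (b :: L) = opair b (zlist L) from rfl] at *
    have hn := h.cx.nat (j+1)
    rw [natZ_succ] at *
    rw [g4s h.cx h.cs hn this hy, sem_var h L (fun a ha => hL a (by simp [ha])) j y hy]; simp

theorem sem_env (h : Sem G z σ S U i) (L : List ZFSet.{0}) (hL : ∀ b ∈ L, b ∈ z) : zlist L ∈ G := by
  rw [zlist_eq_nest]
  exact h.cx.nests L (fun a ha => by simp [ZZ, z_XX (hL a ha)]) ∅ (by simp [ZZ, XX])

theorem sem_NL (h : Sem G z σ S U i) {a} (ha : a ∈ G) (E : Tm → ZFSet.{0}) : ∀ (ts : List Tm)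
    (_ : zlist (ts.map TmCode) ∈ G)
    (_ : ∀ t ∈ ts, ∀ y ∈ G, (nd 7 (TmCode t) a ∅ y ∈ S ↔ y = E t)) (w y : ZFSet.{0}) (_ : w ∈ G) (_ : y ∈ G),
    (nd 8 (zlist (ts.map TmCode)) a w y ∈ S ↔ w ≠ nest (ts.map E) y)
  | [], _, _, w, y, hw, hy => by
    rw [show zlist (List.map TmCode []) = ∅ from rfl, g8e h.cx h.cs ha hw hy]; simp
  | t :: ts, hG, ht, w, y, hw, hy => by
    rw [show zlist (List.map TmCode (t :: ts)) = opair (TmCode t) (zlist (ts.map TmCode)) from rfl] at *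
    have hR := opair_right h.cx.tG hG
    by_cases hp : ∃ y1 w', w = opair y1 w'
    · obtain ⟨y1, w', rfl⟩ := hp
      rw [g8p h.cx h.cs hG ha hw hy, sem_NL h ha E ts hR (fun t ht' => ht t (by simp [ht'])) w' y
        (opair_right h.cx.tG hw) hy, ht t (by simp) y1 (opair_left h.cx.tG hw)]
      simp only [List.map_cons, nest_cons, ne_eq, opair_inj]
      tauto
    · push Not at hp
      rw [g8n h.cx h.cs hG ha hw hp hy]
      simp only [List.map_cons, nest_cons, true_iff]
      exact hp _ _

theorem zlist_cons (a : ZFSet.{0}) (l) : zlist (a :: l) = opair a (zlist l) := rfl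
theorem zlist_nil : zlist ([] : List ZFSet.{0}) = ∅ := rfl

theorem sem_NT (h : Sem G z σ S U i) {a} (ha : a ∈ G) (E : Tm → ZFSet.{0}) : ∀ (ts : List Tm)
    (_ : zlist (ts.map TmCode) ∈ G)
    (_ : ∀ t ∈ ts, ∀ y ∈ G, (nd 7 (TmCode t) a ∅ y ∈ S ↔ y = E t)) (w : ZFSet.{0}) (_ : w ∈ G),
    (nd 9 (zlist (ts.map TmCode)) a w ∅ ∈ S ↔ w ≠ ztuple (ts.map E))
  | [], _, _, w, hw => by
    rw [show zlist (List.map TmCode []) = ∅ from rfl, g9e h.cx h.cs ha hw]; simp [ztuple]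
  | [t], hG, ht, w, hw => by
    rw [show zlist (List.map TmCode [t]) = opair (TmCode t) ∅ from rfl] at *
    rw [g9o h.cx h.cs hG ha hw, ht t (by simp) w hw]; simp [ztuple]
  | t :: t' :: ts, hG, ht, w, hw => by
    rw [show zlist (List.map TmCode (t :: t' :: ts)) = opair (TmCode t) (zlist ((t' :: ts).map TmCode)) from rfl] at *
    have hR := opair_right h.cx.tG hG
    have hne : zlist ((t' :: ts).map TmCode) ≠ ∅ := by
      rw [List.map_cons, zlist_cons]; exact opair_ne_empty _ _
    by_cases hp : ∃ y1 w', w = opair y1 w'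
    · obtain ⟨y1, w', rfl⟩ := hp
      rw [g9p h.cx h.cs hG hne ha hw, sem_NT h ha E (t' :: ts) hR (fun t ht' => ht t (by simp [ht'])) w'
        (opair_right h.cx.tG hw), ht t (by simp) y1 (opair_left h.cx.tG hw)]
      simp only [List.map_cons, ztuple, ne_eq, opair_inj]
      tauto
    · push Not at hp
      rw [g9n h.cx h.cs hG hne ha hw hp]
      simp only [List.map_cons, ztuple, true_iff]
      exact hp _ _

theorem arityOf_eq {s : ZFSet.{0}} {n : ℕ} (h : symArity s = natZ n) : arityOf s = n := by
  unfold arityOf; rw [h, zToNat_natZ]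

/-- replacing junk in argument lists -/
theorem rp_list (hUZ : U ⊆ z) {L : List ZFSet.{0}} (hL : ∀ v ∈ L, XJ z v) :
    (∀ v ∈ L.map (rp z), v ∈ U) ∨ (∀ v ∈ L, v ∈ U) → L.map (rp z) = L := by
  intro h
  have : ∀ v ∈ L, rp z v = v := by
    rcases h with h | h
    · intro v hv
      exact rp_mem (hL v hv) (z_XX (hUZ (h _ (List.mem_map_of_mem hv))))
    · intro v hv
      exact rp_id (z_XX (hUZ (h v hv)))
  conv_rhs => rw [← List.map_id L]
  exact List.map_congr_left this

theorem rp_tuple (hUZ : U ⊆ z) {X : ZFSet.{0}} {L : List ZFSet.{0}} (hL : ∀ v ∈ L, XJ z v)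
    (hX : X ⊆ ZPow U L.length) : ztuple (L.map (rp z)) ∈ X ↔ ztuple L ∈ X := by
  constructor
  · intro hx
    obtain ⟨L', h1, h2, h3⟩ := (mem_ZPow _ _ _).1 (hX hx)
    have := ztuple_inj _ _ (by simp [h1]) h3
    have e := rp_list hUZ hL (Or.inl (this ▸ h2))
    rwa [e] at hx
  · intro hx
    obtain ⟨L', h1, h2, h3⟩ := (mem_ZPow _ _ _).1 (hX hx)
    have := ztuple_inj _ _ (by simp [h1]) h3
    have e := rp_list hUZ hL (Or.inr (this ▸ h2))
    rwa [e]

theorem rp_nest (hUZ : U ⊆ z) {X : ZFSet.{0}} {L : List ZFSet.{0}} (hL : ∀ v ∈ L, XJ z v)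
    (hX : X ⊆ ZPow U (L.length + 1)) (y : ZFSet.{0}) : nest (L.map (rp z)) y ∈ X ↔ nest L y ∈ X := by
  constructor
  · intro hx
    obtain ⟨L', b, h1, h2, _, h3⟩ := (mem_ZPow_succ _ _ _).1 (hX hx)
    have := (nest_inj _ _ _ _ (by simp [h1]) h3).1
    have e := rp_list hUZ hL (Or.inl (this ▸ h2))
    rwa [e] at hx
  · intro hx
    obtain ⟨L', b, h1, h2, _, h3⟩ := (mem_ZPow_succ _ _ _).1 (hX hx)
    have := (nest_inj _ _ _ _ (by simp [h1]) h3).1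
    have e := rp_list hUZ hL (Or.inr (this ▸ h2))
    rwa [e]

theorem sem_tm (h : Sem G z σ S U i) (hs : Str z U σ i) (L : List ZFSet.{0}) (hL : ∀ b ∈ L, b ∈ z) (t : Tm) :
    Tm.usesSig σ t → TmCode t ∈ G → XJ z (Tm.eval (fIs i) (fun j => L.getD j ∅) t) ∧
      ∀ y ∈ G, (nd 7 (TmCode t) (zlist L) ∅ y ∈ S ↔ y = rp z (Tm.eval (fIs i) (fun j => L.getD j ∅) t)) := by
  have hLG := sem_env h L hL
  induction t with
  | var j =>
    intro _ hG
    have h1 : L.getD j ∅ ∈ XX z := by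
      by_cases hj : j < L.length
      · rw [List.getD_eq_getElem _ _ hj]; exact z_XX (hL _ (List.getElem_mem hj))
      · rw [List.getD_eq_default _ _ (by omega)]; simp [XX]
    refine ⟨Or.inl h1, fun y hy => ?_⟩
    simp only [TmCode, Tm.eval] at *
    rw [g7v h.cx h.cs hG hLG hy, sem_var h L hL j y hy, rp_id h1]
  | param a => intro h; exact h.elim
  | func s n a ih =>
    intro hu hG
    simp only [Tm.usesSig] at hu
    obtain ⟨hsσ, hk, hua⟩ := hu
    obtain ⟨k, ar, nm, rfl, hk', m, rfl⟩ := hs.sym s hsσ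
    simp only [TmCode] at hG ⊢
    have hR := opair_right h.cx.tG hG
    have hRR := opair_right h.cx.tG hR
    rcases hk with ⟨hk1, hk2⟩ | ⟨hk1, rfl⟩
    · simp only [symKind, symArity, zfst_opair, zsnd_opair] at hk1 hk2
      subst hk1
      obtain rfl := natZ_inj hk2
      have har : arityOf (opair (natZ 1) (opair (natZ m) nm)) = m := arityOf_eq (by simp [symArity])
      have hf := hs.f _ hsσ (by simp [symKind])
      have hft := hs.ft _ hsσ (by simp [symKind])
      have hleaf := h.h1 _ hsσ (by simp [symKind, natZ_eq_iff])
      rw [har] at hf hft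
      have hlist : List.ofFn (fun i => TmCode (a i)) = (List.ofFn a).map TmCode := by
        rw [List.map_ofFn]; rfl
      have helist : List.ofFn (fun j => Tm.eval (fIs i) (fun j => L.getD j ∅) (a j))
          = (List.ofFn a).map (Tm.eval (fIs i) (fun j => L.getD j ∅)) := by
        rw [List.map_ofFn]; rfl
      rw [hlist] at hG hRR ⊢
      cases m with
      | zero =>
        obtain ⟨b, ⟨hb, hbi⟩, hbu⟩ := hft [] rfl (by simp)
        have hi : i (opair (natZ 1) (opair (natZ 0) nm)) = {b} := by
          ext w
          rw [ZFSet.mem_singleton]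
          constructor
          · intro hw; exact hbu w ⟨hf hw, hw⟩
          · rintro rfl; exact hbi
        have hev : Tm.eval (fIs i) (fun j => L.getD j ∅) (Tm.func (opair (natZ 1) (opair (natZ 0) nm)) 0 a) = {b} := by
          rw [Tm.eval, fIs, if_pos (by simp), hi]
        have hX : ({b} : ZFSet.{0}) ∈ XX z := by
          simp only [XX, ZFSet.mem_insert_iff, ZFSet.mem_union, mem_zimage]
          exact Or.inr (Or.inr ⟨b, hs.UZ hb, rfl⟩)
        rw [hev, rp_id hX]
        refine ⟨Or.inl hX, fun y hy => ?_⟩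
        simp only [List.ofFn_zero, List.map_nil, zlist_nil] at hG ⊢
        rw [g7z h.cx h.cs hG hLG hy]
        constructor
        · rintro ⟨b', hb', rfl, hl⟩
          rw [hleaf b' hb', hi, ZFSet.mem_singleton] at hl
          rw [hl]
        · rintro rfl
          have : b ∈ G := h.cx.zs (hs.UZ hb)
          exact ⟨b, this, rfl, by rw [hleaf b this, hi]; simp⟩
      | succ m =>
        have hne : zlist ((List.ofFn a).map TmCode) ≠ ∅ := by
          rw [List.ofFn_succ, List.map_cons, zlist_cons]; exact opair_ne_empty _ _
        have iht : ∀ t ∈ List.ofFn a, XJ z (Tm.eval (fIs i) (fun j => L.getD j ∅) t) ∧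
          ∀ y ∈ G, (nd 7 (TmCode t) (zlist L) ∅ y ∈ S ↔ y = rp z (Tm.eval (fIs i) (fun j => L.getD j ∅) t)) := by
          intro t ht
          obtain ⟨j, rfl⟩ := (List.mem_ofFn' _ _).1 ht
          refine ih j (hua j) ?_
          have key : ∀ (l : List Tm), zlist (l.map TmCode) ∈ G → ∀ t ∈ l, TmCode t ∈ G := by
            intro l
            induction l with
            | nil => simp
            | cons t l ihl =>
              intro hl t' ht'
              rw [List.map_cons, zlist_cons] at hl
              rcases List.mem_cons.1 ht' with rfl | ht'
              · exact opair_left h.cx.tG hl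
              · exact ihl (opair_right h.cx.tG hl) t' ht'
          exact key _ hRR _ ht
        set ts := List.ofFn a with hts
        set ev := Tm.eval (fIs i) (fun j => L.getD j ∅) with hevd
        have hlen : ts.length = m + 1 := by simp [hts]
        have hXJ : ∀ v ∈ ts.map ev, XJ z v := by
          intro v hv
          obtain ⟨t, ht, rfl⟩ := List.mem_map.1 hv
          exact (iht t ht).1
        have hval : ev (Tm.func (opair (natZ 1) (opair (natZ (m+1)) nm)) (m+1) a) =
          Classical.epsilon fun b => nest (ts.map ev) b ∈ i (opair (natZ 1) (opair (natZ (m+1)) nm)) := by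
          rw [hevd, Tm.eval, fIs, helist, if_neg (by simp [hts])]
          simp only [ztuple_snoc]
          rfl
        rw [hval]
        have h5 : ∀ w ∈ G, ∀ y ∈ G, (nd 5 (opair (natZ 2) (opair (opair (natZ 1) (opair (natZ (m+1)) nm)) (zlist (ts.map TmCode)))) (zlist L) w y ∉ S ↔
          w = nest (ts.map (fun t => rp z (ev t))) y ∧ w ∈ i (opair (natZ 1) (opair (natZ (m+1)) nm))) := by
          intro w hw y hy
          rw [g5 h.cx h.cs hG hLG hw hy, sem_NL h hLG (fun t => rp z (ev t)) ts hRR (fun t ht => (iht t ht).2) w y hw hy,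
            hleaf w hw]
          tauto
        have hmm : ts.map (fun t => rp z (ev t)) = (ts.map ev).map (rp z) := by simp
        have hnG : ∀ y ∈ z, nest (ts.map (fun t => rp z (ev t))) y ∈ G := by
          intro y hy
          refine h.cx.nests _ ?_ y (by simp [ZZ, z_XX hy])
          intro v hv
          obtain ⟨t, ht, rfl⟩ := List.mem_map.1 hv
          exact rp_ZZ (iht t ht).1
        have h5' : ∀ y ∈ z, ((∃ w ∈ G, nd 5 (opair (natZ 2) (opair (opair (natZ 1) (opair (natZ (m+1)) nm)) (zlist (ts.map TmCode)))) (zlist L) w y ∉ S) ↔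
          nest (ts.map ev) y ∈ i (opair (natZ 1) (opair (natZ (m+1)) nm))) := by
          intro y hy
          rw [← rp_nest hs.UZ hXJ (by rw [List.length_map, hlen]; exact hf) y, ← hmm]
          constructor
          · rintro ⟨w, hw, h'⟩
            rw [h5 w hw y (h.cx.zs hy)] at h'
            rw [← h'.1]; exact h'.2
          · intro h'
            exact ⟨_, hnG y hy, (h5 _ (hnG y hy) y (h.cx.zs hy)).2 ⟨rfl, h'⟩⟩
        have huniq : ∀ b b', nest (ts.map ev) b ∈ i (opair (natZ 1) (opair (natZ (m+1)) nm)) →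
            nest (ts.map ev) b' ∈ i (opair (natZ 1) (opair (natZ (m+1)) nm)) → b ∈ U ∧ b = b' := by
          intro b b' hb hb'
          obtain ⟨L1, c1, l1, l2, l3, l4⟩ := (mem_ZPow_succ _ _ _).1 (hf hb)
          obtain ⟨L2, c2, m1, m2, m3, m4⟩ := (mem_ZPow_succ _ _ _).1 (hf hb')
          obtain ⟨e1, rfl⟩ := nest_inj _ _ _ _ (by simp [hlen, l1]) l4
          obtain ⟨e2, rfl⟩ := nest_inj _ _ _ _ (by simp [hlen, m1]) m4
          have := hft (ts.map ev) (by simp [hlen]) (e1 ▸ l2)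
          refine ⟨l3, this.unique ⟨l3, ?_⟩ ⟨m3, ?_⟩⟩
          · rw [ztuple_snoc]; exact hb
          · rw [ztuple_snoc]; exact hb'
        by_cases hex : ∃ b, nest (ts.map ev) b ∈ i (opair (natZ 1) (opair (natZ (m+1)) nm))
        · have he := Classical.epsilon_spec hex
          set b := Classical.epsilon fun b => nest (ts.map ev) b ∈ i (opair (natZ 1) (opair (natZ (m+1)) nm)) with hb
          have hbU := (huniq b b he he).1
          have hbz := hs.UZ hbU
          rw [rp_id (z_XX hbz)]
          refine ⟨Or.inl (z_XX hbz), fun y hy => ?_⟩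
          rw [g7f h.cx h.cs hG hne hLG hy]
          constructor
          · rintro (⟨hyz, h'⟩ | ⟨_, h'⟩)
            · exact ((huniq b y he ((h5' y hyz).1 h')).2).symm
            · rw [g6 h.cx h.cs hG hLG] at h'
              obtain ⟨w, hw, hw'⟩ := (h5' b hbz).2 he
              exact absurd ⟨w, hw, b, hbz, hw'⟩ h'
          · rintro rfl
            exact Or.inl ⟨hbz, (h5' _ hbz).2 he⟩
        · have hJ : (Classical.epsilon fun b => nest (ts.map ev) b ∈ i (opair (natZ 1) (opair (natZ (m+1)) nm))) = J0 := by
            unfold J0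
            congr 1
            funext b
            exact eq_false (fun hb => hex ⟨b, hb⟩)
          rw [hJ, rp_J0]
          refine ⟨Or.inr rfl, fun y hy => ?_⟩
          rw [g7f h.cx h.cs hG hne hLG hy]
          constructor
          · rintro (⟨hyz, h'⟩ | ⟨h', _⟩)
            · exact absurd ⟨y, (h5' y hyz).1 h'⟩ hex
            · exact h'
          · rintro rfl
            refine Or.inr ⟨rfl, ?_⟩
            rw [g6 h.cx h.cs hG hLG]
            rintro ⟨w, hw, y, hyz, h'⟩
            exact hex ⟨y, (h5' y hyz).1 ⟨w, hw, h'⟩⟩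
    · simp only [symKind, zfst_opair] at hk1
      subst hk1
      have hc := hs.c _ hsσ (by simp [symKind])
      have hev : Tm.eval (fIs i) (fun j => L.getD j ∅) (Tm.func (opair (natZ 2) (opair (natZ m) nm)) 0 a) = i (opair (natZ 2) (opair (natZ m) nm)) := by
        rw [Tm.eval, fIs, if_pos (by simp)]
      rw [hev, rp_id (z_XX (hs.UZ hc))]
      refine ⟨Or.inl (z_XX (hs.UZ hc)), fun y hy => ?_⟩
      rw [g7c h.cx h.cs hG hLG hy, h.h2 _ hsσ (by simp [symKind]) y hy]

theorem code_list (hG : G.IsTransitive) (l : List Tm) (hl : zlist (l.map TmCode) ∈ G) : ∀ t ∈ l, TmCode t ∈ G := by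
  induction l with
  | nil => simp
  | cons t l ihl =>
    intro t' ht'
    rw [List.map_cons, zlist_cons] at hl
    rcases List.mem_cons.1 ht' with rfl | ht'
    · exact opair_left hG hl
    · exact ihl (opair_right hG hl) t' ht'

theorem vcons_getD (b : ZFSet.{0}) (L : List ZFSet.{0}) :
    vcons b (fun j => L.getD j ∅) = fun j => (b :: L).getD j ∅ := by
  funext j
  cases j <;> simp [vcons]

theorem sem_fm (h : Sem G z σ S U i) (hs : Str z U σ i) (f : Fm) :
    ∀ (L : List ZFSet.{0}) (_ : ∀ b ∈ L, b ∈ z), Fm.usesSig σ f → FmCode f ∈ G →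
    (nd 12 (FmCode f) (zlist L) ∅ ∅ ∈ S ↔ Sat (· ∈ U) (rIs i) (fIs i) f (fun j => L.getD j ∅)) := by
  induction f with
  | rel s n a =>
    intro L hL hu hG
    have hLG := sem_env h L hL
    simp only [Fm.usesSig] at hu
    obtain ⟨hsσ, hk, har, hua⟩ := hu
    have harn := arityOf_eq har
    have hr := hs.r _ hsσ hk
    have hleaf := h.h1 _ hsσ (by rw [hk]; simp [natZ_eq_iff])
    rw [harn] at hr
    simp only [FmCode, Sat] at hG ⊢
    have hlist : List.ofFn (fun i => TmCode (a i)) = (List.ofFn a).map TmCode := by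
      rw [List.map_ofFn]; rfl
    have helist : List.ofFn (fun j => Tm.eval (fIs i) (fun j => L.getD j ∅) (a j))
        = (List.ofFn a).map (Tm.eval (fIs i) (fun j => L.getD j ∅)) := by
      rw [List.map_ofFn]; rfl
    rw [hlist] at hG ⊢
    rw [helist]
    have hR := opair_right h.cx.tG hG
    have hRR := opair_right h.cx.tG hR
    have iht : ∀ t ∈ List.ofFn a, XJ z (Tm.eval (fIs i) (fun j => L.getD j ∅) t) ∧
        ∀ y ∈ G, (nd 7 (TmCode t) (zlist L) ∅ y ∈ S ↔ y = rp z (Tm.eval (fIs i) (fun j => L.getD j ∅) t)) := by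
      intro t ht
      have := code_list h.cx.tG _ hRR t ht
      obtain ⟨j, rfl⟩ := (List.mem_ofFn' _ _).1 ht
      exact sem_tm h hs L hL _ (hua j) this
    set ts := List.ofFn a with hts
    set ev := Tm.eval (fIs i) (fun j => L.getD j ∅) with hevd
    have hlen : ts.length = n := by simp [hts]
    have hXJ : ∀ v ∈ ts.map ev, XJ z v := by
      intro v hv
      obtain ⟨t, ht, rfl⟩ := List.mem_map.1 hv
      exact (iht t ht).1
    have hmm : ts.map (fun t => rp z (ev t)) = (ts.map ev).map (rp z) := by simp
    have htG : ztuple (ts.map (fun t => rp z (ev t))) ∈ G := by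
      have hz : ∀ v ∈ ts.map (fun t => rp z (ev t)), v ∈ ZZ z (Jz z) := by
        intro v hv
        obtain ⟨t, ht, rfl⟩ := List.mem_map.1 hv
        exact rp_ZZ (iht t ht).1
      generalize ts.map (fun t => rp z (ev t)) = K at hz
      cases hn : K.length with
      | zero => rw [List.length_eq_zero_iff.1 hn]; exact h.cx.em
      | succ m =>
        obtain ⟨K', y, rfl, _⟩ := list_snoc K m hn
        rw [ztuple_snoc]
        exact h.cx.nests K' (fun a ha => hz a (by simp [ha])) y (hz y (by simp))
    rw [g12r h.cx h.cs hG hLG, rIs, ← rp_tuple hs.UZ hXJ (by rw [List.length_map, hlen]; exact hr), ← hmm]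
    have h10 : ∀ w ∈ G, (nd 10 (opair (natZ 0) (opair s (zlist (ts.map TmCode)))) (zlist L) w ∅ ∉ S ↔
        w = ztuple (ts.map (fun t => rp z (ev t))) ∧ w ∈ i s) := by
      intro w hw
      rw [g10 h.cx h.cs hG hLG hw, sem_NT h hLG (fun t => rp z (ev t)) ts hRR (fun t ht => (iht t ht).2) w hw, hleaf w hw]
      tauto
    constructor
    · rintro ⟨w, hw, h'⟩
      rw [h10 w hw] at h'
      rw [← h'.1]; exact h'.2
    · intro h'
      exact ⟨_, htG, (h10 _ htG).2 ⟨rfl, h'⟩⟩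
  | eq t u =>
    intro L hL hu hG
    have hLG := sem_env h L hL
    simp only [FmCode, Sat, Fm.usesSig] at hu hG ⊢
    have hR := opair_right h.cx.tG hG
    obtain ⟨t1, t2⟩ := sem_tm h hs L hL t hu.1 (opair_left h.cx.tG hR)
    obtain ⟨u1, u2⟩ := sem_tm h hs L hL u hu.2 (opair_right h.cx.tG hR)
    rw [g12e h.cx h.cs hG hLG]
    constructor
    · rintro ⟨y, hy, h'⟩
      rw [g11 h.cx h.cs hG hLG hy, t2 y hy, u2 y hy] at h'
      push Not at h'
      exact rp_inj t1 u1 (h'.1 ▸ h'.2)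
    · intro h'
      have hy : rp z (Tm.eval (fIs i) (fun j => L.getD j ∅) t) ∈ G := h.cx.zz (rp_ZZ t1)
      refine ⟨_, hy, ?_⟩
      rw [g11 h.cx h.cs hG hLG hy, t2 _ hy, u2 _ hy, ← h']
      simp
  | not f ih =>
    intro L hL hu hG
    simp only [FmCode, Sat, Fm.usesSig] at hu hG ⊢
    rw [g12n h.cx h.cs hG (sem_env h L hL), ih L hL hu (opair_right h.cx.tG hG)]
  | imp f g ihf ihg =>
    intro L hL hu hG
    simp only [FmCode, Sat, Fm.usesSig] at hu hG ⊢
    have hR := opair_right h.cx.tG hG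
    rw [g12i h.cx h.cs hG (sem_env h L hL), ihf L hL hu.1 (opair_left h.cx.tG hR), ihg L hL hu.2 (opair_right h.cx.tG hR)]
    tauto
  | all f ih =>
    intro L hL hu hG
    simp only [FmCode, Sat, Fm.usesSig] at hu hG ⊢
    have hR := opair_right h.cx.tG hG
    rw [g12a h.cx h.cs hG (sem_env h L hL), g15 h.cx h.cs hR (sem_env h L hL)]
    have hx : ∀ b ∈ z, opair b (zlist L) ∈ G ∧ (nd 14 (FmCode f) (opair b (zlist L)) ∅ b ∈ S ↔
        (b ∈ U → Sat (· ∈ U) (rIs i) (fIs i) f (vcons b (fun j => L.getD j ∅)))) := by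
      intro b hb
      have hbL : ∀ a ∈ b :: L, a ∈ z := by
        intro a ha
        rcases List.mem_cons.1 ha with rfl | ha
        · exact hb
        · exact hL a ha
      have hE := sem_env h (b :: L) hbL
      refine ⟨hE, ?_⟩
      have := ih (b :: L) hbL hu hR
      rw [zlist_cons] at this hE
      rw [g14 h.cx h.cs hR hE (h.cx.zs hb), this, h.hU b hb, vcons_getD]
      tauto
    constructor
    · intro h' b hb
      by_contra hc
      exact h' ⟨b, hs.UZ hb, (hx b (hs.UZ hb)).1, fun hh => hc (((hx b (hs.UZ hb)).2.1 hh) hb)⟩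
    · rintro h' ⟨b, hb, _, hn⟩
      exact hn ((hx b hb).2.2 (h' b))
  | ex f ih =>
    intro L hL hu hG
    simp only [FmCode, Sat, Fm.usesSig] at hu hG ⊢
    have hR := opair_right h.cx.tG hG
    rw [g12x h.cx h.cs hG (sem_env h L hL)]
    have hx : ∀ b ∈ z, opair b (zlist L) ∈ G ∧ (nd 13 (FmCode f) (opair b (zlist L)) ∅ b ∉ S ↔
        (b ∈ U ∧ Sat (· ∈ U) (rIs i) (fIs i) f (vcons b (fun j => L.getD j ∅)))) := by
      intro b hb
      have hbL : ∀ a ∈ b :: L, a ∈ z := by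
        intro a ha
        rcases List.mem_cons.1 ha with rfl | ha
        · exact hb
        · exact hL a ha
      have hE := sem_env h (b :: L) hbL
      refine ⟨hE, ?_⟩
      have := ih (b :: L) hbL hu hR
      rw [zlist_cons] at this hE
      rw [g13 h.cx h.cs hR hE (h.cx.zs hb), this, h.hU b hb, vcons_getD]
      tauto
    constructor
    · rintro ⟨b, hb, _, hn⟩
      exact ⟨b, (hx b hb).2.1 hn⟩
    · rintro ⟨b, hb, h'⟩
      exact ⟨b, hs.UZ hb, (hx b (hs.UZ hb)).1, (hx b (hs.UZ hb)).2.2 ⟨hb, h'⟩⟩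

end
end SmallExt

namespace SmallExt

/-! ### Part 9: constraints -/

section
attribute [local instance] Classical.propDecidable

/-- `K` is definable by clauses from `Q` -/
def CD (D Q : ZFSet.{0}) (K : ZFSet.{0} → Prop) : Prop :=
  ∀ S ⊆ D, (∀ A ∈ Q, ∀ B ∈ Q, (∀ S' ⊆ D, K S' → cl D S' A B) → cl D S A B) → K S

section
variable {D Q : ZFSet.{0}} {K K' : ZFSet.{0} → Prop}

theorem CD.and (h : CD D Q K) (h' : CD D Q K') : CD D Q (fun S => K S ∧ K' S) := fun S hS H =>
  ⟨h S hS fun A hA B hB hc => H A hA B hB fun S' hS' hK => hc S' hS' hK.1,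
   h' S hS fun A hA B hB hc => H A hA B hB fun S' hS' hK => hc S' hS' hK.2⟩

theorem CD.all {ι : Sort*} {K : ι → ZFSet.{0} → Prop} (h : ∀ i, CD D Q (K i)) : CD D Q (fun S => ∀ i, K i S) :=
  fun S hS H i => h i S hS fun A hA B hB hc => H A hA B hB fun S' hS' hK => hc S' hS' (hK i)

theorem CD.congr (h : CD D Q K) (e : ∀ S ⊆ D, (K' S ↔ K S)) : CD D Q K' := fun S hS H =>
  (e S hS).2 (h S hS fun A hA B hB hc => H A hA B hB fun S' hS' hK => hc S' hS' ((e S' hS').1 hK))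

theorem CD.base {A B} (hA : A ∈ Q) (hB : B ∈ Q) : CD D Q (fun S => cl D S A B) := fun _ _ H =>
  H A hA B hB fun _ _ h => h

end

section
variable {V : ZFSet.{0}} [hV : Fact (IsTransModel V)] {D : ZFSet.{0}}

theorem cl_iff {S A B : ZFSet.{0}} (hA : A ⊆ D) (hB : B ⊆ D) :
    cl D S A B ↔ (∃ m ∈ A, m ∈ S) ∨ (∃ m ∈ B, m ∉ S) := by
  unfold cl
  constructor
  · rintro ⟨y, _, ⟨h, h'⟩ | ⟨h, h'⟩⟩
    · exact Or.inl ⟨y, h', h⟩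
    · exact Or.inr ⟨y, h', h⟩
  · rintro (⟨y, h, h'⟩ | ⟨y, h, h'⟩)
    · exact ⟨y, hA h, Or.inl ⟨h', h⟩⟩
    · exact ⟨y, hB h, Or.inr ⟨h', h⟩⟩

theorem CD.gen {A B : ZFSet.{0}} (hA : A ⊆ D) (hB : B ⊆ D) (hA' : A ∈ V) (hB' : B ∈ V) :
    CD D (pw V D) (fun S => (∃ m ∈ A, m ∈ S) ∨ (∃ m ∈ B, m ∉ S)) :=
  (CD.base (mem_pw.2 ⟨hA', hA⟩) (mem_pw.2 ⟨hB', hB⟩)).congr fun _ _ => (cl_iff hA hB).symm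

theorem sing_sub {u : ZFSet.{0}} (h : u ∈ D) : ({u} : ZFSet.{0}) ⊆ D := by
  intro w hw; rw [ZFSet.mem_singleton] at hw; rw [hw]; exact h
theorem pair_sub {u u' : ZFSet.{0}} (h : u ∈ D) (h' : u' ∈ D) : ({u, u'} : ZFSet.{0}) ⊆ D := by
  intro w hw; rw [ZFSet.mem_pair] at hw; rcases hw with rfl | rfl <;> assumption
theorem emp_sub : (∅ : ZFSet.{0}) ⊆ D := ZFSet.empty_subset _

theorem CD.pos (hD : D ∈ V) {u : ZFSet.{0}} (h : u ∈ D) : CD D (pw V D) (fun S => u ∈ S) :=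
  (CD.gen (sing_sub h) emp_sub (W_singleton (W_trans hD h)) W_empty).congr fun _ _ => by simp
theorem CD.neg (hD : D ∈ V) {u : ZFSet.{0}} (h : u ∈ D) : CD D (pw V D) (fun S => u ∉ S) :=
  (CD.gen emp_sub (sing_sub h) W_empty (W_singleton (W_trans hD h))).congr fun _ _ => by simp
theorem CD.pp (hD : D ∈ V) {u u' : ZFSet.{0}} (h : u ∈ D) (h' : u' ∈ D) :
    CD D (pw V D) (fun S => u ∈ S → u' ∈ S) :=
  (CD.gen (sing_sub h') (sing_sub h) (W_singleton (W_trans hD h')) (W_singleton (W_trans hD h))).congr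
    fun _ _ => by simp; tauto
theorem CD.pn (hD : D ∈ V) {u u' : ZFSet.{0}} (h : u ∈ D) (h' : u' ∈ D) :
    CD D (pw V D) (fun S => u ∈ S → u' ∉ S) :=
  (CD.gen emp_sub (pair_sub h h') W_empty (W_pair (W_trans hD h) (W_trans hD h'))).congr
    fun _ _ => by simp; tauto
theorem CD.np (hD : D ∈ V) {u u' : ZFSet.{0}} (h : u ∈ D) (h' : u' ∈ D) :
    CD D (pw V D) (fun S => u ∉ S → u' ∈ S) :=
  (CD.gen (pair_sub h h') emp_sub (W_pair (W_trans hD h) (W_trans hD h')) W_empty).congr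
    fun _ _ => by simp; tauto
theorem CD.ppp (hD : D ∈ V) {u u' u'' : ZFSet.{0}} (h : u ∈ D) (h' : u' ∈ D) (h'' : u'' ∈ D) :
    CD D (pw V D) (fun S => u ∈ S → u' ∈ S ∨ u'' ∈ S) :=
  (CD.gen (pair_sub h' h'') (sing_sub h) (W_pair (W_trans hD h') (W_trans hD h'')) (W_singleton (W_trans hD h))).congr
    fun _ _ => by simp; tauto

theorem CD.cons {Lf Ep En : ZFSet.{0}} (hD : D ∈ V) (hP : Ep ∈ V) (hN : En ∈ V)  :
    CD D (pw V D) (fun S => Cons D Lf Ep En S) := by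
  have : Fact (D ∈ V) := ⟨hD⟩
  have : Fact (Ep ∈ V) := ⟨hP⟩
  have : Fact (En ∈ V) := ⟨hN⟩
  refine CD.all fun u => CD.all fun hu => CD.all fun hl => ?_
  have : Fact (u ∈ V) := ⟨W_trans hD hu⟩
  have h1 : CD D (pw V D) (fun S => ∀ m, ∀ _ : m ∈ D, ∀ _ : opair u m ∈ Ep, (m ∈ S → u ∈ S)) :=
    CD.all fun m => CD.all fun hm => CD.all fun _ => CD.pp hD hm hu
  have h2 : CD D (pw V D) (fun S => ∀ m, ∀ _ : m ∈ D, ∀ _ : opair u m ∈ En, (m ∉ S → u ∈ S)) :=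
    CD.all fun m => CD.all fun hm => CD.all fun _ => CD.np hD hm hu
  have hA : ZFSet.sep (fun m => opair u m ∈ Ep) D ∈ V := W_sep inferInstance hD
  have hB : ZFSet.sep (fun m => m = u ∨ opair u m ∈ En) D ∈ V := W_sep inferInstance hD
  have h3 := CD.gen (V := V) (D := D) (fun m hm => (ZFSet.mem_sep.1 hm).1) (fun m hm => (ZFSet.mem_sep.1 hm).1) hA hB
  refine ((h1.and h2).and h3).congr fun S _ => ?_
  simp only [ZFSet.mem_sep]
  unfold Gate
  constructor
  · intro h
    refine ⟨⟨fun m hm he hs => h.2 (Or.inl ⟨m, hm, he, hs⟩), fun m hm he hs => h.2 (Or.inr ⟨m, hm, he, hs⟩)⟩, ?_⟩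
    by_cases hs : u ∈ S
    · rcases h.1 hs with ⟨m, hm, he, hs⟩ | ⟨m, hm, he, hs⟩
      · exact Or.inl ⟨m, ⟨hm, he⟩, hs⟩
      · exact Or.inr ⟨m, ⟨hm, Or.inr he⟩, hs⟩
    · exact Or.inr ⟨u, ⟨hu, Or.inl rfl⟩, hs⟩
  · rintro ⟨⟨h1, h2⟩, h3⟩
    constructor
    · intro hs
      rcases h3 with ⟨m, ⟨hm, he⟩, hs'⟩ | ⟨m, ⟨hm, rfl | he⟩, hs'⟩
      · exact Or.inl ⟨m, hm, he, hs'⟩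
      · exact absurd hs hs'
      · exact Or.inr ⟨m, hm, he, hs'⟩
    · rintro (⟨m, hm, he, hs⟩ | ⟨m, hm, he, hs⟩)
      · exact h1 m hm he hs
      · exact h2 m hm he hs
end

/-- type of tuples for a symbol -/
def TS (G s n : ZFSet.{0}) : Prop :=
  ∃ nm ∈ G, s = opair (natZ 0) (opair (insert n n) nm) ∨ s = opair (natZ 1) (opair n nm) ∨
    (n = ∅ ∧ s = opair (natZ 2) nm)
def TF (G s n : ZFSet.{0}) : Prop :=
  ∃ nm ∈ G, s = opair (natZ 1) (opair n nm) ∨ (n = ∅ ∧ s = opair (natZ 2) nm)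
def TZ (G s : ZFSet.{0}) : Prop := ∃ nm ∈ G, s = opair (natZ 0) (opair ∅ nm)
def TC (G s : ZFSet.{0}) : Prop := ∃ p ∈ G, s = opair (natZ 2) p

def Al (G E th s w : ZFSet.{0}) : Prop :=
  (∃ y ∈ G, ∃ i ∈ G, opair s (opair y i) ∈ th ∧ w ∈ y) ∧
    ((∃ n ∈ G, ∃ l ∈ G, ∃ b ∈ G, TS G s n ∧ ent n l b w ∈ E) ∨ (TZ G s ∧ w = ∅))

def KT (T S : ZFSet.{0}) : Prop := ∀ c ∈ T, nd 12 c ∅ ∅ ∅ ∈ S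
def K3 (G σ E S : ZFSet.{0}) : Prop := ∀ s ∈ σ, ∀ n ∈ G, TS G s n → ∀ l ∈ G, ∀ b ∈ G, ∀ w ∈ G, ent n l b w ∈ E →
  (nd 1 ∅ s w ∅ ∈ S → nd 0 ∅ ∅ ∅ b ∈ S) ∧ (nd 1 ∅ s w ∅ ∈ S → nd 3 l ∅ ∅ ∅ ∉ S)
def K4 (G σ E th S : ZFSet.{0}) : Prop := ∀ s ∈ σ, ∀ w ∈ G, ¬ Al G E th s w → nd 1 ∅ s w ∅ ∉ S
def K5 (G σ E th S : ZFSet.{0}) : Prop := ∀ s ∈ σ, ¬ TC G s → ∀ n ∈ G, TS G s n → ∀ l ∈ G, ∀ b ∈ G, ∀ w ∈ G,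
  ent n l b w ∈ E → ∀ y ∈ G, opair s (opair y (natZ 1)) ∈ th → w ∈ y →
    (nd 0 ∅ ∅ ∅ b ∈ S → nd 3 l ∅ ∅ ∅ ∈ S ∨ nd 1 ∅ s w ∅ ∈ S)
def K6 (G σ th S : ZFSet.{0}) : Prop := ∀ s ∈ σ, TZ G s → ∀ y ∈ G, opair s (opair y (natZ 1)) ∈ th → ∅ ∈ y →
  nd 1 ∅ s ∅ ∅ ∈ S
def Lst (G z E n l : ZFSet.{0}) : Prop := (n = ∅ ∧ l = ∅) ∨ ∃ b ∈ z, ∃ w ∈ G, ent n l b w ∈ E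
def K7 (G z σ E S : ZFSet.{0}) : Prop := ∀ s ∈ σ, ∀ n ∈ G, TF G s n → ∀ l ∈ G, Lst G z E n l →
  nd 3 l ∅ ∅ ∅ ∈ S ∨ ∃ b ∈ z, ∃ w ∈ G, ent n l b w ∈ E ∧ nd 1 ∅ s w ∅ ∈ S
def K8 (G z σ E S : ZFSet.{0}) : Prop := ∀ s ∈ σ, ∀ n ∈ G, TF G s n → ∀ l ∈ G, ∀ b ∈ z, ∀ w ∈ G, ∀ b' ∈ z, ∀ w' ∈ G,
  ent n l b w ∈ E → ent n l b' w' ∈ E → b ≠ b' → (nd 1 ∅ s w ∅ ∈ S → nd 1 ∅ s w' ∅ ∉ S)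
def K9 (z ud th S : ZFSet.{0}) : Prop := opair ud (opair z (natZ 1)) ∈ th → ∀ b ∈ z, nd 0 ∅ ∅ ∅ b ∈ S

def KK (G z J σ E T ud th D Lf Ep En S : ZFSet.{0}) : Prop :=
  Cons D Lf Ep En S ∧ KT T S ∧ K3 G σ E S ∧ K4 G σ E th S ∧ K5 G σ E th S ∧ K6 G σ th S ∧
  K7 G z σ E S ∧ K8 G z σ E S ∧ K9 z ud th S

def Cd (G s v S : ZFSet.{0}) : Prop :=
  (TC G s → v ∈ G ∧ nd 1 ∅ s v ∅ ∈ S) ∧ (¬ TC G s → v ⊆ G ∧ ∀ w ∈ G, (w ∈ v ↔ nd 1 ∅ s w ∅ ∈ S))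

def Dec (G z σ M S : ZFSet.{0}) : Prop :=
  ∃ q ∈ M, ∃ U ∈ q, ∃ I ∈ q, M = opair U I ∧ (U ⊆ z ∧ ∀ b ∈ z, (b ∈ U ↔ nd 0 ∅ ∅ ∅ b ∈ S)) ∧
    (∀ p ∈ I, ∃ s ∈ σ, ∃ q' ∈ p, ∃ v ∈ q', p = opair s v ∧ Cd G s v S) ∧
    (∀ s ∈ σ, ∃ p ∈ I, ∃ q' ∈ p, ∃ v ∈ q', p = opair s v ∧ Cd G s v S)

section
variable {V : ZFSet.{0}} [hV : Fact (IsTransModel V)]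
variable {G z J σ E T ud th D Lf Ep En : ZFSet.{0}} [Fact (G ∈ V)] [Fact (z ∈ V)] [Fact (J ∈ V)] [Fact (σ ∈ V)]
  [Fact (E ∈ V)] [Fact (T ∈ V)] [Fact (ud ∈ V)] [Fact (th ∈ V)] [Fact (D ∈ V)] [Fact (Lf ∈ V)] [Fact (Ep ∈ V)]
  [Fact (En ∈ V)]
set_option synthInstance.maxHeartbeats 400000
set_option synthInstance.maxSize 100000

instance DD.TS (i j : ℕ) : DD V (fun v => TS G (v i) (v j)) := by unfold SmallExt.TS; infer_instance
instance DD.TF (i j : ℕ) : DD V (fun v => TF G (v i) (v j)) := by unfold SmallExt.TF; infer_instance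
instance DD.TZ (i : ℕ) : DD V (fun v => TZ G (v i)) := by unfold SmallExt.TZ; infer_instance
instance DD.TC (i : ℕ) : DD V (fun v => TC G (v i)) := by unfold SmallExt.TC; infer_instance
instance DD.Al (i j : ℕ) : DD V (fun v => Al G E th (v i) (v j)) := by unfold SmallExt.Al; infer_instance
instance DD.KT (i : ℕ) : DD V (fun v => KT T (v i)) := by unfold SmallExt.KT; infer_instance
instance DD.K3 (i : ℕ) : DD V (fun v => K3 G σ E (v i)) := by unfold SmallExt.K3; infer_instance
instance DD.K4 (i : ℕ) : DD V (fun v => K4 G σ E th (v i)) := by unfold SmallExt.K4; infer_instance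
instance DD.K5 (i : ℕ) : DD V (fun v => K5 G σ E th (v i)) := by unfold SmallExt.K5; infer_instance
instance DD.K6 (i : ℕ) : DD V (fun v => K6 G σ th (v i)) := by unfold SmallExt.K6; infer_instance
instance DD.Lst (i j : ℕ) : DD V (fun v => Lst G z E (v i) (v j)) := by unfold SmallExt.Lst; infer_instance
instance DD.K7 (i : ℕ) : DD V (fun v => K7 G z σ E (v i)) := by unfold SmallExt.K7; infer_instance
instance DD.K8 (i : ℕ) : DD V (fun v => K8 G z σ E (v i)) := by unfold SmallExt.K8; infer_instance
instance DD.K9 (i : ℕ) : DD V (fun v => K9 z ud th (v i)) := by unfold SmallExt.K9; infer_instance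
instance DD.Cons (i : ℕ) : DD V (fun v => Cons D Lf Ep En (v i)) := by
  unfold SmallExt.Cons SmallExt.Gate; infer_instance
instance DD.KK (i : ℕ) : DD V (fun v => KK G z J σ E T ud th D Lf Ep En (v i)) := by
  unfold SmallExt.KK; infer_instance
instance DD.Cd (i j k : ℕ) : DD V (fun v => Cd G (v i) (v j) (v k)) := by unfold SmallExt.Cd; infer_instance
instance DD.Dec (i j : ℕ) : DD V (fun v => Dec G z σ (v i) (v j)) := by unfold SmallExt.Dec; infer_instance
end

section
variable {V : ZFSet.{0}} [hV : Fact (IsTransModel V)] {G z J σ E T ud th Lf Ep En : ZFSet.{0}}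

theorem KK_CD (hG : G ∈ V) (hE : E ∈ V) (hz : z ∈ V) (hP : Ep ∈ V) (hN : En ∈ V)
    (e : ∅ ∈ G) (sG : σ ⊆ G) (tG : T ⊆ G) (zG : z ⊆ G) :
    CD (DDn G) (pw V (DDn G)) (KK G z J σ E T ud th (DDn G) Lf Ep En) := by
  have hD := V_DDn hG
  have d1 : ∀ {s w}, s ∈ σ → w ∈ G → nd 1 ∅ s w ∅ ∈ DDn G := fun hs hw => (mem_DDn (by omega)).2 ⟨e, sG hs, hw, e⟩
  have d0 : ∀ {b}, b ∈ G → nd 0 ∅ ∅ ∅ b ∈ DDn G := fun hw => (mem_DDn (by omega)).2 ⟨e, e, e, hw⟩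
  have d3 : ∀ {b}, b ∈ G → nd 3 b ∅ ∅ ∅ ∈ DDn G := fun hw => (mem_DDn (by omega)).2 ⟨hw, e, e, e⟩
  have d12 : ∀ {b}, b ∈ G → nd 12 b ∅ ∅ ∅ ∈ DDn G := fun hw => (mem_DDn (by omega)).2 ⟨hw, e, e, e⟩
  refine (CD.cons hD hP hN).and (CD.and ?_ (CD.and ?_ (CD.and ?_ (CD.and ?_ (CD.and ?_ (CD.and ?_ (CD.and ?_ ?_)))))))
  · exact CD.all fun c => CD.all fun hc => CD.pos hD (d12 (tG hc))
  · exact CD.all fun s => CD.all fun hs => CD.all fun n => CD.all fun _ => CD.all fun _ => CD.all fun l => CD.all fun hl =>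
      CD.all fun b => CD.all fun hb => CD.all fun w => CD.all fun hw => CD.all fun _ =>
      (CD.pp hD (d1 hs hw) (d0 hb)).and (CD.pn hD (d1 hs hw) (d3 hl))
  · exact CD.all fun s => CD.all fun hs => CD.all fun w => CD.all fun hw => CD.all fun _ => CD.neg hD (d1 hs hw)
  · exact CD.all fun s => CD.all fun hs => CD.all fun _ => CD.all fun n => CD.all fun _ => CD.all fun _ => CD.all fun l => CD.all fun hl =>
      CD.all fun b => CD.all fun hb => CD.all fun w => CD.all fun hw => CD.all fun _ => CD.all fun _ => CD.all fun _ =>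
      CD.all fun _ => CD.all fun _ => CD.ppp hD (d0 hb) (d3 hl) (d1 hs hw)
  · exact CD.all fun s => CD.all fun hs => CD.all fun _ => CD.all fun y => CD.all fun _ => CD.all fun _ => CD.all fun _ =>
      CD.pos hD (d1 hs e)
  · refine CD.all fun s => CD.all fun hs => CD.all fun n => CD.all fun hn => CD.all fun _ => CD.all fun l => CD.all fun hl => CD.all fun _ => ?_
    have : Fact (G ∈ V) := ⟨hG⟩
    have : Fact (z ∈ V) := ⟨hz⟩
    have : Fact (E ∈ V) := ⟨hE⟩
    have : Fact (s ∈ V) := ⟨W_trans hG (sG hs)⟩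
    have : Fact (n ∈ V) := ⟨W_trans hG hn⟩
    have : Fact (l ∈ V) := ⟨W_trans hG hl⟩
    have hA : ZFSet.sep (fun m => m = nd 3 l ∅ ∅ ∅ ∨ ∃ b ∈ z, ∃ w ∈ G, ent n l b w ∈ E ∧ m = nd 1 ∅ s w ∅) (DDn G) ∈ V :=
      W_sep inferInstance hD
    refine (CD.gen (V := V) (D := DDn G) (fun m hm => (ZFSet.mem_sep.1 hm).1) emp_sub hA W_empty).congr fun S _ => ?_
    simp only [ZFSet.mem_sep, ZFSet.notMem_empty, false_and, exists_false, or_false]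
    constructor
    · rintro (h | ⟨b, hb, w, hw, he, h⟩)
      · exact ⟨_, ⟨d3 hl, Or.inl rfl⟩, h⟩
      · exact ⟨_, ⟨d1 hs hw, Or.inr ⟨b, hb, w, hw, he, rfl⟩⟩, h⟩
    · rintro ⟨_, ⟨_, rfl | ⟨b, hb, w, hw, he, rfl⟩⟩, h⟩
      · exact Or.inl h
      · exact Or.inr ⟨b, hb, w, hw, he, h⟩
  · exact CD.all fun s => CD.all fun hs => CD.all fun n => CD.all fun _ => CD.all fun _ => CD.all fun l => CD.all fun hl =>
      CD.all fun b => CD.all fun hb => CD.all fun w => CD.all fun hw => CD.all fun b' => CD.all fun hb' => CD.all fun w' => CD.all fun hw' =>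
      CD.all fun _ => CD.all fun _ => CD.all fun _ => CD.pn hD (d1 hs hw) (d1 hs hw')
  · exact CD.all fun _ => CD.all fun b => CD.all fun hb => CD.pos hD (d0 (zG hb))
end

end
end SmallExt

namespace SmallExt

/-! ### Part 10: models and solutions -/

section
attribute [local instance] Classical.propDecidable

structure Bx (G z σ T ud th E : ZFSet.{0}) : Prop where
  cx : Cx G z (Jz z) σ
  hE : ∀ n l b q, ent n l b q ∈ E ↔
    ∃ L : List ZFSet.{0}, (∀ a ∈ L, a ∈ z) ∧ n = natZ L.length ∧ l = zlist L ∧ b ∈ z ∧ q = nest L b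
  sym : ∀ s ∈ σ, IsSymbol s
  TG : T ⊆ G
  thG : ∀ s y i, opair s (opair y i) ∈ th → y ∈ G ∧ i ∈ G
  thf : IsZFunc th (insert ud σ)
  thv : ∀ s ∈ insert ud σ, ∃ y i, iapp th s = opair y i ∧ (i = natZ 0 ∨ i = natZ 1)
  zdef : z = zfst (iapp th ud)
  Tf : ∀ c ∈ T, ∃ f : Fm, FmCode f = c ∧ Fm.usesSig σ f

structure MT (σ T ud th U : ZFSet.{0}) (i : ZFSet.{0} → ZFSet.{0}) : Prop where
  u : ∀ y j, iapp th ud = opair y j → (j = natZ 0 → U ⊆ y) ∧ (j = natZ 1 → U = y)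
  s : ∀ s ∈ σ, ∀ y j, iapp th s = opair y j →
    (symKind s = natZ 0 →
      (j = natZ 0 → i s ⊆ y ∩ ZPow U (arityOf s)) ∧
      (j = natZ 1 → i s = y ∩ ZPow U (arityOf s))) ∧
    (symKind s = natZ 1 →
      (∀ args : List ZFSet, args.length = arityOf s → (∀ a ∈ args, a ∈ U) →
        ∃! b, b ∈ U ∧ ztuple (args ++ [b]) ∈ i s) ∧
      (j = natZ 0 → i s ⊆ y ∩ ZPow U (arityOf s + 1)) ∧
      (j = natZ 1 → i s = y ∩ ZPow U (arityOf s + 1))) ∧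
    (symKind s = natZ 2 → i s ∈ y ∧ i s ∈ U)
  t : ∀ c ∈ T, ∀ f : Fm, FmCode f = c → Sat (· ∈ U) (rIs i) (fIs i) f (fun _ => ∅)

abbrev KX (G z σ T ud th E S : ZFSet.{0}) : Prop :=
  KK G z (Jz z) σ E T ud th (DDn G) (LF G z σ) (EP G) (EN G z (Jz z)) S

inductive SK (G s : ZFSet.{0}) : Prop
  | Z : TZ G s → symKind s = natZ 0 → arityOf s = 0 → ¬ TC G s → (∀ n, ¬ TS G s n) → (∀ n, ¬ TF G s n) → SK G s
  | R (m : ℕ) : symKind s = natZ 0 → arityOf s = m + 1 → ¬ TC G s → ¬ TZ G s → (∀ n, TS G s n ↔ n = natZ m) →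
      (∀ n, ¬ TF G s n) → SK G s
  | F (m : ℕ) : symKind s = natZ 1 → arityOf s = m → ¬ TC G s → ¬ TZ G s → (∀ n, TS G s n ↔ n = natZ m) →
      (∀ n, TF G s n ↔ n = natZ m) → SK G s
  | C : symKind s = natZ 2 → TC G s → ¬ TZ G s → (∀ n, TS G s n ↔ n = ∅) → (∀ n, TF G s n ↔ n = ∅) → SK G s

variable {G z σ T ud th E S U : ZFSet.{0}} {i : ZFSet.{0} → ZFSet.{0}}

theorem sk (tG : G.IsTransitive) {s : ZFSet.{0}} (hs : IsSymbol s) (hG : s ∈ G) : SK G s := by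
  obtain ⟨k, a, nm, rfl, hk, n, rfl⟩ := hs
  have h1 := opair_right tG hG
  have h2 := opair_right tG h1
  have z0 : (∅ : ZFSet.{0}) = natZ 0 := rfl
  rcases hk with rfl | rfl | rfl
  · cases n with
    | zero =>
      refine SK.Z ⟨nm, h2, rfl⟩ (by simp [symKind]) (arityOf_eq (by simp [symArity])) ?_ ?_ ?_
      · rintro ⟨p, _, h⟩; simp [opair_inj, natZ_eq_iff] at h
      · rintro n ⟨p, _, h⟩; simp [opair_inj, natZ_eq_iff] at h
        exact succ_ne_empty n h.1.symm
      · rintro n ⟨p, _, h⟩; simp [opair_inj, natZ_eq_iff] at h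
    | succ m =>
      refine SK.R m (by simp [symKind]) (arityOf_eq (by simp [symArity])) ?_ ?_ ?_ ?_
      · rintro ⟨p, _, h⟩; simp [opair_inj, natZ_eq_iff] at h
      · rintro ⟨p, _, h⟩; rw [z0] at h; simp [opair_inj, natZ_eq_iff] at h
      · intro n
        constructor
        · rintro ⟨p, _, h⟩; simp only [opair_inj, natZ_eq_iff] at h
          simp [natZ_succ m, succ_inj_iff] at h
          exact h.1.symm
        · rintro rfl; exact ⟨nm, h2, Or.inl rfl⟩
      · rintro n ⟨p, _, h⟩; simp [opair_inj, natZ_eq_iff] at h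
  · refine SK.F n (by simp [symKind]) (arityOf_eq (by simp [symArity])) ?_ ?_ ?_ ?_
    · rintro ⟨p, _, h⟩; simp [opair_inj, natZ_eq_iff] at h
    · rintro ⟨p, _, h⟩; simp [opair_inj, natZ_eq_iff] at h
    · intro n
      constructor
      · rintro ⟨p, _, h⟩; simp [opair_inj, natZ_eq_iff] at h
        exact h.1.symm
      · rintro rfl; exact ⟨nm, h2, Or.inr (Or.inl rfl)⟩
    · intro n
      constructor
      · rintro ⟨p, _, h⟩; simp [opair_inj, natZ_eq_iff] at h
        exact h.1.symm
      · rintro rfl; exact ⟨nm, h2, Or.inl rfl⟩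
  · refine SK.C (by simp [symKind]) ⟨_, h1, rfl⟩ ?_ ?_ ?_
    · rintro ⟨p, _, h⟩; simp [opair_inj, natZ_eq_iff] at h
    · intro n
      constructor
      · rintro ⟨p, _, h⟩; simp [opair_inj, natZ_eq_iff] at h
        exact h.1
      · rintro rfl; exact ⟨_, h1, Or.inr (Or.inr ⟨rfl, rfl⟩)⟩
    · intro n
      constructor
      · rintro ⟨p, _, h⟩; simp [opair_inj, natZ_eq_iff] at h
        exact h.1
      · rintro rfl; exact ⟨_, h1, Or.inr ⟨rfl, rfl⟩⟩

theorem Bx.sk (h : Bx G z σ T ud th E) {s} (hs : s ∈ σ) : SK G s := SmallExt.sk h.cx.tG (h.sym s hs) (h.cx.ss hs)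

theorem Bx.nest (h : Bx G z σ T ud th E) (L : List ZFSet.{0}) (hL : ∀ a ∈ L, a ∈ z) {b} (hb : b ∈ z) : nest L b ∈ G :=
  h.cx.nests L (fun a ha => by simp [ZZ, z_XX (hL a ha)]) b (by simp [ZZ, z_XX hb])
theorem Bx.zl (h : Bx G z σ T ud th E) (L : List ZFSet.{0}) (hL : ∀ a ∈ L, a ∈ z) : zlist L ∈ G := by
  rw [zlist_eq_nest]
  exact h.cx.nests L (fun a ha => by simp [ZZ, z_XX (hL a ha)]) ∅ (by simp [ZZ, XX])

theorem TC_iff (h : SK G s) : TC G s ↔ symKind s = natZ 2 := by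
  cases h with
  | Z _ h1 _ h2 => rw [h1]; simp [h2, natZ_eq_iff]
  | R _ h1 _ h2 => rw [h1]; simp [h2, natZ_eq_iff]
  | F _ h1 _ h2 => rw [h1]; simp [h2, natZ_eq_iff]
  | C h1 h2 => simp [h1, h2]

theorem NI_iff (h : Bx G z σ T ud th E) (cs : CS G z (Jz z) σ S) (hU : ∀ b ∈ z, (b ∈ U ↔ nd 0 ∅ ∅ ∅ b ∈ S)) :
    ∀ (L : List ZFSet.{0}), (∀ a ∈ L, a ∈ z) → (nd 3 (zlist L) ∅ ∅ ∅ ∉ S ↔ ∀ a ∈ L, a ∈ U)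
  | [], _ => by simp [zlist_nil, g3e h.cx cs]
  | a :: L, hL => by
    have h1 := h.zl _ hL
    rw [zlist_cons] at *
    rw [g3 h.cx cs h1]
    have := NI_iff h cs hU L (fun b hb => hL b (by simp [hb]))
    have h2 := hU a (hL a (by simp))
    simp only [List.mem_cons, forall_eq_or_imp, ← this, h2]
    tauto

/-- solutions restrict leaves -/
theorem leafShape (h : Bx G z σ T ud th E) (hK : KX G z σ T ud th E S)
    (hU : ∀ b ∈ z, (b ∈ U ↔ nd 0 ∅ ∅ ∅ b ∈ S)) {s w} (hs : s ∈ σ) (hw : w ∈ G) (hl : nd 1 ∅ s w ∅ ∈ S) :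
    w ∈ zfst (iapp th s) ∧ ((TZ G s ∧ w = ∅) ∨ ∃ (m : ℕ) (L : List ZFSet.{0}) (b : ZFSet.{0}), TS G s (natZ m) ∧ L.length = m ∧
      (∀ a ∈ L, a ∈ U) ∧ b ∈ U ∧ (∀ a ∈ L, a ∈ z) ∧ b ∈ z ∧ w = SmallExt.nest L b) := by
  obtain ⟨cs, _, k3, k4, _⟩ := hK
  have hA : Al G E th s w := by
    by_contra hc
    exact k4 s hs w hw hc hl
  obtain ⟨⟨y, _, j, _, ht, hy⟩, hA⟩ := hA
  refine ⟨?_, ?_⟩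
  · rw [iapp_eq h.thf (ZFSet.mem_insert_of_mem _ hs) ht]; simpa using hy
  · rcases hA with ⟨n, hn, l, hl', b, hb, hT, hE⟩ | hA
    · right
      have hE' := hE
      rw [h.hE] at hE
      obtain ⟨L, hL, rfl, rfl, hbz, rfl⟩ := hE
      have := k3 s hs _ hn hT _ hl' b hb _ hw hE'
      exact ⟨L.length, L, b, hT, rfl, (NI_iff h cs hU L hL).1 (this.2 hl), (hU b hbz).2 (this.1 hl), hL, hbz, rfl⟩
    · exact Or.inl hA

structure DecF (G z σ S U : ZFSet.{0}) (i : ZFSet.{0} → ZFSet.{0}) : Prop where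
  UZ : U ⊆ z
  hU : ∀ b ∈ z, (b ∈ U ↔ nd 0 ∅ ∅ ∅ b ∈ S)
  hi : ∀ s ∈ σ, Cd G s (i s) S

/-- the constant leaf -/
theorem leafConst (h : Bx G z σ T ud th E) (hK : KX G z σ T ud th E S)
    (hU : ∀ b ∈ z, (b ∈ U ↔ nd 0 ∅ ∅ ∅ b ∈ S)) {s w w'} (hs : s ∈ σ) (hc : TC G s) (hw : w ∈ G) (hw' : w' ∈ G)
    (hl : nd 1 ∅ s w ∅ ∈ S) (hl' : nd 1 ∅ s w' ∅ ∈ S) : w = w' := by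
  have key : ∀ w ∈ G, nd 1 ∅ s w ∅ ∈ S → w ∈ z := by
    intro w hw hl
    obtain ⟨_, h1⟩ := leafShape h hK hU hs hw hl
    have hk := h.sk hs
    cases hk with
    | Z _ _ _ h2 => exact absurd hc h2
    | R _ _ _ h2 => exact absurd hc h2
    | F _ _ _ h2 => exact absurd hc h2
    | C _ _ hz hts _ =>
      rcases h1 with ⟨h1, _⟩ | ⟨m, L, b, hT, hm, _, _, _, hb, rfl⟩
      · exact absurd h1 hz
      · have : m = 0 := natZ_inj ((hts _).1 hT)
        subst this
        rw [List.length_eq_zero_iff] at hm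
        subst hm
        exact hb
  have k8 := hK.2.2.2.2.2.2.2.1
  by_contra hne
  have hk := h.sk hs
  have hTF : TF G s ∅ := by
    cases hk with
    | Z _ _ _ h2 => exact absurd hc h2
    | R _ _ _ h2 => exact absurd hc h2
    | F _ _ _ h2 => exact absurd hc h2
    | C _ _ hz hts htf => exact (htf _).2 rfl
  exact k8 s hs ∅ h.cx.em hTF ∅ h.cx.em w (key w hw hl) w hw w' (key w' hw' hl') w' hw'
    ((h.hE _ _ _ _).2 ⟨[], by simp, rfl, rfl, key w hw hl, rfl⟩)
    ((h.hE _ _ _ _).2 ⟨[], by simp, rfl, rfl, key w' hw' hl', rfl⟩) hne hl hl'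

theorem leafConst_ex (h : Bx G z σ T ud th E) (hK : KX G z σ T ud th E S) {s} (hs : s ∈ σ) (hc : TC G s) :
    ∃ w ∈ G, nd 1 ∅ s w ∅ ∈ S := by
  have k7 := hK.2.2.2.2.2.2.1
  have hTF : TF G s ∅ := by
    cases h.sk hs with
    | Z _ _ _ h2 => exact absurd hc h2
    | R _ _ _ h2 => exact absurd hc h2
    | F _ _ _ h2 => exact absurd hc h2
    | C _ _ hz hts htf => exact (htf _).2 rfl
  rcases k7 s hs ∅ h.cx.em hTF ∅ h.cx.em (Or.inl ⟨rfl, rfl⟩) with h1 | ⟨b, _, w, hw, _, h1⟩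
  · exact absurd h1 (g3e h.cx hK.1)
  · exact ⟨w, hw, h1⟩

theorem dec_sem (h : Bx G z σ T ud th E) (hK : KX G z σ T ud th E S) (d : DecF G z σ S U i) : Sem G z σ S U i where
  cx := h.cx
  cs := hK.1
  hU := fun b hb => (d.hU b hb).symm
  h2 := fun s hs hk w hw => by
    have hc := (TC_iff (h.sk hs)).2 hk
    obtain ⟨h1, h2⟩ := (d.hi s hs).1 hc
    constructor
    · intro hl; exact leafConst h hK d.hU hs hc hw h1 hl h2
    · rintro rfl; exact h2
  h1 := fun s hs hk w hw => by
    have hc := mt (TC_iff (h.sk hs)).1 hk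
    exact (((d.hi s hs).2 hc).2 w hw).symm

theorem ZPow_of (h : Bx G z σ T ud th E) (hK : KX G z σ T ud th E S) (d : DecF G z σ S U i) {s w} (hs : s ∈ σ)
    (hc : ¬ TC G s) (hw : w ∈ i s) : w ∈ zfst (iapp th s) ∧
      (symKind s = natZ 0 → w ∈ ZPow U (arityOf s)) ∧ (symKind s = natZ 1 → w ∈ ZPow U (arityOf s + 1)) := by
  obtain ⟨h1, h2⟩ := (d.hi s hs).2 hc
  obtain ⟨h3, h4⟩ := leafShape h hK d.hU hs (h1 hw) ((h2 w (h1 hw)).1 hw)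
  refine ⟨h3, ?_⟩
  cases h.sk hs with
  | Z hz hk ha _ hts _ =>
    rw [hk, ha]
    refine ⟨fun _ => ?_, fun hh => absurd hh (natZ_ne (by omega))⟩
    rcases h4 with ⟨_, rfl⟩ | ⟨m, L, b, hT, _⟩
    · exact (mem_ZPow _ _ _).2 ⟨[], rfl, by simp, rfl⟩
    · exact absurd hT (hts _)
  | R m hk ha _ hz hts _ =>
    rw [hk, ha]
    refine ⟨fun _ => ?_, fun hh => absurd hh (natZ_ne (by omega))⟩
    rcases h4 with ⟨hh, _⟩ | ⟨m', L, b, hT, hm, hL, hb, _, _, rfl⟩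
    · exact absurd hh hz
    · have := natZ_inj ((hts _).1 hT)
      exact (mem_ZPow_succ _ _ _).2 ⟨L, b, by omega, hL, hb, rfl⟩
  | F m hk ha _ hz hts _ =>
    rw [hk, ha]
    refine ⟨fun hh => absurd hh (natZ_ne (by omega)), fun _ => ?_⟩
    rcases h4 with ⟨hh, _⟩ | ⟨m', L, b, hT, hm, hL, hb, _, _, rfl⟩
    · exact absurd hh hz
    · have := natZ_inj ((hts _).1 hT)
      exact (mem_ZPow_succ _ _ _).2 ⟨L, b, by omega, hL, hb, rfl⟩
  | C _ hc' => exact absurd hc' hc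

theorem fun_total (h : Bx G z σ T ud th E) (hK : KX G z σ T ud th E S) (d : DecF G z σ S U i) {s} (hs : s ∈ σ)
    (hk : symKind s = natZ 1) (args : List ZFSet.{0}) (hlen : args.length = arityOf s) (hU : ∀ a ∈ args, a ∈ U) :
    ∃! b, b ∈ U ∧ ztuple (args ++ [b]) ∈ i s := by
  have hc : ¬ TC G s := by rw [TC_iff (h.sk hs), hk]; exact natZ_ne (by omega)
  obtain ⟨h1, h2⟩ := (d.hi s hs).2 hc
  have hz : ∀ a ∈ args, a ∈ z := fun a ha => d.UZ (hU a ha)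
  have hTF : TF G s (natZ args.length) ∧ TS G s (natZ args.length) := by
    cases h.sk hs with
    | Z _ hk' => rw [hk] at hk'; exact absurd hk' (natZ_ne (by omega))
    | R _ hk' => rw [hk] at hk'; exact absurd hk' (natZ_ne (by omega))
    | F m _ ha _ _ h3 h4 => rw [h3, h4, hlen, ha]; exact ⟨rfl, rfl⟩
    | C hk' => rw [hk] at hk'; exact absurd hk' (natZ_ne (by omega))
  obtain ⟨cs, _, k3, _, _, _, k7, k8, _⟩ := hK
  have hni := (NI_iff h cs d.hU args hz).2 hU
  have hzl := h.zl args hz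
  have hLst : Lst G z E (natZ args.length) (zlist args) ∨ ∀ b ∈ z, False := by
    by_cases he : ∃ b, b ∈ z
    · obtain ⟨b, hb⟩ := he
      exact Or.inl (Or.inr ⟨b, hb, _, h.nest args hz hb, (h.hE _ _ _ _).2 ⟨args, hz, rfl, rfl, hb, rfl⟩⟩)
    · exact Or.inr fun b hb => he ⟨b, hb⟩
  have hLst : Lst G z E (natZ args.length) (zlist args) := by
    rcases hLst with h' | h'
    · exact h'
    · cases args with
      | nil => exact Or.inl ⟨rfl, rfl⟩
      | cons a l => exact (h' a (hz a (by simp))).elim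
  simp only [ztuple_snoc]
  rcases k7 s hs _ (h.cx.nat _) hTF.1 _ hzl hLst with h3 | ⟨b, hb, w, hw, hE, hl⟩
  · exact absurd h3 hni
  · have hw' : w = SmallExt.nest args b := by
      obtain ⟨L, hL, e1, e2, _, rfl⟩ := (h.hE _ _ _ _).1 hE
      rw [zlist_inj _ _ e2]
    subst hw'
    refine ⟨b, ⟨?_, (h2 _ hw).2 hl⟩, ?_⟩
    · exact (d.hU b hb).2 ((k3 s hs _ (h.cx.nat _) hTF.2 _ hzl b (h.cx.zs hb) _ hw hE).1 hl)
    · rintro b' ⟨hb', hi⟩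
      have hbz := d.UZ hb'
      have hw2 := h.nest args hz hbz
      by_contra hne
      exact k8 s hs _ (h.cx.nat _) hTF.1 _ hzl b hb _ hw b' hbz _ hw2 hE
        ((h.hE _ _ _ _).2 ⟨args, hz, rfl, rfl, hbz, rfl⟩) (fun e => hne e.symm) hl ((h2 _ hw2).1 hi)

theorem dec_str (h : Bx G z σ T ud th E) (hK : KX G z σ T ud th E S) (d : DecF G z σ S U i) : Str z U σ i where
  sym := h.sym
  UZ := d.UZ
  r := fun s hs hk w hw => (ZPow_of h hK d hs (by rw [TC_iff (h.sk hs), hk]; exact natZ_ne (by omega)) hw).2.1 hk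
  f := fun s hs hk w hw => (ZPow_of h hK d hs (by rw [TC_iff (h.sk hs), hk]; exact natZ_ne (by omega)) hw).2.2 hk
  ft := fun s hs hk args h1 h2 => fun_total h hK d hs hk args h1 h2
  c := fun s hs hk => by
    have hc := (TC_iff (h.sk hs)).2 hk
    obtain ⟨h1, h2⟩ := (d.hi s hs).1 hc
    obtain ⟨_, h3⟩ := leafShape h hK d.hU hs h1 h2
    cases h.sk hs with
    | Z _ _ _ h2 => exact absurd hc h2
    | R _ _ _ h2 => exact absurd hc h2
    | F _ _ _ h2 => exact absurd hc h2
    | C _ _ hz hts _ =>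
      rcases h3 with ⟨h1, _⟩ | ⟨m, L, b, hT, hm, _, hb, _, _, he⟩
      · exact absurd h1 hz
      · have : m = 0 := natZ_inj ((hts _).1 hT)
        subst this
        rw [List.length_eq_zero_iff] at hm
        subst hm
        rw [he]; exact hb

theorem th_pair (h : Bx G z σ T ud th E) {s y j} (hs : s ∈ insert ud σ) (e : iapp th s = opair y j) :
    opair s (opair y j) ∈ th := by rw [← e]; exact iapp_mem h.thf hs

theorem th_mem (h : Bx G z σ T ud th E) (hK : KX G z σ T ud th E S) (d : DecF G z σ S U i) {s y w} (hs : s ∈ σ)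
    (hc : ¬ TC G s) (e : iapp th s = opair y (natZ 1)) (hw : w ∈ y)
    (hp : (symKind s = natZ 0 ∧ w ∈ ZPow U (arityOf s)) ∨ (symKind s = natZ 1 ∧ w ∈ ZPow U (arityOf s + 1))) : w ∈ i s := by
  have ht := th_pair h (ZFSet.mem_insert_of_mem _ hs) e
  have hyG := (h.thG _ _ _ ht).1
  have hwG := h.cx.tG _ hyG hw
  rw [((d.hi s hs).2 hc).2 w hwG]
  obtain ⟨cs, _, _, _, k5, k6, _⟩ := hK
  have key : ∀ m, TS G s (natZ m) → w ∈ ZPow U (m + 1) → nd 1 ∅ s w ∅ ∈ S := by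
    intro m hT hp
    obtain ⟨L, b, rfl, hL, hb, rfl⟩ := (mem_ZPow_succ _ _ _).1 hp
    have hLz := fun a ha => d.UZ (hL a ha)
    have hbz := d.UZ hb
    rcases k5 s hs hc _ (h.cx.nat _) hT _ (h.zl L hLz) b (h.cx.zs hbz) _ hwG
      ((h.hE _ _ _ _).2 ⟨L, hLz, rfl, rfl, hbz, rfl⟩) y hyG ht hw ((d.hU b hbz).1 hb) with h1 | h1
    · exact absurd h1 ((NI_iff h cs d.hU L hLz).2 hL)
    · exact h1
  cases h.sk hs with
  | Z hz hk ha _ _ _ =>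
    rw [hk, ha] at hp
    rcases hp with ⟨_, hp⟩ | ⟨hp, _⟩
    · have : w = ∅ := by
        obtain ⟨L, hL, _, rfl⟩ := (mem_ZPow _ _ _).1 hp
        rw [List.length_eq_zero_iff] at hL
        subst hL; rfl
      subst this
      exact k6 s hs hz y hyG ht hw
    · exact absurd hp (natZ_ne (by omega))
  | R m hk ha _ _ hts _ =>
    rw [hk, ha] at hp
    rcases hp with ⟨_, hp⟩ | ⟨hp, _⟩
    · exact key m ((hts _).2 rfl) hp
    · exact absurd hp (natZ_ne (by omega))
  | F m hk ha _ _ hts _ =>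
    rw [hk, ha] at hp
    rcases hp with ⟨hp, _⟩ | ⟨_, hp⟩
    · exact absurd hp (natZ_ne (by omega))
    · exact key m ((hts _).2 rfl) hp
  | C _ hc' => exact absurd hc' hc

theorem sol_model (h : Bx G z σ T ud th E) (hK : KX G z σ T ud th E S) (d : DecF G z σ S U i) : MT σ T ud th U i where
  u := fun y j e => by
    have hz := h.zdef
    rw [e, zfst_opair] at hz
    subst hz
    refine ⟨fun _ => d.UZ, ?_⟩
    rintro rfl
    have k9 := hK.2.2.2.2.2.2.2.2 (th_pair h (ZFSet.mem_insert _ _) e)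
    ext b
    exact ⟨fun hb => d.UZ hb, fun hb => (d.hU b hb).2 (k9 b hb)⟩
  s := fun s hs y j e => by
    have fy : zfst (iapp th s) = y := by rw [e, zfst_opair]
    refine ⟨fun hk => ?_, fun hk => ?_, fun hk => ?_⟩
    · have hc : ¬ TC G s := by rw [TC_iff (h.sk hs), hk]; exact natZ_ne (by omega)
      have h1 : i s ⊆ y ∩ ZPow U (arityOf s) := by
        intro w hw
        obtain ⟨h1, h2, _⟩ := ZPow_of h hK d hs hc hw
        rw [ZFSet.mem_inter]
        exact ⟨fy ▸ h1, h2 hk⟩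
      refine ⟨fun _ => h1, ?_⟩
      rintro rfl
      ext w
      refine ⟨fun hw => h1 hw, fun hw => ?_⟩
      rw [ZFSet.mem_inter] at hw
      exact th_mem h hK d hs hc e hw.1 (Or.inl ⟨hk, hw.2⟩)
    · have hc : ¬ TC G s := by rw [TC_iff (h.sk hs), hk]; exact natZ_ne (by omega)
      have h1 : i s ⊆ y ∩ ZPow U (arityOf s + 1) := by
        intro w hw
        obtain ⟨h1, _, h2⟩ := ZPow_of h hK d hs hc hw
        rw [ZFSet.mem_inter]
        exact ⟨fy ▸ h1, h2 hk⟩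
      refine ⟨fun args h1 h2 => fun_total h hK d hs hk args h1 h2, fun _ => h1, ?_⟩
      rintro rfl
      ext w
      refine ⟨fun hw => h1 hw, fun hw => ?_⟩
      rw [ZFSet.mem_inter] at hw
      exact th_mem h hK d hs hc e hw.1 (Or.inr ⟨hk, hw.2⟩)
    · have hc := (TC_iff (h.sk hs)).2 hk
      obtain ⟨h1, h2⟩ := (d.hi s hs).1 hc
      exact ⟨fy ▸ (leafShape h hK d.hU hs h1 h2).1, (dec_str h hK d).c s hs hk⟩
  t := fun c hc f hf => by
    obtain ⟨f', hf', hu⟩ := h.Tf c hc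
    have : f' = f := FmCode_inj _ _ (hf'.trans hf.symm)
    subst this
    have := sem_fm (dec_sem h hK d) (dec_str h hK d) f' [] (by simp) hu (by rw [hf]; exact h.TG hc)
    rw [hf] at this
    have h2 := this.1 (hK.2.1 c hc)
    simpa using h2

end
end SmallExt

namespace SmallExt

/-! ### Part 11: models give solutions -/

section
attribute [local instance] Classical.propDecidable

variable {G z σ T ud th E S U : ZFSet.{0}} {i : ZFSet.{0} → ZFSet.{0}}

theorem MT.UZ (h : Bx G z σ T ud th E) (m : MT σ T ud th U i) : U ⊆ z := by
  obtain ⟨y, j, e, hj⟩ := h.thv ud (ZFSet.mem_insert _ _)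
  have hz := h.zdef
  rw [e, zfst_opair] at hz
  subst hz
  rcases hj with hj | hj
  · exact (m.u _ _ e).1 hj
  · rw [(m.u _ _ e).2 hj]

theorem MT.str (h : Bx G z σ T ud th E) (m : MT σ T ud th U i) : Str z U σ i where
  sym := h.sym
  UZ := m.UZ h
  r := fun s hs hk w hw => by
    obtain ⟨y, j, e, hj⟩ := h.thv s (ZFSet.mem_insert_of_mem _ hs)
    have := (m.s s hs y j e).1 hk
    rcases hj with hj | hj
    · exact (ZFSet.mem_inter.1 (this.1 hj hw)).2
    · have h2 := this.2 hj; rw [h2] at hw; exact (ZFSet.mem_inter.1 hw).2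
  f := fun s hs hk w hw => by
    obtain ⟨y, j, e, hj⟩ := h.thv s (ZFSet.mem_insert_of_mem _ hs)
    have := ((m.s s hs y j e).2.1 hk).2
    rcases hj with hj | hj
    · exact (ZFSet.mem_inter.1 (this.1 hj hw)).2
    · have h2 := this.2 hj; rw [h2] at hw; exact (ZFSet.mem_inter.1 hw).2
  ft := fun s hs hk => by
    obtain ⟨y, j, e, hj⟩ := h.thv s (ZFSet.mem_insert_of_mem _ hs)
    exact ((m.s s hs y j e).2.1 hk).1
  c := fun s hs hk => by
    obtain ⟨y, j, e, hj⟩ := h.thv s (ZFSet.mem_insert_of_mem _ hs)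
    exact ((m.s s hs y j e).2.2 hk).2

theorem MT.in_y (h : Bx G z σ T ud th E) (m : MT σ T ud th U i) {s w} (hs : s ∈ σ) (hc : ¬ TC G s) (hw : w ∈ i s) :
    w ∈ zfst (iapp th s) := by
  obtain ⟨y, j, e, hj⟩ := h.thv s (ZFSet.mem_insert_of_mem _ hs)
  rw [e, zfst_opair]
  have key : symKind s = natZ 0 ∨ symKind s = natZ 1 := by
    cases h.sk hs with
    | Z _ hk => exact Or.inl hk
    | R _ hk => exact Or.inl hk
    | F _ hk => exact Or.inr hk
    | C _ h' => exact absurd h' hc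
  rcases key with hk | hk
  · have := (m.s s hs y j e).1 hk
    rcases hj with hj | hj
    · exact (ZFSet.mem_inter.1 (this.1 hj hw)).1
    · have h2 := this.2 hj; rw [h2] at hw; exact (ZFSet.mem_inter.1 hw).1
  · have := ((m.s s hs y j e).2.1 hk).2
    rcases hj with hj | hj
    · exact (ZFSet.mem_inter.1 (this.1 hj hw)).1
    · have h2 := this.2 hj; rw [h2] at hw; exact (ZFSet.mem_inter.1 hw).1

theorem MT.shape (h : Bx G z σ T ud th E) (m : MT σ T ud th U i) (sem : Sem G z σ S U i) {s w} (hs : s ∈ σ) (hw : w ∈ G)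
    (hl : nd 1 ∅ s w ∅ ∈ S) :
    w ∈ zfst (iapp th s) ∧ ((TZ G s ∧ w = ∅) ∨ ∃ (L : List ZFSet.{0}) (b : ZFSet.{0}), (∀ n, TS G s n ↔ n = natZ L.length) ∧
      (∀ a ∈ L, a ∈ U) ∧ b ∈ U ∧ w = SmallExt.nest L b) := by
  have st := m.str h
  cases h.sk hs with
  | Z hz hk ha hc _ _ =>
    have hk2 : symKind s ≠ natZ 2 := by rw [hk]; exact natZ_ne (by omega)
    have hi := (sem.h1 s hs hk2 w hw).1 hl
    refine ⟨m.in_y h hs hc hi, Or.inl ⟨hz, ?_⟩⟩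
    have := st.r s hs hk hi
    rw [ha, mem_ZPow] at this
    obtain ⟨L, hL, _, rfl⟩ := this
    rw [List.length_eq_zero_iff] at hL
    subst hL; rfl
  | R k hk ha hc hz hts _ =>
    have hk2 : symKind s ≠ natZ 2 := by rw [hk]; exact natZ_ne (by omega)
    have hi := (sem.h1 s hs hk2 w hw).1 hl
    refine ⟨m.in_y h hs hc hi, Or.inr ?_⟩
    have := st.r s hs hk hi
    rw [ha, mem_ZPow_succ] at this
    obtain ⟨L, b, rfl, hL, hb, rfl⟩ := this
    exact ⟨L, b, hts, hL, hb, rfl⟩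
  | F k hk ha hc hz hts _ =>
    have hk2 : symKind s ≠ natZ 2 := by rw [hk]; exact natZ_ne (by omega)
    have hi := (sem.h1 s hs hk2 w hw).1 hl
    refine ⟨m.in_y h hs hc hi, Or.inr ?_⟩
    have := st.f s hs hk hi
    rw [ha, mem_ZPow_succ] at this
    obtain ⟨L, b, rfl, hL, hb, rfl⟩ := this
    exact ⟨L, b, hts, hL, hb, rfl⟩
  | C hk hc hz hts htf =>
    have hi := (sem.h2 s hs hk w hw).1 hl
    subst hi
    obtain ⟨y, j, e, hj⟩ := h.thv s (ZFSet.mem_insert_of_mem _ hs)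
    have := (m.s s hs y j e).2.2 hk
    rw [e, zfst_opair]
    exact ⟨this.1, Or.inr ⟨[], i s, hts, by simp, this.2, rfl⟩⟩

theorem MT.sol (h : Bx G z σ T ud th E) (m : MT σ T ud th U i) (sem : Sem G z σ S U i) : KX G z σ T ud th E S := by
  have st := m.str h
  have UZ := m.UZ h
  have hU : ∀ b ∈ z, (b ∈ U ↔ nd 0 ∅ ∅ ∅ b ∈ S) := fun b hb => (sem.hU b hb).symm
  have cs := sem.cs
  refine ⟨cs, ?_, ?_, ?_, ?_, ?_, ?_, ?_, ?_⟩
  · intro c hc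
    obtain ⟨f, rfl, hu⟩ := h.Tf c hc
    have := sem_fm sem st f [] (by simp) hu (h.TG hc)
    rw [zlist_nil] at this
    rw [this]
    simpa using m.t _ hc f rfl
  · intro s hs n hn hT l hl b hb w hw hE
    obtain ⟨L, hL, rfl, rfl, hbz, rfl⟩ := (h.hE _ _ _ _).1 hE
    have key : nd 1 ∅ s (SmallExt.nest L b) ∅ ∈ S → b ∈ U ∧ ∀ a ∈ L, a ∈ U := by
      intro hlf
      rcases (m.shape h sem hs hw hlf).2 with ⟨hz, _⟩ | ⟨L', b', hts, hL', hb', e⟩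
      · cases h.sk hs with
        | Z _ _ _ _ h1 _ => exact absurd hT (h1 _)
        | R _ _ _ _ h1 => exact absurd hz h1
        | F _ _ _ _ h1 => exact absurd hz h1
        | C _ _ h1 => exact absurd hz h1
      · obtain ⟨rfl, rfl⟩ := nest_inj _ _ _ _ (natZ_inj ((hts _).1 hT)) e
        exact ⟨hb', hL'⟩
    exact ⟨fun hlf => (hU b hbz).1 (key hlf).1, fun hlf => (NI_iff h cs hU L hL).2 (key hlf).2⟩
  · intro s hs w hw hA hlf
    apply hA
    obtain ⟨h1, h2⟩ := m.shape h sem hs hw hlf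
    obtain ⟨y, j, e, hj⟩ := h.thv s (ZFSet.mem_insert_of_mem _ hs)
    have ht := th_pair h (ZFSet.mem_insert_of_mem _ hs) e
    rw [e, zfst_opair] at h1
    refine ⟨⟨y, (h.thG _ _ _ ht).1, j, (h.thG _ _ _ ht).2, ht, h1⟩, ?_⟩
    rcases h2 with h2 | ⟨L, b, hts, hL, hb, rfl⟩
    · exact Or.inr h2
    · have hLz := fun a ha => UZ (hL a ha)
      exact Or.inl ⟨_, h.cx.nat L.length, _, h.zl L hLz, b, h.cx.zs (UZ hb), (hts _).2 rfl,
        (h.hE _ _ _ _).2 ⟨L, hLz, rfl, rfl, UZ hb, rfl⟩⟩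
  · intro s hs hc n hn hT l hl b hb w hw hE y hy ht hwy hbS
    obtain ⟨L, hL, rfl, rfl, hbz, rfl⟩ := (h.hE _ _ _ _).1 hE
    by_cases hni : nd 3 (zlist L) ∅ ∅ ∅ ∈ S
    · exact Or.inl hni
    · right
      have hLU := (NI_iff h cs hU L hL).1 hni
      have hbU := (hU b hbz).2 hbS
      have e := iapp_eq h.thf (ZFSet.mem_insert_of_mem _ hs) ht
      have hk2 := mt (TC_iff (h.sk hs)).2 hc
      rw [sem.h1 s hs hk2 _ hw]
      cases h.sk hs with
      | Z _ _ _ _ h1 _ => exact absurd hT (h1 _)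
      | R k hk ha _ _ hts =>
        have := ((m.s s hs _ _ e).1 hk).2 rfl
        rw [this, ZFSet.mem_inter, ha, mem_ZPow_succ]
        exact ⟨hwy, L, b, natZ_inj ((hts _).1 hT), hLU, hbU, rfl⟩
      | F k hk ha _ _ hts =>
        have := ((m.s s hs _ _ e).2.1 hk).2.2 rfl
        rw [this, ZFSet.mem_inter, ha, mem_ZPow_succ]
        exact ⟨hwy, L, b, natZ_inj ((hts _).1 hT), hLU, hbU, rfl⟩
      | C _ hc' => exact absurd hc' hc
  · intro s hs hz y hy ht hwy
    have e := iapp_eq h.thf (ZFSet.mem_insert_of_mem _ hs) ht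
    cases h.sk hs with
    | Z _ hk ha hc _ _ =>
      have hk2 := mt (TC_iff (h.sk hs)).2 hc
      rw [sem.h1 s hs hk2 _ h.cx.em]
      have := ((m.s s hs _ _ e).1 hk).2 rfl
      rw [this, ZFSet.mem_inter, ha, mem_ZPow]
      exact ⟨hwy, [], rfl, by simp, rfl⟩
    | R _ _ _ _ h1 => exact absurd hz h1
    | F _ _ _ _ h1 => exact absurd hz h1
    | C _ _ h1 => exact absurd hz h1
  · intro s hs n hn hT l hl hLst
    have hL : ∃ L : List ZFSet.{0}, (∀ a ∈ L, a ∈ z) ∧ n = natZ L.length ∧ l = zlist L := by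
      rcases hLst with ⟨rfl, rfl⟩ | ⟨b, _, w, _, hE⟩
      · exact ⟨[], by simp, rfl, rfl⟩
      · obtain ⟨L, h1, h2, h3, _⟩ := (h.hE _ _ _ _).1 hE
        exact ⟨L, h1, h2, h3⟩
    obtain ⟨L, hLz, rfl, rfl⟩ := hL
    by_cases hni : nd 3 (zlist L) ∅ ∅ ∅ ∈ S
    · exact Or.inl hni
    · right
      have hLU := (NI_iff h cs hU L hLz).1 hni
      have key : ∀ b ∈ U, nd 1 ∅ s (SmallExt.nest L b) ∅ ∈ S → ∃ b ∈ z, ∃ w ∈ G, ent (natZ L.length) (zlist L) b w ∈ E ∧ nd 1 ∅ s w ∅ ∈ S := by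
        intro b hb hlf
        exact ⟨b, UZ hb, _, h.nest L hLz (UZ hb), (h.hE _ _ _ _).2 ⟨L, hLz, rfl, rfl, UZ hb, rfl⟩, hlf⟩
      cases h.sk hs with
      | Z _ _ _ _ _ h1 => exact absurd hT (h1 _)
      | R _ _ _ _ _ _ h1 => exact absurd hT (h1 _)
      | F k hk ha hc _ _ htf =>
        have hlen : L.length = arityOf s := by rw [ha]; exact natZ_inj ((htf _).1 hT)
        obtain ⟨b, ⟨hb, hi⟩, _⟩ := st.ft s hs hk L hlen hLU
        rw [ztuple_snoc] at hi
        have hk2 := mt (TC_iff (h.sk hs)).2 hc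
        exact key b hb ((sem.h1 s hs hk2 _ (h.nest L hLz (UZ hb))).2 hi)
      | C hk hc _ _ htf =>
        have hlen : L.length = 0 := natZ_inj ((htf _).1 hT)
        rw [List.length_eq_zero_iff] at hlen
        subst hlen
        have hi := st.c s hs hk
        exact key (i s) hi ((sem.h2 s hs hk _ (h.cx.zs (UZ hi))).2 rfl)
  · intro s hs n hn hT l hl b hb w hw b' hb' w' hw' hE hE' hne hlf hlf'
    apply hne
    obtain ⟨L, hLz, rfl, rfl, _, rfl⟩ := (h.hE _ _ _ _).1 hE
    obtain ⟨L', hLz', _, el, _, rfl⟩ := (h.hE _ _ _ _).1 hE'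
    have := zlist_inj _ _ el
    subst this
    cases h.sk hs with
    | Z _ _ _ _ _ h1 => exact absurd hT (h1 _)
    | R _ _ _ _ _ _ h1 => exact absurd hT (h1 _)
    | F k hk ha hc _ _ htf =>
      have hlen : L.length = arityOf s := by rw [ha]; exact natZ_inj ((htf _).1 hT)
      have hk2 := mt (TC_iff (h.sk hs)).2 hc
      have h1 := (sem.h1 s hs hk2 _ hw).1 hlf
      have h2 := (sem.h1 s hs hk2 _ hw').1 hlf'
      have key : ∀ c, SmallExt.nest L c ∈ i s → (∀ a ∈ L, a ∈ U) ∧ c ∈ U := by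
        intro c hc'
        have := st.f s hs hk hc'
        rw [mem_ZPow_succ] at this
        obtain ⟨L', b', hl', hL', hb', e⟩ := this
        obtain ⟨rfl, rfl⟩ := nest_inj _ _ _ _ (hlen.trans hl'.symm) e
        exact ⟨hL', hb'⟩
      have hu := st.ft s hs hk L hlen (key b h1).1
      simp only [ztuple_snoc] at hu
      exact hu.unique ⟨(key b h1).2, h1⟩ ⟨(key b' h2).2, h2⟩
    | C hk hc _ _ htf =>
      have hlen : L.length = 0 := natZ_inj ((htf _).1 hT)
      rw [List.length_eq_zero_iff] at hlen
      subst hlen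
      exact ((sem.h2 s hs hk _ hw).1 hlf).trans ((sem.h2 s hs hk _ hw').1 hlf').symm
  · intro ht b hb
    have e := iapp_eq h.thf (ZFSet.mem_insert _ _) ht
    rw [← hU b hb, (m.u _ _ e).2 rfl]
    exact hb

theorem MT.dec (h : Bx G z σ T ud th E) (m : MT σ T ud th U i) (sem : Sem G z σ S U i) : DecF G z σ S U i where
  UZ := m.UZ h
  hU := fun b hb => (sem.hU b hb).symm
  hi := fun s hs => by
    have st := m.str h
    have UZ := m.UZ h
    refine ⟨fun hc => ?_, fun hc => ?_⟩
    · have hk := (TC_iff (h.sk hs)).1 hc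
      have hG := h.cx.zs (UZ (st.c s hs hk))
      exact ⟨hG, (sem.h2 s hs hk _ hG).2 rfl⟩
    · have hk2 := mt (TC_iff (h.sk hs)).2 hc
      refine ⟨fun w hw => ?_, fun w hw => (sem.h1 s hs hk2 w hw).symm⟩
      have h1 := m.in_y h hs hc hw
      obtain ⟨y, j, e, hj⟩ := h.thv s (ZFSet.mem_insert_of_mem _ hs)
      have ht := th_pair h (ZFSet.mem_insert_of_mem _ hs) e
      rw [e, zfst_opair] at h1
      exact h.cx.tG _ (h.thG _ _ _ ht).1 h1

end
end SmallExt

namespace SmallExt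

/-! ### Part 12: coding models -/

section
attribute [local instance] Classical.propDecidable

variable {G z σ T ud th E S U I M : ZFSet.{0}} {i : ZFSet.{0} → ZFSet.{0}}

theorem mem_opair_l {a b : ZFSet.{0}} : ({a, b} : ZFSet.{0}) ∈ opair a b := mem_opair.2 (Or.inr rfl)

theorem Cd_unique (h : Bx G z σ T ud th E) (hK : KX G z σ T ud th E S)
    (hU : ∀ b ∈ z, (b ∈ U ↔ nd 0 ∅ ∅ ∅ b ∈ S)) {s v v'} (hs : s ∈ σ) (h1 : Cd G s v S) (h2 : Cd G s v' S) : v = v' := by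
  by_cases hc : TC G s
  · exact leafConst h hK hU hs hc (h1.1 hc).1 (h2.1 hc).1 (h1.1 hc).2 (h2.1 hc).2
  · obtain ⟨a, b⟩ := h1.2 hc
    obtain ⟨a', b'⟩ := h2.2 hc
    ext w
    constructor
    · intro hw; exact (b' w (a hw)).2 ((b w (a hw)).1 hw)
    · intro hw; exact (b w (a' hw)).2 ((b' w (a' hw)).1 hw)

theorem Dec.decF (h : Bx G z σ T ud th E) (hK : KX G z σ T ud th E S) (d : Dec G z σ M S) :
    M = opair (zfst M) (zsnd M) ∧ IsZFunc (zsnd M) σ ∧ DecF G z σ S (zfst M) (iapp (zsnd M)) := by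
  obtain ⟨_, _, U, _, I, _, rfl, ⟨h1, h2⟩, h3, h4⟩ := d
  rw [zfst_opair, zsnd_opair]
  have hc : ∀ s v, opair s v ∈ I → s ∈ σ ∧ Cd G s v S := by
    intro s v hp
    obtain ⟨s', hs', _, _, v', _, e, hcd⟩ := h3 _ hp
    obtain ⟨rfl, rfl⟩ := opair_inj.1 e
    exact ⟨hs', hcd⟩
  have hf : IsZFunc I σ := by
    constructor
    · intro p hp
      obtain ⟨s', hs', _, _, v', _, e, hcd⟩ := h3 _ hp
      exact ⟨s', v', e, hs'⟩
    · intro s hs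
      obtain ⟨p, hp, _, _, v, _, rfl, hcd⟩ := h4 s hs
      exact ⟨v, hp, fun v' hv' => Cd_unique h hK h2 hs (hc _ _ hv').2 hcd⟩
  exact ⟨rfl, hf, h1, h2, fun s hs => (hc _ _ (iapp_mem hf hs)).2⟩

theorem DecF.dec (hM : M = opair (zfst M) (zsnd M)) (hf : IsZFunc (zsnd M) σ)
    (d : DecF G z σ S (zfst M) (iapp (zsnd M))) : Dec G z σ M S := by
  refine ⟨{zfst M, zsnd M}, ?_, zfst M, by simp, zsnd M, by simp, hM, ⟨d.UZ, d.hU⟩, ?_, ?_⟩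
  · have h1 := mem_opair_l (a := zfst M) (b := zsnd M)
    rwa [← hM] at h1
  · intro p hp
    obtain ⟨s, hs, rfl⟩ := (zfunc_ext hf).1 hp
    exact ⟨s, hs, _, mem_opair_l, _, by simp, rfl, d.hi s hs⟩
  · intro s hs
    exact ⟨_, iapp_mem hf hs, _, mem_opair_l, _, by simp, rfl, d.hi s hs⟩

theorem Dec_unique_M {M' : ZFSet.{0}} (h : Bx G z σ T ud th E) (hK : KX G z σ T ud th E S)
    (d : Dec G z σ M S) (d' : Dec G z σ M' S) : M = M' := by
  obtain ⟨e, hf, d⟩ := d.decF h hK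
  obtain ⟨e', hf', d'⟩ := d'.decF h hK
  rw [e, e']
  have hU : zfst M = zfst M' := by
    ext b
    constructor
    · intro hb; exact (d'.hU b (d.UZ hb)).2 ((d.hU b (d.UZ hb)).1 hb)
    · intro hb; exact (d.hU b (d'.UZ hb)).2 ((d'.hU b (d'.UZ hb)).1 hb)
  have hi : ∀ s ∈ σ, iapp (zsnd M) s = iapp (zsnd M') s := fun s hs =>
    Cd_unique h hK d.hU hs (d.hi s hs) (d'.hi s hs)
  rw [hU]
  congr 1
  ext q
  rw [zfunc_ext hf, zfunc_ext hf']
  constructor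
  · rintro ⟨s, hs, e⟩; exact ⟨s, hs, by rw [e, hi s hs]⟩
  · rintro ⟨s, hs, e⟩; exact ⟨s, hs, by rw [e, hi s hs]⟩

theorem Dec_unique_S {S' : ZFSet.{0}} (h : Bx G z σ T ud th E) (hK : KX G z σ T ud th E S)
    (hK' : KX G z σ T ud th E S') (hS : S ⊆ DDn G) (hS' : S' ⊆ DDn G)
    (d : Dec G z σ M S) (d' : Dec G z σ M S') : S = S' := by
  have m := dec_sem h hK (d.decF h hK).2.2
  have m' := dec_sem h hK' (d'.decF h hK').2.2
  have key := cons_unique (edge_wf G z (Jz z)) hK.1 hK'.1 (by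
    intro u hu hl
    unfold LF at hl
    rw [ZFSet.mem_sep] at hl
    rcases hl.2 with ⟨y, hy, rfl⟩ | ⟨s, hs, w, hw, rfl⟩
    · rw [m.hU y hy, m'.hU y hy]
    · by_cases hk : symKind s = natZ 2
      · rw [m.h2 s hs hk w hw, m'.h2 s hs hk w hw]
      · rw [m.h1 s hs hk w hw, m'.h1 s hs hk w hw])
  ext u
  exact ⟨fun hu => (key u (hS hu)).1 hu, fun hu => (key u (hS' hu)).2 hu⟩

variable {W : ZFSet.{0}} [hW : Fact (IsTransModel W)]

theorem sol_exists (h : Bx G z σ T ud th E) (hG : G ∈ W) (hz : z ∈ W) (hs : σ ∈ W) (hJ : Jz z ∈ W)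
    (hU : U ∈ W) (hI : I ∈ W) (hf : IsZFunc I σ) :
    ∃ S ∈ W, S ⊆ DDn G ∧ Sem G z σ S U (iapp I) := by
  have : Fact (G ∈ W) := ⟨hG⟩
  have : Fact (z ∈ W) := ⟨hz⟩
  have : Fact (σ ∈ W) := ⟨hs⟩
  have : Fact (U ∈ W) := ⟨hU⟩
  have : Fact (I ∈ W) := ⟨hI⟩
  have h0 := W_sep (W := W) (P := fun u => (∃ b ∈ U, u = nd 0 ∅ ∅ ∅ b) ∨ ∃ s ∈ σ, ∃ w ∈ G, u = nd 1 ∅ s w ∅ ∧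
    ((TC G s ∧ opair s w ∈ I) ∨ (¬ TC G s ∧ ∃ p ∈ I, ∃ q ∈ p, ∃ v ∈ q, p = opair s v ∧ w ∈ v))) inferInstance (V_DDn hG)
  obtain ⟨S, hS, hSD, hC, hL⟩ := circuit_exists (V_DDn hG) (V_LF hG hz hs) (V_EP hG) (V_EN hG hz hJ) h0 (edge_wf G z (Jz z))
  have l0 : ∀ b ∈ z, nd 0 ∅ ∅ ∅ b ∈ DDn G := fun b hb =>
    (mem_DDn (by omega)).2 ⟨h.cx.em, h.cx.em, h.cx.em, h.cx.tG _ h.cx.zG hb⟩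
  have l1 : ∀ s ∈ σ, ∀ w ∈ G, nd 1 ∅ s w ∅ ∈ DDn G := fun s hs w hw =>
    (mem_DDn (by omega)).2 ⟨h.cx.em, h.cx.tG _ h.cx.sG hs, hw, h.cx.em⟩
  have k1 : ∀ s ∈ σ, ∀ w ∈ G, (nd 1 ∅ s w ∅ ∈ S ↔ ((TC G s ∧ opair s w ∈ I) ∨
      (¬ TC G s ∧ ∃ p ∈ I, ∃ q ∈ p, ∃ v ∈ q, p = opair s v ∧ w ∈ v))) := by
    intro s hs w hw
    rw [hL _ (l1 s hs w hw) (ZFSet.mem_sep.2 ⟨l1 s hs w hw, Or.inr ⟨s, hs, w, hw, rfl⟩⟩), ZFSet.mem_sep]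
    constructor
    · rintro ⟨_, ⟨b, _, e⟩ | ⟨s', hs', w', hw', e, h2⟩⟩
      · exact absurd (nd_inj.1 e).1 (by omega)
      · obtain ⟨_, _, rfl, rfl, _⟩ := nd_inj.1 e
        exact h2
    · intro h2
      exact ⟨l1 s hs w hw, Or.inr ⟨s, hs, w, hw, rfl, h2⟩⟩
  refine ⟨S, hS, hSD, h.cx, hC, ?_, ?_, ?_⟩
  · intro b hb
    rw [hL _ (l0 b hb) (ZFSet.mem_sep.2 ⟨l0 b hb, Or.inl ⟨b, hb, rfl⟩⟩), ZFSet.mem_sep]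
    constructor
    · rintro ⟨_, ⟨b', hb', e⟩ | ⟨s', hs', w', hw', e, h2⟩⟩
      · obtain ⟨_, _, _, _, rfl⟩ := nd_inj.1 e
        exact hb'
      · exact absurd (nd_inj.1 e).1 (by omega)
    · intro h2
      exact ⟨l0 b hb, Or.inl ⟨b, h2, rfl⟩⟩
  · intro s hs hk w hw
    have hc := (TC_iff (h.sk hs)).2 hk
    rw [k1 s hs w hw]
    constructor
    · rintro (⟨_, h2⟩ | ⟨h2, _⟩)
      · exact (iapp_eq hf hs h2).symm
      · exact absurd hc h2
    · rintro rfl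
      exact Or.inl ⟨hc, iapp_mem hf hs⟩
  · intro s hs hk w hw
    have hc := mt (TC_iff (h.sk hs)).1 hk
    rw [k1 s hs w hw]
    constructor
    · rintro (⟨h2, _⟩ | ⟨_, p, hp, _, _, v, _, rfl, hwv⟩)
      · exact absurd h2 hc
      · rw [iapp_eq hf hs hp]; exact hwv
    · intro hwv
      exact Or.inr ⟨hc, _, iapp_mem hf hs, _, mem_opair_l, _, by simp, rfl, hwv⟩

theorem mod_exists (h : Bx G z σ T ud th E) (hK : KX G z σ T ud th E S) (hG : G ∈ W) (hz : z ∈ W) (hs : σ ∈ W)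
    (hS : S ∈ W) : ∃ M ∈ W, Dec G z σ M S := by
  have : Fact (G ∈ W) := ⟨hG⟩
  have : Fact (z ∈ W) := ⟨hz⟩
  have : Fact (σ ∈ W) := ⟨hs⟩
  have : Fact (S ∈ W) := ⟨hS⟩
  have hR : pw W G ∪ G ∈ W := W_union (W_pw hG) hG
  have : Fact (pw W G ∪ G ∈ W) := ⟨hR⟩
  have hU := W_sep (W := W) (P := fun b => nd 0 ∅ ∅ ∅ b ∈ S) inferInstance hz
  have hI := W_sep (W := W) (P := fun p => ∃ s ∈ σ, ∃ v ∈ pw W G ∪ G, p = opair s v ∧ Cd G s v S)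
    (by unfold Cd; infer_instance) (W_prod hs hR)
  refine ⟨_, W_opair hU hI, {_, _}, mem_opair_l, _, ZFSet.mem_insert _ _,
    _, ZFSet.mem_insert_of_mem _ (ZFSet.mem_singleton.2 rfl), rfl, ⟨?_, ?_⟩, ?_, ?_⟩
  · intro b hb; exact (ZFSet.mem_sep.1 hb).1
  · intro b hb; rw [ZFSet.mem_sep]; simp [hb]
  · intro p hp
    obtain ⟨_, s, hs, v, hv, rfl, hc⟩ := ZFSet.mem_sep.1 hp
    exact ⟨s, hs, _, mem_opair_l, v, by simp, rfl, hc⟩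
  · intro s hs
    have hex : ∃ v ∈ pw W G ∪ G, Cd G s v S := by
      by_cases hc : TC G s
      · obtain ⟨w, hw, hl⟩ := leafConst_ex h hK hs hc
        exact ⟨w, ZFSet.mem_union.2 (Or.inr hw), fun _ => ⟨hw, hl⟩, fun h => absurd hc h⟩
      · have : Fact (s ∈ W) := ⟨W_trans ‹Fact (σ ∈ W)›.out hs⟩
        have hv := W_sep (W := W) (P := fun w => nd 1 ∅ s w ∅ ∈ S) inferInstance hG
        refine ⟨_, ZFSet.mem_union.2 (Or.inl (mem_pw.2 ⟨hv, ?_⟩)), fun h => absurd h hc, fun _ => ⟨?_, ?_⟩⟩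
        · intro w hw; exact (ZFSet.mem_sep.1 hw).1
        · intro w hw; exact (ZFSet.mem_sep.1 hw).1
        · intro w hw; rw [ZFSet.mem_sep]; simp [hw]
    obtain ⟨v, hv, hc⟩ := hex
    refine ⟨opair s v, ZFSet.mem_sep.2 ⟨?_, s, hs, v, hv, rfl, hc⟩, _, mem_opair_l, v, by simp, rfl, hc⟩
    have : opair s v = ZFSet.pair s v := rfl
    rw [this, ZFSet.pair_mem_prod]; exact ⟨hs, hv⟩

/-! ### Assembly -/

theorem W_Jz {z : ZFSet.{0}} (hz : z ∈ W) : XX z ∈ W ∧ Jz z ∈ W := by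
  have h1 : XX z ∈ W := by
    have : zimage (fun b => ({b} : ZFSet.{0})) z ∈ W :=
      W_image inferInstance hz (fun b hb => W_singleton (W_trans hz hb))
    exact W_insert W_empty (W_union hz this)
  refine ⟨h1, ?_⟩
  unfold Jz
  split_ifs with h
  · exact W_trans h1 h
  · exact h1

theorem bx_exists {x : ZFSet.{0}} (hx : x ∈ W) (hT : IsTCI x) : ∃ G z E, G ∈ W ∧ z ∈ W ∧ E ∈ W ∧
    x ∈ G ∧ Bx G z (tciSig x) (tciT x) (tciUdot x) (tciTheta x) E := by
  obtain ⟨e, h1, h2, h3, h4, h5, h6, h7, h8, h9, h10⟩ := hT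
  have hzd : ∃ z, z = zfst (iapp (tciTheta x) (tciUdot x)) := ⟨_, rfl⟩
  obtain ⟨z, hz⟩ := hzd
  have tW : W.IsTransitive := fun a ha b hb => W_trans ha hb
  have pull : ∀ A : ZFSet.{0}, A.IsTransitive → x ∈ A →
      tciT x ∈ A ∧ tciSig x ∈ A ∧ tciUdot x ∈ A ∧ tciTheta x ∈ A ∧ z ∈ A := by
    intro A tA hA
    rw [e] at hA
    have a1 := opair_left tA hA
    have a2 := opair_right tA hA
    have a3 := opair_left tA a2
    have a4 := opair_right tA a2
    have a5 := opair_left tA a4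
    have a6 := opair_right tA a4
    refine ⟨a1, a3, a5, a6, ?_⟩
    obtain ⟨y, i, e', _⟩ := h7 (tciUdot x) (ZFSet.mem_insert _ _)
    have b1 := tA _ a6 (iapp_mem h6 (ZFSet.mem_insert _ _))
    have b2 := opair_right tA b1
    rw [e'] at b2
    rw [hz, e', zfst_opair]
    exact opair_left tA b2
  have hzW : z ∈ W := (pull W tW hx).2.2.2.2
  obtain ⟨hX, hJ⟩ := W_Jz (W := W) hzW
  obtain ⟨G, hG, tG, xG, ZG, nat, nests⟩ := W_nests (W := W) (Z := ZZ z (Jz z)) (W_insert hJ hX) hx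
  obtain ⟨p1, p2, p3, p4, p5⟩ := pull G tG xG
  refine ⟨G, z, GE W G z, hG, hzW, W_GE hG hzW, xG, ?_⟩
  refine ⟨⟨tG, p5, p2, nat, nests⟩, ?_, h1, tG _ p1, ?_, h6, ?_, hz, ?_⟩
  · intro n l b q
    refine mem_GE hG tG nat (tG _ p5) ?_ n l b q
    intro L hL y hy
    refine nests L (fun a ha => by simp [ZZ, z_XX (hL a ha)]) y ?_
    rcases hy with hy | rfl
    · simp [ZZ, z_XX hy]
    · simp [ZZ, XX]
  · intro s y i hp
    have b := opair_right tG (tG _ p4 hp)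
    exact ⟨opair_left tG b, opair_right tG b⟩
  · intro s hs
    obtain ⟨y, i, e', hi, _⟩ := h7 s hs
    exact ⟨y, i, e', hi⟩
  · intro c hc
    obtain ⟨f, a, _, b⟩ := h10 c hc
    exact ⟨f, a, b⟩

end
end SmallExt

namespace SmallExt

/-! ### Part 13: the theorem -/

theorem MT_iff {M x : ZFSet.{0}} : ModelsTCI M x ↔ IsTCI x ∧ M = opair (zfst M) (zsnd M) ∧
    IsZFunc (zsnd M) (tciSig x) ∧ MT (tciSig x) (tciT x) (tciUdot x) (tciTheta x) (zfst M) (iapp (zsnd M)) := by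
  constructor
  · rintro ⟨a, b, c, d, e, f⟩
    exact ⟨a, b, c, d, e, f⟩
  · rintro ⟨a, b, c, d, e, f⟩
    exact ⟨a, b, c, d, e, f⟩

/-- The correspondence. -/
def Th (D Q' R : ZFSet.{0}) (K : ZFSet.{0} → Prop) (Dc : ZFSet.{0} → ZFSet.{0} → Prop) (M N : ZFSet.{0}) : Prop :=
  ∃ q ∈ N, ∃ I ∈ q, ∃ p ∈ I, ∃ q' ∈ p, ∃ S ∈ q', N = opair D (insert (opair R S) Q') ∧ S ⊆ D ∧ K S ∧ Dc M S

theorem Th_iff {D Q M N : ZFSet.{0}} {K Dc} : Th D (JJ Q) symR K Dc M N ↔ ∃ S, N = NN D Q S ∧ S ⊆ D ∧ K S ∧ Dc M S := by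
  constructor
  · rintro ⟨_, _, _, _, _, _, _, _, S, _, h⟩
    exact ⟨S, h⟩
  · rintro ⟨S, rfl, h⟩
    exact ⟨_, mem_opair_l, insert (opair symR S) (JJ Q), by simp, opair symR S, by simp, _, mem_opair_l, S, by simp, rfl, h⟩

theorem main_aux (V : ZFSet.{0}) (hV : IsCTM V) (n : ℕ) (hn : 1 ≤ n)
    (x : ZFSet.{0}) (hxV : x ∈ V) (hPi : IsPiTCI (n + 1) x) :
    ∃ x' : ZFSet.{0}, ∃ θ : Fm, IsSigmaTCI n x' ∧ Fm.memOnly θ ∧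
      (∀ a ∈ Fm.paramSet θ, a ∈ V) ∧
      (∀ W, OuterModel V W → ∀ a b, a ∈ W → b ∈ W →
        (SatV W θ (vtwo a b) ↔ SatU θ (vtwo a b))) ∧
      (∀ W, OuterModel V W →
        (∀ M, M ∈ W → ModelsTCI M x →
          ∃! N, N ∈ W ∧ ModelsTCI N x' ∧ SatV W θ (vtwo M N)) ∧
        (∀ N, N ∈ W → ModelsTCI N x' →
          ∃! M, M ∈ W ∧ ModelsTCI M x ∧ SatV W θ (vtwo M N)) ∧
        (∀ M N, M ∈ W → N ∈ W → SatV W θ (vtwo M N) →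
          ModelsTCI M x ∧ ModelsTCI N x')) := by
  have fV : Fact (IsTransModel V) := ⟨hV.1⟩
  have hT : IsTCI x := hPi.1
  obtain ⟨G, z, E, hG, hz, hE, xG, h⟩ := bx_exists (W := V) hxV hT
  have tV : V.IsTransitive := fun a ha b hb => W_trans ha hb
  obtain ⟨hJ1, hJ⟩ := W_Jz (W := V) hz
  have hp : tciT x ∈ V ∧ tciSig x ∈ V ∧ tciUdot x ∈ V ∧ tciTheta x ∈ V := by
    have hA := hxV
    rw [hT.1] at hA
    have a1 := opair_left tV hA
    have a2 := opair_right tV hA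
    have a4 := opair_right tV a2
    exact ⟨a1, opair_left tV a2, opair_left tV a4, opair_right tV a4⟩
  obtain ⟨hTV, hs, hud, hth⟩ := hp
  have hD := V_DDn (V := V) hG
  have hLf := V_LF (V := V) hG hz hs
  have hEp := V_EP (V := V) hG
  have hEn := V_EN (V := V) hG hz hJ
  have hQ := W_pw (W := V) hD
  have hJJ : JJ (pw V (DDn G)) ∈ V := by
    unfold JJ
    refine W_image (by unfold symP; infer_instance) hQ ?_
    intro B hB
    have hB := W_trans hQ hB
    exact W_opair (W_opair (W_natZ _) (W_opair (W_natZ _) (W_opair hB hB))) hB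
  have hR : symR ∈ V := W_opair (W_natZ _) (W_opair (W_natZ _) (W_natZ _))
  have tx : tciT x ⊆ G := h.TG
  obtain ⟨x', hx', hmod⟩ := clause_tci (V := V) (D := DDn G) (pw V (DDn G)) rfl (fun d hd => DDn_empty hd)
    (KX G z (tciSig x) (tciT x) (tciUdot x) (tciTheta x) E)
    (KK_CD hG hE hz hEp hEn h.cx.em (h.cx.tG _ h.cx.sG) tx (h.cx.tG _ h.cx.zG))
  have : Fact (G ∈ V) := ⟨hG⟩
  have : Fact (z ∈ V) := ⟨hz⟩
  have : Fact (E ∈ V) := ⟨hE⟩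
  have : Fact (Jz z ∈ V) := ⟨hJ⟩
  have : Fact (tciSig x ∈ V) := ⟨hs⟩
  have : Fact (tciT x ∈ V) := ⟨hTV⟩
  have : Fact (tciUdot x ∈ V) := ⟨hud⟩
  have : Fact (tciTheta x ∈ V) := ⟨hth⟩
  have : Fact (DDn G ∈ V) := ⟨hD⟩
  have : Fact (LF G z (tciSig x) ∈ V) := ⟨hLf⟩
  have : Fact (EP G ∈ V) := ⟨hEp⟩
  have : Fact (EN G z (Jz z) ∈ V) := ⟨hEn⟩
  have : Fact (JJ (pw V (DDn G)) ∈ V) := ⟨hJJ⟩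
  have : Fact (symR ∈ V) := ⟨hR⟩
  have hdd : DD V (fun v => Th (DDn G) (JJ (pw V (DDn G))) symR (KX G z (tciSig x) (tciT x) (tciUdot x) (tciTheta x) E)
      (Dec G z (tciSig x)) (v 0) (v 1)) := by
    unfold Th; infer_instance
  obtain ⟨θ, ht1, ht2, ht3⟩ := hdd.out.realize
  have hv : ∀ W, OuterModel V W → ∀ a b, a ∈ W → b ∈ W → (SatV W θ (vtwo a b) ↔
      ∃ S, b = NN (DDn G) (pw V (DDn G)) S ∧ S ⊆ DDn G ∧
        KX G z (tciSig x) (tciT x) (tciUdot x) (tciTheta x) E S ∧ Dec G z (tciSig x) a S) := by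
    intro W hW a b ha hb
    have fW : Fact (IsTransModel W) := ⟨hW.2.1.1⟩
    rw [← Th_iff]
    refine ht3 (· ∈ W) (fun c hc => hW.2.2.1 hc) (fun c d hc hd => W_trans hc hd) (vtwo a b) ?_
    intro k
    unfold vtwo
    split_ifs
    · exact ha
    · exact hb
    · exact W_empty
  have ex : ∀ M S, KX G z (tciSig x) (tciT x) (tciUdot x) (tciTheta x) E S → Dec G z (tciSig x) M S →
      ModelsTCI M x := by
    intro M S hK d
    obtain ⟨e, hf, d⟩ := d.decF h hK
    exact MT_iff.2 ⟨hT, e, hf, sol_model h hK d⟩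
  refine ⟨x', θ, hx' n hn, ht1, ht2, ?_, ?_⟩
  · intro W hW a b ha hb
    rw [hv W hW a b ha hb, ← Th_iff]
    exact (ht3 (fun _ => True) (fun _ _ => trivial) (fun _ _ _ _ => trivial) (vtwo a b) (fun _ => trivial)).symm
  · intro W hW
    have fW : Fact (IsTransModel W) := ⟨hW.2.1.1⟩
    have hVW := hW.2.2.1
    refine ⟨?_, ?_, ?_⟩
    · intro M hM hMx
      obtain ⟨_, eM, hf, m⟩ := MT_iff.1 hMx
      have tW : W.IsTransitive := fun a ha b hb => W_trans ha hb
      have hM' := hM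
      rw [eM] at hM'
      obtain ⟨S, hS, hSD, sem⟩ := sol_exists (W := W) h (hVW hG) (hVW hz) (hVW hs) (hVW hJ)
        (opair_left tW hM') (opair_right tW hM') hf
      have hK := m.sol h sem
      have hd := DecF.dec eM hf (m.dec h sem)
      have hN : NN (DDn G) (pw V (DDn G)) S ∈ W :=
        W_opair (hVW hD) (W_insert (W_opair (hVW hR) hS) (hVW hJJ))
      refine ⟨NN (DDn G) (pw V (DDn G)) S, ⟨hN, (hmod _).2 ⟨S, hSD, hK, rfl⟩,
        (hv W hW _ _ hM hN).2 ⟨S, rfl, hSD, hK, hd⟩⟩, ?_⟩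
      rintro N' ⟨hN', _, ht⟩
      obtain ⟨S', rfl, hSD', hK', hd'⟩ := (hv W hW _ _ hM hN').1 ht
      rw [Dec_unique_S h hK hK' hSD hSD' hd hd']
    · intro N hN hNx
      obtain ⟨S, hSD, hK, rfl⟩ := (hmod N).1 hNx
      have tW : W.IsTransitive := fun a ha b hb => W_trans ha hb
      have hS : S ∈ W := by
        have h1 := opair_right tW hN
        exact opair_right tW (tW _ h1 (ZFSet.mem_insert _ _))
      obtain ⟨M, hM, hd⟩ := mod_exists (W := W) h hK (hVW hG) (hVW hz) (hVW hs) hS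
      refine ⟨M, ⟨hM, ex M S hK hd, (hv W hW _ _ hM hN).2 ⟨S, rfl, hSD, hK, hd⟩⟩, ?_⟩
      rintro M' ⟨hM', _, ht⟩
      obtain ⟨S', e, hSD', hK', hd'⟩ := (hv W hW _ _ hM' hN).1 ht
      obtain rfl := NN_inj e
      exact Dec_unique_M h hK hd' hd
    · intro M N hM hN ht
      obtain ⟨S, rfl, hSD, hK, hd⟩ := (hv W hW _ _ hM hN).1 ht
      exact ⟨ex M S hK hd, (hmod _).2 ⟨S, hSD, hK, rfl⟩⟩

end SmallExt

open SmallExt in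
/-- For `1 ≤ n` and every `Π_{n+1}` TCI `𝔗` there are a
`Σ_n` TCI `𝔗'` and a formula `θ` of the language of set theory with two free
variables, absolute for outer models of `V`, defining in every outer model of
`V` a bijection from the models of `𝔗` onto the models of `𝔗'`. -/
theorem pi_np1_to_sigma_n (V : ZFSet) (hV : IsCTM V) (n : ℕ) (hn : 1 ≤ n)
    (x : ZFSet) (hxV : x ∈ V) (hPi : IsPiTCI (n + 1) x) :
    ∃ x' : ZFSet, ∃ θ : Fm, IsSigmaTCI n x' ∧ Fm.memOnly θ ∧
      (∀ a ∈ Fm.paramSet θ, a ∈ V) ∧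
      (∀ W, OuterModel V W → ∀ a b, a ∈ W → b ∈ W →
        (SatV W θ (vtwo a b) ↔ SatU θ (vtwo a b))) ∧
      (∀ W, OuterModel V W →
        (∀ M, M ∈ W → ModelsTCI M x →
          ∃! N, N ∈ W ∧ ModelsTCI N x' ∧ SatV W θ (vtwo M N)) ∧
        (∀ N, N ∈ W → ModelsTCI N x' →
          ∃! M, M ∈ W ∧ ModelsTCI M x ∧ SatV W θ (vtwo M N)) ∧
        (∀ M N, M ∈ W → N ∈ W → SatV W θ (vtwo M N) →
          ModelsTCI M x ∧ ModelsTCI N x')) := by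
  exact main_aux V hV n hn x hxV hPi
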